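/- Let A be a separable unital C*-algebra with locally finite nuclear dimension, and let α : G → Aut(A) be an action of a finite group G with the Rokhlin property. Then the fixed point algebra A^α has locally finite nuclear dimension. -/

import Mathlib

noncomputable section
set_option linter.unusedSectionVars false

open scoped ComplexOrder Matrix.Norms.L2Operator
open Filter Topology

/-- An element of a `*`-ring is *positive* (in the C*-algebraic sense) if it has the
form `star y * y`. -/
def IsPosElem {R : Type*} [Mul R] [Star R] (a : R) : Prop :=
  ∃ y : R, a = star y * y

/-- A linear functional on a unital complex `*`-algebra is a *tracial state* if it is unital,
positive and tracial. -/
def IsTracialState {R : Type*} [Ring R] [StarRing R] [Module ℂ R] (τ : R →ₗ[ℂ] ℂ) : Prop :=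
  τ 1 = 1 ∧ (∀ x : R, 0 ≤ τ (star x * x)) ∧ ∀ a b : R, τ (a * b) = τ (b * a)

/-- A linear map between complex `*`-algebras is *completely positive* if all of its matrix
amplifications map positive elements to positive elements. -/
def IsCompletelyPositive {A B : Type*} [Ring A] [StarRing A] [Module ℂ A]
    [Ring B] [StarRing B] [Module ℂ B] (φ : A →ₗ[ℂ] B) : Prop :=
  ∀ (k : ℕ) (x : Matrix (Fin k) (Fin k) A), IsPosElem x → IsPosElem (x.map φ)

/-- A map has *order zero* on a subset if it preserves orthogonality there. -/
def OrderZeroOn {F D : Type*} [Mul F] [Zero F] [Mul D] [Zero D] (φ : F → D) (s : Set F) : Prop :=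
  ∀ e ∈ s, ∀ f ∈ s, e * f = 0 → f * e = 0 → φ e * φ f = 0 ∧ φ f * φ e = 0

/-- The finite-dimensional C*-algebra `⊕_{i=1}^s M_{r i}(ℂ)`. -/
abbrev FDBlock (s : ℕ) (r : Fin s → ℕ) : Type :=
  ∀ i : Fin s, Matrix (Fin (r i)) (Fin (r i)) ℂ

/-- The elements of `⊕_{i=1}^s M_{r i}(ℂ)` supported on the blocks with label `j`. -/
def blockSupp {s : ℕ} {r : Fin s → ℕ} {n : ℕ} (J : Fin s → Fin (n + 1)) (j : Fin (n + 1)) :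
    Set (FDBlock s r) :=
  {x | ∀ i : Fin s, J i ≠ j → x i = 0}

/-- `DecompositionRankLE n D` : the C*-algebra `D` has decomposition rank at most `n`. -/
def DecompositionRankLE (n : ℕ) (D : Type*) [NormedRing D] [StarRing D]
    [NormedAlgebra ℂ D] : Prop :=
  ∀ (S : Finset D) (ε : ℝ), 0 < ε →
    ∃ (s : ℕ) (r : Fin s → ℕ) (J : Fin s → Fin (n + 1))
      (ψ : D →ₗ[ℂ] FDBlock s r) (φ : FDBlock s r →ₗ[ℂ] D),
      IsCompletelyPositive ψ ∧ IsCompletelyPositive φ ∧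
      (∀ a : D, ‖ψ a‖ ≤ ‖a‖) ∧ (∀ x : FDBlock s r, ‖φ x‖ ≤ ‖x‖) ∧
      (∀ j : Fin (n + 1), OrderZeroOn φ (blockSupp J j)) ∧
      ∀ a ∈ S, ‖φ (ψ a) - a‖ < ε

/-- `NuclearDimensionLE n D` : the C*-algebra `D` has nuclear dimension at most `n`. -/
def NuclearDimensionLE (n : ℕ) (D : Type*) [NormedRing D] [StarRing D]
    [NormedAlgebra ℂ D] : Prop :=
  ∀ (S : Finset D) (ε : ℝ), 0 < ε →
    ∃ (s : ℕ) (r : Fin s → ℕ) (J : Fin s → Fin (n + 1))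
      (ψ : D →ₗ[ℂ] FDBlock s r) (φ : FDBlock s r →ₗ[ℂ] D),
      IsCompletelyPositive ψ ∧ IsCompletelyPositive φ ∧
      (∀ a : D, ‖ψ a‖ ≤ ‖a‖) ∧
      (∀ j : Fin (n + 1), (∀ x ∈ blockSupp J j, ‖φ x‖ ≤ ‖x‖) ∧
        OrderZeroOn φ (blockSupp J j)) ∧
      ∀ a ∈ S, ‖φ (ψ a) - a‖ < ε

/-- A bundled unital C*-algebra. -/
structure CStarAlg : Type 1 where
  carrier : Type
  [str : CStarAlgebra carrier]

attribute [instance] CStarAlg.str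

/-- The *finite saturation* of a class `𝒞` of unital C*-algebras: the smallest class
containing `𝒞` which is closed under isomorphism, finite direct sums, matrix amplifications
and corners by nonzero projections. -/
inductive FinSat (𝒞 : CStarAlg → Prop) : CStarAlg → Prop
  | base {B : CStarAlg} : 𝒞 B → FinSat 𝒞 B
  | iso {B B' : CStarAlg} : FinSat 𝒞 B → Nonempty (B'.carrier ≃⋆ₐ[ℂ] B.carrier) →
      FinSat 𝒞 B'
  | sum {B₁ B₂ B : CStarAlg} : FinSat 𝒞 B₁ → FinSat 𝒞 B₂ →
      Nonempty (B.carrier ≃⋆ₐ[ℂ] (B₁.carrier × B₂.carrier)) → FinSat 𝒞 B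
  | matrix {B B' : CStarAlg} (k : ℕ) : FinSat 𝒞 B →
      Nonempty (B'.carrier ≃⋆ₐ[ℂ] Matrix (Fin (k + 1)) (Fin (k + 1)) B.carrier) →
      FinSat 𝒞 B'
  | corner {B B' : CStarAlg} (p : B.carrier) : FinSat 𝒞 B → p ≠ 0 → p * p = p →
      star p = p →
      (∃ ι : B'.carrier →⋆ₙₐ[ℂ] B.carrier, Function.Injective ι ∧ ι 1 = p ∧
        Set.range ι = {x : B.carrier | p * x * p = x}) →
      FinSat 𝒞 B'

/-- `A` is a *unital local `𝒞`-algebra*. -/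
def IsUnitalLocalAlg (𝒞 : CStarAlg → Prop) (A : Type*) [NormedRing A] [StarRing A]
    [NormedAlgebra ℂ A] : Prop :=
  ∀ (S : Finset A) (ε : ℝ), 0 < ε →
    ∃ B : CStarAlg, FinSat 𝒞 B ∧
      ∃ φ : B.carrier →⋆ₐ[ℂ] A, ∀ a ∈ S, ∃ b : B.carrier, ‖a - φ b‖ < ε

/-- The class of separable unital C*-algebras with decomposition rank at most `n`. -/
def drClass (n : ℕ) : CStarAlg → Prop :=
  fun B => TopologicalSpace.SeparableSpace B.carrier ∧ DecompositionRankLE n B.carrier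

/-- The class of separable unital C*-algebras with nuclear dimension at most `n`. -/
def nucClass (n : ℕ) : CStarAlg → Prop :=
  fun B => TopologicalSpace.SeparableSpace B.carrier ∧ NuclearDimensionLE n B.carrier

/-- The class of separable unital C*-algebras with finite nuclear dimension. -/
def lnucClass : CStarAlg → Prop :=
  fun B => TopologicalSpace.SeparableSpace B.carrier ∧ ∃ n : ℕ, NuclearDimensionLE n B.carrier

/-- A separable unital C*-algebra has *locally finite nuclear dimension* if it is a
unital local `C_lnuc`-algebra. -/
def HasLocallyFiniteNuclearDimension (A : Type*) [NormedRing A] [StarRing A]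
    [NormedAlgebra ℂ A] : Prop :=
  IsUnitalLocalAlg lnucClass A
/-! ### Group actions and the Rokhlin property -/

/-- `α : G → (A →⋆ₐ[ℂ] A)` is an action of the group `G` on `A` by *-automorphisms. -/
def IsGroupAction {G A : Type*} [Group G] [CStarAlgebra A] (α : G → (A →⋆ₐ[ℂ] A)) : Prop :=
  (∀ a : A, α 1 a = a) ∧ ∀ (g h : G) (a : A), α g (α h a) = α (g * h) a

/-- The fixed point algebra `A^α` of an action, as a star subalgebra of `A`. -/
def fixedPointAlgebra {G A : Type*} [Group G] [CStarAlgebra A] (α : G → (A →⋆ₐ[ℂ] A)) :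
    StarSubalgebra ℂ A where
  carrier := {a : A | ∀ g : G, α g a = a}
  mul_mem' := fun {a} {b} ha hb g => by rw [map_mul, ha g, hb g]
  add_mem' := fun {a} {b} ha hb g => by rw [map_add, ha g, hb g]
  algebraMap_mem' := fun c g => by rw [AlgHomClass.commutes]
  star_mem' := fun {a} ha g => by rw [map_star, ha g]

/-- The Rokhlin property for a finite group action, expressed in terms of representing
sequences for projections in `A_∞ = (ℓ^∞(ℕ,A)/c₀(ℕ,A)) ∩ A'`. -/
def ActionHasRokhlin {G A : Type*} [Group G] [Fintype G] [CStarAlgebra A]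
    (α : G → (A →⋆ₐ[ℂ] A)) : Prop :=
  ∃ e : G → ℕ → A,
    (∀ g, ∃ M : ℝ, ∀ k, ‖e g k‖ ≤ M) ∧
    (∀ g, Tendsto (fun k => ‖e g k * e g k - e g k‖) atTop (𝓝 0)) ∧
    (∀ g, Tendsto (fun k => ‖star (e g k) - e g k‖) atTop (𝓝 0)) ∧
    (∀ g (a : A), Tendsto (fun k => ‖e g k * a - a * e g k‖) atTop (𝓝 0)) ∧
    Tendsto (fun k => ‖(∑ g : G, e g k) - 1‖) atTop (𝓝 0) ∧
    (∀ g h, Tendsto (fun k => ‖α g (e h k) - e (g * h) k‖) atTop (𝓝 0))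

/-! ### Inclusions of unital C*-algebras, conditional expectations, Watatani index -/

variable {P A : Type*}

/-- `E : A →ₗ[ℂ] P` is a conditional expectation onto the subalgebra `P` (included in `A`
via the injective unital *-homomorphism `ι`). -/
structure IsCondExpect [CStarAlgebra P] [CStarAlgebra A] (ι : P →⋆ₐ[ℂ] A)
    (E : A →ₗ[ℂ] P) : Prop where
  restricts : ∀ p : P, E (ι p) = p
  pos : ∀ x : A, IsPosElem (E (star x * x))
  bimodule : ∀ (p q : P) (x : A), E (ι p * x * ι q) = p * E x * q

/-- `{(u i, v i)}` is a quasi-basis for the conditional expectation `E`; the existence of a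
quasi-basis says precisely that `E` is of index-finite type. -/
def IsQuasiBasis [CStarAlgebra P] [CStarAlgebra A] (ι : P →⋆ₐ[ℂ] A) (E : A →ₗ[ℂ] P)
    {m : ℕ} (u v : Fin m → A) : Prop :=
  ∀ a : A, (a = ∑ i, u i * ι (E (v i * a))) ∧ (a = ∑ i, ι (E (a * u i)) * v i)

/-- The Rokhlin property for a conditional expectation of index-finite type with index
`ind = ∑ u i * v i` : there is a projection `e` in `A_∞ = (ℓ^∞(ℕ,A)/c₀(ℕ,A)) ∩ A'`
(given by a representing sequence) with `E^∞(e) = (Index E)⁻¹ · 1` such that `x ↦ x e`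
is injective on `A`. -/
def CondExpectHasRokhlin [CStarAlgebra P] [CStarAlgebra A] (ι : P →⋆ₐ[ℂ] A)
    (E : A →ₗ[ℂ] P) (ind : A) : Prop :=
  ∃ e : ℕ → A,
    (∃ M : ℝ, ∀ k, ‖e k‖ ≤ M) ∧
    Tendsto (fun k => ‖e k * e k - e k‖) atTop (𝓝 0) ∧
    Tendsto (fun k => ‖star (e k) - e k‖) atTop (𝓝 0) ∧
    (∀ a : A, Tendsto (fun k => ‖e k * a - a * e k‖) atTop (𝓝 0)) ∧
    (∃ w : A, w * ind = 1 ∧ ind * w = 1 ∧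
      Tendsto (fun k => ‖ι (E (e k)) - w‖) atTop (𝓝 0)) ∧
    (∀ x : A, Tendsto (fun k => ‖x * e k‖) atTop (𝓝 0) → x = 0)

/-! ### Cuntz comparison, dimension functions, strict comparison, almost divisibility -/

/-- Cuntz subequivalence for positive matrices over a C*-algebra (the topology on matrices
over a C*-algebra is the norm topology, which agrees with the product topology). -/
def CuntzSub {R : Type*} [NonUnitalNonAssocSemiring R] [Star R] [TopologicalSpace R]
    {m k : Type*} [Fintype m] [Fintype k] (a : Matrix m m R) (b : Matrix k k R) : Prop :=
  ∃ v : ℕ → Matrix m k R, Tendsto (fun j => v j * b * (v j).conjTranspose) atTop (𝓝 a)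

/-- `matNthRoot a j` is the (unique, if it exists) positive `j`-th root `a^{1/j}` of a
positive matrix `a` over a C*-algebra. -/
def matNthRoot {R : Type*} [Ring R] [StarRing R] {m : Type*} [Fintype m] [DecidableEq m]
    (a : Matrix m m R) (j : ℕ) : Matrix m m R :=
  open scoped Classical in
  if h : ∃ b : Matrix m m R, IsPosElem b ∧ b ^ j = a then h.choose else 0

/-- The standard extension `τ ⊗ Tr` of a functional `τ` to matrices. -/
def traceExt {R : Type*} [Ring R] [Module ℂ R] {m : Type*} [Fintype m]
    (τ : R →ₗ[ℂ] ℂ) (x : Matrix m m R) : ℂ :=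
  ∑ i, τ (x i i)

/-- The dimension function `d_τ(a) = lim_{n → ∞} τ(a^{1/n})` associated to a tracial
state `τ` (the limit exists, so it agrees with the `limsup` used here). -/
def dimFun {R : Type*} [Ring R] [StarRing R] [Module ℂ R] {m : Type*} [Fintype m]
    [DecidableEq m] (τ : R →ₗ[ℂ] ℂ) (a : Matrix m m R) : ℝ :=
  Filter.limsup (fun j : ℕ => (traceExt τ (matNthRoot a (j + 1))).re) atTop

/-- A unital C*-algebra `R` has *strict comparison* (of positive elements, with respect to
tracial states) if `d_τ(a) < d_τ(b)` for all tracial states `τ` implies `a ≾ b`. -/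
def HasStrictComparison (R : Type*) [Ring R] [StarRing R] [Module ℂ R]
    [TopologicalSpace R] : Prop :=
  ∀ (m k : ℕ) (a : Matrix (Fin m) (Fin m) R) (b : Matrix (Fin k) (Fin k) R),
    IsPosElem a → IsPosElem b →
    (∀ τ : R →ₗ[ℂ] ℂ, IsTracialState τ → dimFun τ a < dimFun τ b) →
    CuntzSub a b

/-- The Cuntz semigroup `W(R)` is *almost divisible*: for every positive contraction `a`
over `R` and every `k ≠ 0` there is `x = ⟨c⟩ ∈ W(R)` with `k ⬝ x ≤ ⟨a⟩ ≤ (k+1) ⬝ x`. -/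
def AlmostDivisible (R : Type*) [Ring R] [StarRing R] [TopologicalSpace R] : Prop :=
  ∀ (m : ℕ) (a : Matrix (Fin m) (Fin m) R),
    IsPosElem a → IsPosElem ((1 : Matrix (Fin m) (Fin m) R) - a) →
    ∀ k : ℕ, k ≠ 0 →
      ∃ (l : ℕ) (c : Matrix (Fin l) (Fin l) R), IsPosElem c ∧
        CuntzSub (Matrix.blockDiagonal fun _ : Fin k => c) a ∧
        CuntzSub a (Matrix.blockDiagonal fun _ : Fin (k + 1) => c)

/-- A unital C*-algebra is *pure* if it has strict comparison and almost divisible Cuntz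
semigroup. -/
def IsPure (R : Type*) [Ring R] [StarRing R] [Module ℂ R] [TopologicalSpace R] : Prop :=
  HasStrictComparison R ∧ AlmostDivisible R

/-- The order on projections over `R` is determined by traces. -/
def ProjOrderDeterminedByTraces (R : Type*) [Ring R] [StarRing R] [Module ℂ R] : Prop :=
  ∀ (k l : ℕ) (p : Matrix (Fin k) (Fin k) R) (q : Matrix (Fin l) (Fin l) R),
    p * p = p → star p = p → q * q = q → star q = q →
    (∀ τ : R →ₗ[ℂ] ℂ, IsTracialState τ → (traceExt τ p).re < (traceExt τ q).re) →
    ∃ v : Matrix (Fin l) (Fin k) R,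
      v.conjTranspose * v = p ∧ IsPosElem (q - v * v.conjTranspose)

/-- A unital C*-algebra has stable rank one if its invertible elements are dense. -/
def HasStableRankOne (R : Type*) [Ring R] [TopologicalSpace R] : Prop :=
  Dense {x : R | IsUnit x}

/-- A unital C*-algebra is simple if it has no nontrivial closed two-sided ideals. -/
def IsSimpleCStarAlgebra (A : Type*) [CStarAlgebra A] : Prop :=
  ∀ I : TwoSidedIdeal A, IsClosed (I : Set A) → I = ⊥ ∨ I = ⊤
/-! ### Corners `pRp` by a projection `p` -/

section CornerSection

variable {R : Type*} [Ring R] [StarRing R] [Algebra ℂ R] [StarModule ℂ R]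

/-- The corner `p R p` of a unital C*-algebra `R` by a projection `p`, as a unital
`*`-algebra with unit `p`. -/
def Corner (p : R) (_hp : p * p = p) (_hsp : star p = p) : Type _ :=
  {x : R // p * x * p = x}

namespace Corner

variable {p : R} {hp : p * p = p} {hsp : star p = p}

theorem mem_mul_left (hp : p * p = p) {x : R} (hx : p * x * p = x) : p * x = x := by
  conv_lhs => rw [← hx]
  simp only [← mul_assoc]
  rw [hp, hx]

theorem mem_mul_right (hp : p * p = p) {x : R} (hx : p * x * p = x) : x * p = x := by
  conv_lhs => rw [← hx]
  rw [mul_assoc, mul_assoc, hp, ← mul_assoc, hx]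

instance : Add (Corner p hp hsp) :=
  ⟨fun x y => ⟨x.1 + y.1, by rw [mul_add, add_mul, x.2, y.2]⟩⟩

instance : Zero (Corner p hp hsp) :=
  ⟨⟨0, by rw [mul_zero, zero_mul]⟩⟩

instance : Neg (Corner p hp hsp) :=
  ⟨fun x => ⟨-x.1, by rw [mul_neg, neg_mul, x.2]⟩⟩

instance : Mul (Corner p hp hsp) :=
  ⟨fun x y => ⟨x.1 * y.1, by
    rw [← mul_assoc p x.1 y.1, mem_mul_left hp x.2, mul_assoc x.1 y.1 p,
      mem_mul_right hp y.2]⟩⟩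

instance : One (Corner p hp hsp) :=
  ⟨⟨p, by rw [hp, hp]⟩⟩

instance : SMul ℂ (Corner p hp hsp) :=
  ⟨fun c x => ⟨c • x.1, by rw [mul_smul_comm, smul_mul_assoc, x.2]⟩⟩

instance : Star (Corner p hp hsp) :=
  ⟨fun x => ⟨star x.1, by
    conv_rhs => rw [← x.2]
    rw [star_mul, star_mul, hsp, ← mul_assoc]⟩⟩

@[simp] theorem val_add (x y : Corner p hp hsp) : (x + y).1 = x.1 + y.1 := rfl
@[simp] theorem val_mul (x y : Corner p hp hsp) : (x * y).1 = x.1 * y.1 := rfl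
@[simp] theorem val_zero : (0 : Corner p hp hsp).1 = 0 := rfl
@[simp] theorem val_one : (1 : Corner p hp hsp).1 = p := rfl
@[simp] theorem val_neg (x : Corner p hp hsp) : (-x).1 = -x.1 := rfl
@[simp] theorem val_smul (c : ℂ) (x : Corner p hp hsp) : (c • x).1 = c • x.1 := rfl
@[simp] theorem val_star (x : Corner p hp hsp) : (star x).1 = star x.1 := rfl

instance instRing : Ring (Corner p hp hsp) where
  add_assoc x y z := Subtype.ext <| by simp [add_assoc]
  zero_add x := Subtype.ext <| by simp
  add_zero x := Subtype.ext <| by simp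
  add_comm x y := Subtype.ext <| by simp [add_comm]
  neg_add_cancel x := Subtype.ext <| by simp
  nsmul := nsmulRec
  zsmul := zsmulRec
  mul_assoc x y z := Subtype.ext <| by simp [mul_assoc]
  one_mul x := Subtype.ext <| by simpa using mem_mul_left hp x.2
  mul_one x := Subtype.ext <| by simpa using mem_mul_right hp x.2
  left_distrib x y z := Subtype.ext <| by simp [left_distrib]
  right_distrib x y z := Subtype.ext <| by simp [right_distrib]
  zero_mul x := Subtype.ext <| by simp
  mul_zero x := Subtype.ext <| by simp

instance instStarRing : StarRing (Corner p hp hsp) where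
  star_involutive x := Subtype.ext <| by simp
  star_mul x y := Subtype.ext <| by simp
  star_add x y := Subtype.ext <| by simp

instance instModule : Module ℂ (Corner p hp hsp) where
  one_smul x := Subtype.ext <| by simp
  mul_smul c d x := Subtype.ext <| by simp [mul_smul]
  smul_zero c := Subtype.ext <| by simp
  smul_add c x y := Subtype.ext <| by simp
  add_smul c d x := Subtype.ext <| by simp [add_smul]
  zero_smul x := Subtype.ext <| by simp

instance instTop [TopologicalSpace R] : TopologicalSpace (Corner p hp hsp) :=
  instTopologicalSpaceSubtype

end Corner

end CornerSection

/-! ### Sequence algebras: `A^∞ = ℓ^∞(ℕ, A)/c₀(ℕ, A)` via representing sequences -/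

/-- A sequence in a normed space is null (i.e. lies in `c₀(ℕ, A)`). -/
def IsNullSeq {A : Type*} [Norm A] (x : ℕ → A) : Prop :=
  Tendsto (fun n => ‖x n‖) atTop (𝓝 0)

/-- A sequence in a normed space is bounded (i.e. lies in `ℓ^∞(ℕ, A)`). -/
def IsBddSeq {A : Type*} [Norm A] (x : ℕ → A) : Prop :=
  ∃ M : ℝ, ∀ n, ‖x n‖ ≤ M

/-- A linear map `β : A →ₗ[ℂ] ℓ^∞(ℕ, P)` represents a unital *-homomorphism
`A → P^∞ = ℓ^∞(ℕ, P)/c₀(ℕ, P)` : it takes values in bounded sequences and is unital,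
multiplicative and star-preserving modulo `c₀(ℕ, P)`. -/
structure RepresentsHomToSeqAlg {A P : Type*} [CStarAlgebra A] [CStarAlgebra P]
    (β : A →ₗ[ℂ] (ℕ → P)) : Prop where
  bdd : ∀ x : A, IsBddSeq (β x)
  unital : IsNullSeq (β 1 - 1)
  mul : ∀ x y : A, IsNullSeq (β (x * y) - β x * β y)
  star : ∀ x : A, IsNullSeq (β (star x) - star (β x))

/-- A Banach limit: a linear functional on (bounded) complex sequences which is unital,
shift-invariant, positive and bounded. -/
structure IsBanachLimit (L : (ℕ → ℂ) →ₗ[ℂ] ℂ) : Prop where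
  unital : L 1 = 1
  shift : ∀ x : ℕ → ℂ, IsBddSeq x → L (fun n => x (n + 1)) = L x
  pos : ∀ x : ℕ → ℂ, IsBddSeq x → (∀ n, 0 ≤ x n) → 0 ≤ L x
  norm_le : ∀ (x : ℕ → ℂ) (M : ℝ), (∀ n, ‖x n‖ ≤ M) → ‖L x‖ ≤ M

/-- A C*-algebra is *exact* iff it is nuclearly embeddable (Kirchberg): it admits a faithful
representation `π : A → B(H)` which approximately factors through matrix algebras by
completely positive contractions in the point-norm topology. -/
def IsExactCStar (A : Type*) [CStarAlgebra A] : Prop :=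
  ∃ (H : Type) (_ : NormedAddCommGroup H) (_ : InnerProductSpace ℂ H) (_ : CompleteSpace H)
    (π : A →⋆ₐ[ℂ] (H →L[ℂ] H)), Function.Injective π ∧
      ∀ (S : Finset A) (ε : ℝ), 0 < ε →
        ∃ (k : ℕ) (ψ : A →ₗ[ℂ] Matrix (Fin k) (Fin k) ℂ)
          (φ : Matrix (Fin k) (Fin k) ℂ →ₗ[ℂ] (H →L[ℂ] H)),
          IsCompletelyPositive ψ ∧ IsCompletelyPositive φ ∧
          (∀ a : A, ‖ψ a‖ ≤ ‖a‖) ∧ (∀ x, ‖φ x‖ ≤ ‖x‖) ∧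
          ∀ a ∈ S, ‖φ (ψ a) - π a‖ < ε


section generic
variable {E : Type*} [CStarAlgebra E] [PartialOrder E] [StarOrderedRing E]

theorem isPos_iff {a : E} : IsPosElem a ↔ 0 ≤ a := by
  rw [CStarAlgebra.nonneg_iff_eq_star_mul_self]; rfl

theorem norm_le_of_sq_le {a : E} {c : ℝ} (hc : 0 ≤ c) (h : star a * a ≤ algebraMap ℝ E (c ^ 2)) :
    ‖a‖ ≤ c := by
  have h1 : ‖star a * a‖ ≤ c ^ 2 :=
    (CStarAlgebra.norm_le_iff_le_algebraMap _ (by positivity) (star_mul_self_nonneg a)).2 h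
  rw [CStarRing.norm_star_mul_self] at h1
  nlinarith [norm_nonneg a]

theorem norm_mul_eq_of_sq {x a y : E} (h : star x * x = star a * a) : ‖x * y‖ = ‖a * y‖ := by
  have h1 : ‖x * y‖ * ‖x * y‖ = ‖a * y‖ * ‖a * y‖ := by
    rw [← CStarRing.norm_star_mul_self, ← CStarRing.norm_star_mul_self, star_mul, star_mul,
      mul_assoc, mul_assoc, ← mul_assoc (star x), h, mul_assoc]
  exact (mul_self_inj_of_nonneg (norm_nonneg _) (norm_nonneg _)).1 h1

/-- Cauchy–Schwarz. -/
theorem cs_sq_le {ι : Type*} [Fintype ι] (z y : ι → E) (hz : ∑ i, z i * star (z i) ≤ 1) :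
    star (∑ i, z i * star (y i)) * (∑ i, z i * star (y i)) ≤ ∑ i, y i * star (y i) := by
  obtain ⟨u, hu⟩ : ∃ u, u = ∑ i, z i * star (y i) := ⟨_, rfl⟩
  rw [← hu]
  have hus : star u = ∑ i, y i * star (z i) := by
    simp [hu, star_sum]
  have h0 : 0 ≤ ∑ i, (y i - star u * z i) * star (y i - star u * z i) :=
    Finset.sum_nonneg fun i _ => mul_star_self_nonneg _
  have h1 : ∑ i, (y i - star u * z i) * star (y i - star u * z i) =
      ∑ i, y i * star (y i) - star u * u - star u * u + star u * (∑ i, z i * star (z i)) * u := by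
    have e1 : star u * (∑ i, z i * star (y i)) = ∑ i, star u * (z i * star (y i)) :=
      Finset.mul_sum _ _ _
    have e2 : (∑ i, y i * star (z i)) * u = ∑ i, y i * star (z i) * u :=
      Finset.sum_mul _ _ _
    rw [← hu] at e1
    rw [← hus] at e2
    have e3 : star u * (∑ i, z i * star (z i)) * u = ∑ i, star u * (z i * star (z i)) * u := by
      rw [Finset.mul_sum, Finset.sum_mul]
    rw [e3]
    conv_rhs => enter [1, 2]; rw [e1]
    conv_rhs => enter [1, 1, 2]; rw [e2]
    rw [← Finset.sum_sub_distrib, ← Finset.sum_sub_distrib, ← Finset.sum_add_distrib]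
    refine Finset.sum_congr rfl fun i _ => ?_
    simp only [star_sub, star_mul, star_star]
    noncomm_ring
  have h2 : star u * (∑ i, z i * star (z i)) * u ≤ star u * u := by
    have := star_left_conjugate_le_conjugate hz u
    simpa using this
  rw [h1] at h0
  have h3 := add_le_add_right h2 (∑ i, y i * star (y i) - star u * u - star u * u)
  have h4 := h0.trans h3
  have h5 : ∑ i, y i * star (y i) - star u * u - star u * u + star u * u
    = ∑ i, y i * star (y i) - star u * u := by abel
  rw [h5] at h4
  exact sub_nonneg.1 h4

theorem cs_norm_le {ι : Type*} [Fintype ι] (z y : ι → E) (hz : ∑ i, z i * star (z i) ≤ 1)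
    {c : ℝ} (hc : 0 ≤ c) (hy : ∑ i, y i * star (y i) ≤ algebraMap ℝ E (c ^ 2)) :
    ‖∑ i, z i * star (y i)‖ ≤ c :=
  norm_le_of_sq_le hc ((cs_sq_le z y hz).trans hy)

theorem cmul {a : E} {f g : ℝ → ℝ} (hf : Continuous f) (hg : Continuous g) :
    cfc f a * cfc g a = cfc (fun t => f t * g t) a :=
  (cfc_mul f g a hf.continuousOn hg.continuousOn).symm

theorem cidmul {a : E} (ha : IsSelfAdjoint a) {f : ℝ → ℝ} (hf : Continuous f) :
    a * cfc f a = cfc (fun t => t * f t) a := by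
  rw [cfc_mul (fun t => t) f a continuous_id.continuousOn hf.continuousOn, cfc_id' ℝ a]

theorem cmulid {a : E} (ha : IsSelfAdjoint a) {f : ℝ → ℝ} (hf : Continuous f) :
    cfc f a * a = cfc (fun t => f t * t) a := by
  rw [cfc_mul f (fun t => t) a hf.continuousOn continuous_id.continuousOn, cfc_id' ℝ a]

theorem csub {a : E} {f g : ℝ → ℝ} (hf : Continuous f) (hg : Continuous g) :
    cfc f a - cfc g a = cfc (fun t => f t - g t) a :=
  (cfc_sub f g a hf.continuousOn hg.continuousOn).symm

theorem cmono {a : E} {f g : ℝ → ℝ} (hf : Continuous f) (hg : Continuous g)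
    (h : ∀ x ∈ spectrum ℝ a, f x ≤ g x) : cfc f a ≤ cfc g a :=
  cfc_mono h hf.continuousOn hg.continuousOn

theorem csa (f : ℝ → ℝ) (a : E) : star (cfc f a) = cfc f a :=
  (cfc_predicate (p := IsSelfAdjoint) f a).star_eq

theorem cnorm {a : E} {f : ℝ → ℝ} {c : ℝ} (hc : 0 ≤ c) (h : ∀ x ∈ spectrum ℝ a, |f x| ≤ c) :
    ‖cfc f a‖ ≤ c := norm_cfc_le hc h

theorem norm_le_of_nonneg_le {a : E} {c : ℝ} (hc : 0 ≤ c) (h0 : 0 ≤ a)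
    (h : a ≤ algebraMap ℝ E c) : ‖a‖ ≤ c :=
  (CStarAlgebra.norm_le_iff_le_algebraMap _ hc h0).2 h

theorem conj_le {a b : E} (h : a ≤ b) (c : E) : c * a * star c ≤ c * b * star c :=
  star_right_conjugate_le_conjugate h c

theorem conj_le' {a b : E} (h : a ≤ b) (c : E) : star c * a * c ≤ star c * b * c :=
  star_left_conjugate_le_conjugate h c

theorem polar {r x : E} (hr : 0 ≤ r) (h : r * r ≤ star x * x) :
    ∃ v ∈ closure (Set.range (fun y => x * y)), star v * v = r * r ∧
      ‖v - x‖ ≤ ‖r - CFC.sqrt (star x * x)‖ := by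
  set a := CFC.sqrt (star x * x) with ha
  have ha0 : 0 ≤ a := CFC.sqrt_nonneg _
  have hasa : IsSelfAdjoint a := .of_nonneg ha0
  have hrsa : IsSelfAdjoint r := .of_nonneg hr
  have haa : a * a = star x * x := CFC.sqrt_mul_sqrt_self _ (star_mul_self_nonneg x)
  have hxa : star x * x = star a * a := by rw [hasa.star_eq, haa]
  have hspec : ∀ t ∈ spectrum ℝ a, 0 ≤ t := fun t ht => spectrum_nonneg_of_nonneg ha0 ht
  -- functions
  let ep : ℕ → ℝ := fun n => 1 / ((n : ℝ) + 1)
  have hep : ∀ n, 0 < ep n := fun n => by positivity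
  have hepl : Tendsto ep atTop (𝓝 0) := tendsto_one_div_add_atTop_nhds_zero_nat
  let f : ℕ → ℝ → ℝ := fun n t => (max t 0 + ep n)⁻¹
  have hfpos : ∀ n t, 0 < max t 0 + ep n := fun n t =>
    add_pos_of_nonneg_of_pos (le_max_right _ _) (hep n)
  have hfc : ∀ n, Continuous (f n) := fun n =>
    Continuous.inv₀ (by fun_prop) fun t => (hfpos n t).ne'
  let c : ℕ → E := fun n => cfc (f n) a
  have hest : ∀ n, ‖a * c n * r - r‖ ≤ ep n := by
    intro n
    set d : E := cfc (fun t => t * f n t - 1) a with hd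
    have hd1 : a * c n * r - r = d * r := by
      have : d = a * c n - 1 := by
        rw [hd, ← csub (by fun_prop) (by fun_prop), cfc_const_one ℝ a, cidmul hasa (hfc n)]
      rw [this]; noncomm_ring
    have hds : star d = d := csa _ _
    rw [hd1, ← norm_star, star_mul, hds, hrsa.star_eq]
    apply norm_le_of_sq_le (hep n).le
    rw [star_mul, hds, hrsa.star_eq]
    have h1 : d * r * (r * d) ≤ d * (a * a) * d := by
      have := conj_le h d
      rw [hds, ← haa] at this
      simpa [mul_assoc] using this
    refine h1.trans ?_
    have h2 : d * (a * a) * d = star (a * d) * (a * d) := by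
      rw [star_mul, hds, hasa.star_eq]; noncomm_ring
    rw [h2]
    have h3 : ‖a * d‖ ≤ ep n := by
      rw [hd, cidmul hasa (by fun_prop)]
      refine cnorm (hep n).le fun t ht => ?_
      have ht0 := hspec t ht
      have : t * (t * f n t - 1) = - (ep n * (t / (t + ep n))) := by
        simp only [f, max_eq_left ht0]
        have := hep n
        field_simp
        ring
      rw [this, abs_neg, abs_of_nonneg (by have := hep n; positivity)]
      have : t / (t + ep n) ≤ 1 := by
        have := hep n
        rw [div_le_one (by positivity)]; linarith
      nlinarith [hep n]
    refine (CStarAlgebra.norm_le_iff_le_algebraMap _ (by positivity)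
      (star_mul_self_nonneg _)).1 ?_
    rw [CStarRing.norm_star_mul_self]
    nlinarith [norm_nonneg (a * d)]
  let v : ℕ → E := fun n => x * (c n * r)
  have hbl : Tendsto (fun n => a * c n * r) atTop (𝓝 r) := by
    rw [tendsto_iff_norm_sub_tendsto_zero]
    exact squeeze_zero (fun _ => norm_nonneg _) hest hepl
  have hcau : CauchySeq v := by
    refine cauchySeq_of_le_tendsto_0 (fun n => 2 * ep n) (fun n m N hn hm => ?_) ?_
    · rw [dist_eq_norm]
      have h1 : v n - v m = x * (c n * r - c m * r) := by simp [v, mul_sub]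
      rw [h1, norm_mul_eq_of_sq hxa]
      have h2 : a * (c n * r - c m * r) = (a * c n * r - r) - (a * c m * r - r) := by noncomm_ring
      rw [h2]
      refine (norm_sub_le _ _).trans ?_
      have hmono : ∀ p q : ℕ, p ≤ q → ep q ≤ ep p := fun p q hpq =>
        one_div_le_one_div_of_le (by positivity) (by gcongr)
      have := hest n; have := hest m; have := hmono _ _ hn; have := hmono _ _ hm
      linarith
    · simpa using hepl.const_mul 2
  obtain ⟨v0, hv0⟩ := cauchySeq_tendsto_of_complete hcau
  refine ⟨v0, ?_, ?_, ?_⟩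
  · refine mem_closure_of_tendsto hv0 (Eventually.of_forall fun n => ⟨c n * r, rfl⟩)
  · have h1 : Tendsto (fun n => star (v n) * v n) atTop (𝓝 (star v0 * v0)) :=
      (continuous_star.tendsto _ |>.comp hv0).mul hv0
    have h2 : Tendsto (fun n => star (a * c n * r) * (a * c n * r)) atTop (𝓝 (star r * r)) :=
      (continuous_star.tendsto _ |>.comp hbl).mul hbl
    have h3 : ∀ n, star (v n) * v n = star (a * c n * r) * (a * c n * r) := fun n => by
      have : star (v n) * v n = star (c n * r) * (star x * x) * (c n * r) := by
        simp only [v, star_mul]; noncomm_ring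
      rw [this, hxa]
      simp only [star_mul]; noncomm_ring
    rw [hrsa.star_eq] at h2
    simp only [h3] at h1
    exact tendsto_nhds_unique h1 h2
  · have h1 : Tendsto (fun n => ‖v n - x‖) atTop (𝓝 ‖v0 - x‖) := (hv0.sub_const x).norm
    have h2 : Tendsto (fun n => ‖a * c n * r - a‖) atTop (𝓝 ‖r - a‖) := (hbl.sub_const a).norm
    have h3 : ∀ n, ‖v n - x‖ = ‖a * c n * r - a‖ := fun n => by
      have e1 : v n - x = x * (c n * r - 1) := by simp [v, mul_sub]
      have e2 : a * c n * r - a = a * (c n * r - 1) := by noncomm_ring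
      rw [e1, e2, norm_mul_eq_of_sq hxa]
    simp only [h3] at h1
    exact (tendsto_nhds_unique h1 h2).le

theorem csq {a : E} (ha : IsSelfAdjoint a) : a * a = cfc (fun t : ℝ => t * t) a := by
  have := cidmul ha (f := fun t => t) continuous_id
  rwa [cfc_id' ℝ a] at this

theorem spec_le_one {a : E} (ha : IsSelfAdjoint a) (h : a ≤ 1) : ∀ t ∈ spectrum ℝ a, t ≤ 1 :=
  (le_algebraMap_iff_spectrum_le (R := ℝ) (r := 1) (a := a)).1 (by simpa using h)

theorem sq_le_self {a : E} (h0 : 0 ≤ a) (h1 : a ≤ 1) : a * a ≤ a := by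
  have hs : IsSelfAdjoint a := .of_nonneg h0
  rw [csq hs]
  conv_rhs => rw [← cfc_id' ℝ a]
  refine cmono (by fun_prop) (by fun_prop) fun t ht => ?_
  nlinarith [spectrum_nonneg_of_nonneg h0 ht, spec_le_one hs h1 t ht]

theorem one_norm_le (E : Type*) [CStarAlgebra E] : ‖(1 : E)‖ ≤ 1 := by
  rcases subsingleton_or_nontrivial E with _ | _
  · rw [Subsingleton.elim (1 : E) 0]; simp
  · simp

set_option maxHeartbeats 1000000 in
theorem rordam {k e : E} {η γ : ℝ} (hk0 : 0 ≤ k) (hk1 : k ≤ 1) (he0 : 0 ≤ e) (he1 : e ≤ 1)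
    (hη : 0 < η) (hη1 : η ≤ 1) (hγ0 : 0 ≤ γ) (hγ : γ ≤ η ^ 4 / 4)
    (hek : (1 - e) * k * (1 - e) ≤ algebraMap ℝ E γ) :
    ∃ v ∈ closure (Set.range (fun y => e * y)), ‖v‖ ≤ 1 ∧ ‖(v - 1) * k‖ ≤ 3 * η ∧
      ∀ w, Commute k w → Commute (star v * v) w := by
  have hks : IsSelfAdjoint k := .of_nonneg hk0
  have hes : IsSelfAdjoint e := .of_nonneg he0
  have hspec : ∀ t ∈ spectrum ℝ k, 0 ≤ t := fun t ht => spectrum_nonneg_of_nonneg hk0 ht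
  have hspec1 : ∀ t ∈ spectrum ℝ k, t ≤ 1 := by
    exact spec_le_one hks hk1
  have h1e : star (1 - e) = 1 - e := by rw [star_sub, star_one, hes.star_eq]
  -- ‖(1-e)k‖ small
  have hA : ‖(1 - e) * k‖ ≤ η ^ 2 / 2 := by
    rw [← norm_star, star_mul, h1e, hks.star_eq]
    apply norm_le_of_sq_le (by positivity)
    rw [star_mul, h1e, hks.star_eq]
    have hkk : k * k ≤ k := sq_le_self hk0 hk1
    have h3 : (1 - e) * k * (k * (1 - e)) ≤ (1 - e) * k * (1 - e) := by
      have := conj_le hkk (1 - e)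
      rw [h1e] at this
      simpa [mul_assoc] using this
    refine h3.trans (hek.trans ?_)
    have : γ ≤ (η ^ 2 / 2) ^ 2 := by nlinarith
    exact algebraMap_mono E this
  -- functions
  let l : ℝ → ℝ := fun t => max (t - η) 0 / max t η
  have hmp : ∀ t, 0 < max t η := fun t => lt_max_of_lt_right hη
  have hl : Continuous l := Continuous.div (by fun_prop) (by fun_prop) fun t => (hmp t).ne'
  let m : ℝ → ℝ := fun t => (max t η)⁻¹
  have hm : Continuous m := Continuous.inv₀ (by fun_prop) fun t => (hmp t).ne'
  let q : ℝ → ℝ := fun t => Real.sqrt (t ^ 2 - η ^ 2)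
  have hq : Continuous q := by fun_prop
  let ρ : ℝ → ℝ := fun t => l t * q t
  have hρ : Continuous ρ := hl.mul hq
  have hl0 : ∀ t, 0 ≤ l t := fun t => div_nonneg (le_max_right _ _) (hmp t).le
  have hl1 : ∀ t, l t ≤ 1 := fun t => by
    rw [div_le_one (hmp t)]
    exact max_le (le_trans (by linarith) (le_max_left _ _)) (hmp t).le
  have hlt : ∀ t, t ≤ η → l t = 0 := fun t ht => by
    simp only [l]; rw [max_eq_right (by linarith), zero_div]
  have hlq : ∀ t, 0 ≤ t → ρ t * ρ t = l t * (t * t - η ^ 2) * l t := fun t ht => by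
    rcases le_total t η with h | h
    · simp only [ρ, hlt t h]; ring
    · have : q t * q t = t ^ 2 - η ^ 2 := Real.mul_self_sqrt (by nlinarith)
      simp only [ρ]
      linear_combination (l t) ^ 2 * this
  set r := cfc ρ k with hr
  set lk := cfc l k with hl'
  have hr0 : 0 ≤ r := cfc_nonneg fun t _ => mul_nonneg (hl0 t) (Real.sqrt_nonneg _)
  have hls : star lk = lk := csa _ _
  have hrs : star r = r := csa _ _
  set x := e * (k * lk) with hx
  -- Y - r^2
  have hrr : r * r = lk * (k * k - algebraMap ℝ E (η ^ 2)) * lk := by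
    have h2 := csq hks
    rw [h2, ← cfc_const (η ^ 2) k, csub (by fun_prop) (by fun_prop), hl', hr, cmul hρ hρ,
      cmul hl (by fun_prop), cmul (by fun_prop) hl]
    exact cfc_congr fun t ht => hlq t (hspec t ht)
  have hY : star x * x = lk * (k * (e * e) * k) * lk := by
    simp only [hx, star_mul, hls, hks.star_eq, hes.star_eq]; noncomm_ring
  have hee : e * e ≤ 1 := (sq_le_self he0 he1).trans he1
  have hne : ‖e‖ ≤ 1 := by
    refine norm_le_of_nonneg_le zero_le_one he0 (by simpa using he1)
  have hB : k * k - k * (e * e) * k ≤ algebraMap ℝ E (η ^ 2) := by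
    have h1 : k * k - k * (e * e) * k = star ((1 - e) * k) * ((1 + e) * k) := by
      rw [star_mul, h1e, hks.star_eq]; noncomm_ring
    have hsa : IsSelfAdjoint (k * k - k * (e * e) * k) := by
      rw [IsSelfAdjoint]; simp [hks.star_eq, hes.star_eq, mul_assoc]
    have hkn : ‖k‖ ≤ 1 := norm_le_of_nonneg_le zero_le_one hk0 (by simpa using hk1)
    have h1n := one_norm_le E
    have h2 : ‖k * k - k * (e * e) * k‖ ≤ η ^ 2 := by
      rw [h1]
      refine (norm_mul_le _ _).trans ?_
      rw [norm_star]
      have h3 : ‖(1 + e) * k‖ ≤ 2 := by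
        refine (norm_mul_le _ _).trans ?_
        have := norm_add_le 1 e
        nlinarith [norm_nonneg (1 + e), norm_nonneg k]
      nlinarith [norm_nonneg ((1 - e) * k), norm_nonneg ((1 + e) * k)]
    refine hsa.le_algebraMap_norm_self.trans (algebraMap_mono E h2)
  have hlow : r * r ≤ star x * x := by
    rw [hrr, hY]
    have := conj_le (show k * k - algebraMap ℝ E (η ^ 2) ≤ k * (e * e) * k by
      rw [sub_le_iff_le_add, ← sub_le_iff_le_add']; exact hB) lk
    rwa [hls] at this
  have hup : star x * x ≤ (r + algebraMap ℝ E η) * (r + algebraMap ℝ E η) := by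
    have h1 : star x * x ≤ lk * (k * k) * lk := by
      rw [hY]
      have := conj_le (conj_le hee k) lk
      rw [hls, hks.star_eq, mul_one] at this
      exact this
    refine h1.trans ?_
    have h2 : lk * (k * k) * lk = r * r + algebraMap ℝ E (η ^ 2) * (lk * lk) := by
      rw [hrr, mul_sub, sub_mul, ← Algebra.commutes (η ^ 2) lk, mul_assoc (algebraMap ℝ E (η ^ 2))]
      abel
    have h3 : algebraMap ℝ E (η ^ 2) * (lk * lk) ≤ algebraMap ℝ E (η ^ 2) := by
      rw [hl', cmul hl hl, ← cfc_const (η ^ 2) k, cmul continuous_const (hl.fun_mul hl)]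
      refine cmono (continuous_const.fun_mul (hl.fun_mul hl)) continuous_const fun t ht => ?_
      nlinarith [hl0 t, hl1 t, mul_nonneg (hl0 t) (hl0 t), mul_le_one₀ (hl1 t) (hl0 t) (hl1 t),
        sq_nonneg η]
    have h4 : (r + algebraMap ℝ E η) * (r + algebraMap ℝ E η) =
        r * r + algebraMap ℝ E (η ^ 2) + (algebraMap ℝ E (2 * η)) * r := by
      have : algebraMap ℝ E (2 * η) = algebraMap ℝ E η + algebraMap ℝ E η := by
        rw [← map_add]; ring_nf
      rw [this, add_mul, mul_add, mul_add, ← Algebra.commutes η r, pow_two, map_mul]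
      noncomm_ring
    rw [h2, h4]
    have h5 : 0 ≤ algebraMap ℝ E (2 * η) * r := by
      rw [← Algebra.smul_def]
      exact smul_nonneg (by positivity) hr0
    calc r * r + algebraMap ℝ E (η ^ 2) * (lk * lk) ≤ r * r + algebraMap ℝ E (η ^ 2) := by gcongr
      _ ≤ _ := le_add_of_nonneg_right h5
  obtain ⟨v0, hv0c, hv0, hv0n⟩ := polar hr0 hlow
  set a := CFC.sqrt (star x * x) with ha
  have hra : ‖r - a‖ ≤ η := by
    have h1 : r ≤ a := by
      have := CFC.sqrt_le_sqrt _ _ hlow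
      rwa [CFC.sqrt_mul_self r hr0] at this
    have hp : 0 ≤ r + algebraMap ℝ E η := add_nonneg hr0 (algebraMap_nonneg E hη.le)
    have h2 : a ≤ r + algebraMap ℝ E η := by
      have := CFC.sqrt_le_sqrt _ _ hup
      rwa [CFC.sqrt_mul_self _ hp] at this
    rw [← norm_neg, neg_sub]
    exact norm_le_of_nonneg_le hη.le (sub_nonneg.2 h1) (by rwa [sub_le_iff_le_add'])
  refine ⟨v0 * cfc m k, ?_, ?_, ?_, ?_⟩
  · have : v0 * cfc m k ∈ closure ((fun y => y * cfc m k) '' (Set.range (fun y => x * y))) :=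
      image_closure_subset_closure_image (by fun_prop) ⟨v0, hv0c, rfl⟩
    refine closure_mono ?_ this
    rintro _ ⟨_, ⟨y, rfl⟩, rfl⟩
    exact ⟨k * lk * (y * cfc m k), by simp only [hx]; noncomm_ring⟩
  · apply norm_le_of_sq_le zero_le_one
    have : star (v0 * cfc m k) * (v0 * cfc m k) = cfc m k * (star v0 * v0) * cfc m k := by
      rw [star_mul, csa]; noncomm_ring
    rw [this, hv0, hr, cmul hρ hρ, cmul hm (hρ.fun_mul hρ), cmul (hm.fun_mul (hρ.fun_mul hρ)) hm]
    rw [← cfc_const ((1 : ℝ) ^ 2) k]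
    refine cmono ((hm.fun_mul (hρ.fun_mul hρ)).fun_mul hm) continuous_const fun t ht => ?_
    have h1 : m t * ρ t ≤ 1 := by
      have : q t ≤ max t η := by
        refine (Real.sqrt_le_sqrt (show t ^ 2 - η ^ 2 ≤ t ^ 2 by nlinarith)).trans ?_
        rw [Real.sqrt_sq (hspec t ht)]; exact le_max_left _ _
      simp only [ρ, m]
      have h2 : l t * q t ≤ 1 * max t η :=
        mul_le_mul (hl1 t) this (Real.sqrt_nonneg _) zero_le_one
      rw [inv_mul_le_iff₀ (hmp t)]; linarith
    have h0 : 0 ≤ m t * ρ t :=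
      mul_nonneg (inv_nonneg.2 (hmp t).le) (mul_nonneg (hl0 t) (Real.sqrt_nonneg _))
    nlinarith
  · have h1 : v0 * cfc m k * k = v0 := by
      have : v0 * (cfc (fun t => m t * t - 1) k) = 0 := by
        rw [← norm_eq_zero, norm_mul_eq_of_sq (show star v0 * v0 = star r * r by rw [hrs, hv0]),
          hr, cmul hρ (by fun_prop), norm_eq_zero]
        rw [← cfc_zero ℝ k]
        refine cfc_congr fun t ht => ?_
        rcases le_total t η with h | h
        · simp [ρ, hlt t h]
        · simp [m, max_eq_left h, inv_mul_cancel₀ (show t ≠ 0 by linarith)]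
      rw [← csub (by fun_prop) (by fun_prop), cfc_const_one ℝ k, ← cmulid hks hm, mul_sub,
        mul_one, sub_eq_zero] at this
      rw [mul_assoc, this]
    have h2 : (v0 * cfc m k - 1) * k = (v0 - x) + e * (k * lk - k) - (1 - e) * k := by
      rw [sub_mul, h1, hx]; noncomm_ring
    rw [h2]
    have h3 : ‖k * lk - k‖ ≤ η := by
      have : k * lk - k = cfc (fun t => t * l t - t) k := by
        rw [← csub (by fun_prop) (by fun_prop), cfc_id' ℝ k, cidmul hks hl]
      rw [this]
      refine cnorm hη.le fun t ht => ?_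
      have ht0 := hspec t ht
      rcases le_total t η with h | h
      · rw [hlt t h]; simp [abs_of_nonneg ht0, h]
      · have h5 : t * l t = t - η := by
          simp only [l]; rw [max_eq_left (by linarith), max_eq_left h]
          field_simp [show t ≠ 0 by linarith]
        rw [h5]; simp [abs_of_pos hη]
    have h4 : ‖e * (k * lk - k)‖ ≤ η := by
      refine (norm_mul_le _ _).trans ?_
      nlinarith [norm_nonneg e, norm_nonneg (k * lk - k)]
    have h5 := norm_sub_le ((v0 - x) + e * (k * lk - k)) ((1 - e) * k)
    have h6 := norm_add_le (v0 - x) (e * (k * lk - k))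
    nlinarith
  · intro w hw
    have : star (v0 * cfc m k) * (v0 * cfc m k) = cfc m k * (r * r) * cfc m k := by
      rw [← hv0, star_mul, csa]; noncomm_ring
    rw [this]
    have c1 : Commute (cfc m k) w := Commute.cfc_real hw m
    have c2 : Commute r w := Commute.cfc_real hw ρ
    exact (c1.mul_left (c2.mul_left c2)).mul_left c1

end generic


/-- Gram matrix. -/
def gram {I L E : Type*} [Fintype L] [NonUnitalNonAssocSemiring E] [Star E] (z : I → L → E)
    (i j : I) : E := ∑ l, z i l * star (z j l)

/-- Approximation data. -/
structure Dat (κ E : Type) [CStarAlgebra E] (I β L : Type) [Fintype I] [DecidableEq I]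
    [Fintype L] where
  blk : I → β
  col : β → κ
  ψ : E →ₗ[ℂ] Matrix I I ℂ
  z : I → L → E
  T : I → I → E
  cp : ∀ a : I → E, (0 : ℂ) ≤ ∑ i, ∑ j, ψ (star (a i) * a j) i j
  ctr : (1 - ψ 1).PosSemidef
  off : ∀ x i j, blk i ≠ blk j → ψ x i j = 0
  mul_ne : ∀ i j k l, blk i = blk j → blk k = blk l → col (blk j) = col (blk k) → j ≠ k →
    gram z i j * gram z k l = 0
  mul_eq : ∀ i j l, blk i = blk j → blk j = blk l → gram z i j * gram z j l = T i l
  sum_le : ∀ (c : κ) (s : Finset I), (∀ i ∈ s, col (blk i) = c) →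
    IsPosElem (1 - ∑ i ∈ s, gram z i i)

/-- The composed map. -/
def Dat.Φ {κ E : Type} [CStarAlgebra E] {I β L : Type} [Fintype I] [DecidableEq I]
    [Fintype L] (D : Dat κ E I β L) (a : E) : E := ∑ i, ∑ j, D.ψ a i j • gram D.z i j

/-- Approximability by data with values in `H`. -/
def HD (κ E : Type) [CStarAlgebra E] (H : Set E) : Prop :=
  ∀ (S : Finset E) (ε : ℝ), (∀ a ∈ S, a ∈ H) → 0 < ε →
    ∃ (I β L : Type) (_ : Fintype I) (_ : DecidableEq I) (_ : Fintype L) (D : Dat κ E I β L),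
      (∀ i j, gram D.z i j ∈ H) ∧ ∀ a ∈ S, ‖D.Φ a - a‖ < ε

section mat
variable {n : Type*} [Fintype n]

theorem psd_factor [DecidableEq n] {M : Matrix n n ℂ} (h : M.PosSemidef) :
    ∃ B : Matrix n n ℂ, M = B.conjTranspose * B := by
  open scoped MatrixOrder in
  have h0 : 0 ≤ M := Matrix.nonneg_iff_posSemidef.2 h
  exact CStarAlgebra.nonneg_iff_eq_star_mul_self.1 h0

theorem quad_eq (M : Matrix n n ℂ) (x : n → ℂ) :
    star x ⬝ᵥ M.mulVec x = ∑ i, ∑ j, star (x i) * M i j * x j := by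
  simp [dotProduct, Matrix.mulVec, Finset.mul_sum, mul_assoc]

theorem psd_of_form {M : Matrix n n ℂ} (hM : M.IsHermitian)
    (h : ∀ x : n → ℂ, 0 ≤ ∑ i, ∑ j, star (x i) * M i j * x j) : M.PosSemidef :=
  Matrix.PosSemidef.of_dotProduct_mulVec_nonneg hM fun x => by rw [quad_eq]; exact h x

theorem psd_form {M : Matrix n n ℂ} (hM : M.PosSemidef) (x : n → ℂ) :
    0 ≤ ∑ i, ∑ j, star (x i) * M i j * x j := by
  rw [← quad_eq]; exact hM.dotProduct_mulVec_nonneg x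

end mat

section gram
variable {E : Type*} [CStarAlgebra E]
variable {I L : Type*} [Fintype L]

theorem star_gram (z : I → L → E) (i j : I) : star (gram z i j) = gram z j i := by
  simp [gram, star_sum]

theorem gram_form [PartialOrder E] [StarOrderedRing E] [Fintype I] [DecidableEq I] (z : I → L → E)
    {M : Matrix I I ℂ} (hM : M.PosSemidef) :
    0 ≤ ∑ i, ∑ j, M i j • gram z i j := by
  obtain ⟨B, rfl⟩ := psd_factor hM
  have : ∑ i, ∑ j, (B.conjTranspose * B) i j • gram z i j =
      ∑ k, ∑ l, (∑ i, star (B k i) • z i l) * star (∑ i, star (B k i) • z i l) := by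
    simp only [Matrix.mul_apply, Matrix.conjTranspose_apply, gram, star_sum, star_smul, star_star,
      Finset.sum_mul_sum, Finset.sum_smul, Finset.smul_sum, smul_mul_smul_comm]
    calc _ = ∑ i, ∑ j, ∑ k, ∑ l, (star (B k i) * B k j) • (z i l * star (z j l)) :=
          Finset.sum_congr rfl fun k _ => Finset.sum_congr rfl fun i _ => Finset.sum_comm
      _ = ∑ i, ∑ k, ∑ j, ∑ l, (star (B k i) * B k j) • (z i l * star (z j l)) :=
          Finset.sum_congr rfl fun i _ => Finset.sum_comm
      _ = ∑ k, ∑ i, ∑ j, ∑ l, (star (B k i) * B k j) • (z i l * star (z j l)) := Finset.sum_comm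
      _ = ∑ k, ∑ i, ∑ l, ∑ j, (star (B k i) * B k j) • (z i l * star (z j l)) :=
          Finset.sum_congr rfl fun k _ => Finset.sum_congr rfl fun i _ => Finset.sum_comm
      _ = _ := Finset.sum_congr rfl fun i _ => Finset.sum_comm
  rw [this]
  exact Finset.sum_nonneg fun k _ => Finset.sum_nonneg fun l _ => mul_star_self_nonneg _

end gram

section dat
variable {κ E : Type} [CStarAlgebra E] {I β L : Type} [Fintype I] [DecidableEq I]
    [Fintype L] (D : Dat κ E I β L)

theorem Dat.psi_star (x : E) : D.ψ (star x) = (D.ψ x).conjTranspose := by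
  let B : (I → E) → (I → E) → ℂ := fun a b => ∑ i, ∑ j, D.ψ (star (a i) * b j) i j
  have hB : ∀ a b, B (a + b) (a + b) = B a a + B a b + B b a + B b b := fun a b => by
    simp only [B, Pi.add_apply, star_add, add_mul, mul_add, map_add, Matrix.add_apply,
      Finset.sum_add_distrib]
    ring
  have him : ∀ a, (B a a).im = 0 := fun a => ((Complex.nonneg_iff.1 (D.cp a)).2).symm
  have him2 : ∀ a b, (B a b + B b a).im = 0 := fun a b => by
    have h := him (a + b)
    rw [hB] at h
    simp only [Complex.add_im, him] at h ⊢
    linarith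
  have hs : ∀ i j u v, B (Pi.single i u) (Pi.single j v) = D.ψ (star u * v) i j := by
    intro i j u v
    simp only [B]
    rw [Finset.sum_eq_single i, Finset.sum_eq_single j]
    · simp
    · intro k _ hk; simp [Pi.single_eq_of_ne hk]
    · simp
    · intro k _ hk; simp [Pi.single_eq_of_ne hk]
    · simp
  ext j i
  rw [Matrix.conjTranspose_apply]
  have h1 := him2 (Pi.single i 1) (Pi.single j x)
  have h2 := him2 (Pi.single i (Complex.I • 1)) (Pi.single j x)
  rw [hs, hs] at h1 h2
  simp only [star_one, one_mul, mul_one, star_smul, smul_mul_assoc, mul_smul_comm, map_smul,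
    Matrix.smul_apply, smul_eq_mul, Complex.add_im, Complex.mul_im, Complex.star_def,
    Complex.conj_I, Complex.neg_re, Complex.neg_im, Complex.I_re, Complex.I_im] at h1 h2
  apply Complex.ext
  · simp; linarith
  · simp; linarith

theorem Dat.psi_pos' (y : E) : (D.ψ (star y * y)).PosSemidef := by
  refine psd_of_form ?_ fun x => ?_
  · rw [Matrix.IsHermitian, ← D.psi_star]; simp
  · have := D.cp fun i => x i • y
    refine this.trans_eq ?_
    refine Finset.sum_congr rfl fun i _ => Finset.sum_congr rfl fun j _ => ?_
    simp only [star_smul, smul_mul_smul_comm, map_smul, Matrix.smul_apply, smul_eq_mul]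
    ring

theorem Dat.psi_mono [PartialOrder E] [StarOrderedRing E] {a b : E} (h : a ≤ b) :
    (D.ψ b - D.ψ a).PosSemidef := by
  obtain ⟨y, hy⟩ := CStarAlgebra.nonneg_iff_eq_star_mul_self.1 (sub_nonneg.2 h)
  rw [← map_sub, hy]; exact D.psi_pos' y

theorem Dat.schwarz (a : E) :
    (D.ψ (a * star a) - D.ψ a * (D.ψ a).conjTranspose).PosSemidef := by
  refine psd_of_form ?_ fun x => ?_
  · rw [Matrix.IsHermitian, Matrix.conjTranspose_sub, ← D.psi_star]; simp
  set η := (D.ψ a).conjTranspose.mulVec x with hη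
  have hη' : ∀ j, η j = ∑ i, star (D.ψ a i j) * x i := fun j => by
    simp [hη, Matrix.mulVec, dotProduct, Matrix.conjTranspose_apply]
  have h1 := D.cp fun i => x i • star a - η i • (1 : E)
  have h2 := psd_form D.ctr η
  have e1 : ∀ i j, D.ψ (star (x i • star a - η i • (1 : E)) * (x j • star a - η j • (1 : E))) i j
      = star (x i) * D.ψ (a * star a) i j * x j - star (x i) * D.ψ a i j * η j
        - star (η i) * star (D.ψ a j i) * x j + star (η i) * D.ψ 1 i j * η j := by
    intro i j
    have : star (x i • star a - η i • (1 : E)) * (x j • star a - η j • (1 : E)) =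
       (star (x i) * x j) • (a * star a) - (star (x i) * η j) • a - (star (η i) * x j) • star a
        + (star (η i) * η j) • (1 : E) := by
      simp only [star_sub, star_smul, star_star, star_one, sub_mul, mul_sub, smul_mul_smul_comm,
        mul_one, one_mul]
      abel
    rw [this, map_add, map_sub, map_sub, map_smul, map_smul, map_smul, map_smul, D.psi_star a]
    simp only [Matrix.add_apply, Matrix.sub_apply, Matrix.smul_apply, smul_eq_mul,
      Matrix.conjTranspose_apply]
    ring
  simp only [e1] at h1
  simp only [Finset.sum_add_distrib, Finset.sum_sub_distrib] at h1
  have e2 : ∑ i, ∑ j, star (x i) * D.ψ a i j * η j = ∑ j, star (η j) * η j := by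
    rw [Finset.sum_comm]
    refine Finset.sum_congr rfl fun j _ => ?_
    rw [← Finset.sum_mul]
    congr 1
    rw [hη' j, star_sum]
    exact Finset.sum_congr rfl fun i _ => by rw [star_mul, star_star]
  have e3 : ∑ i, ∑ j, star (η i) * star (D.ψ a j i) * x j = ∑ j, star (η j) * η j := by
    refine Finset.sum_congr rfl fun i _ => ?_
    rw [hη' i, Finset.mul_sum]
    simp only [mul_assoc]
  have e4 : ∑ i, ∑ j, star (η i) * (1 - D.ψ 1) i j * η j =
      ∑ j, star (η j) * η j - ∑ i, ∑ j, star (η i) * D.ψ 1 i j * η j := by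
    simp only [Matrix.sub_apply, mul_sub, sub_mul, Finset.sum_sub_distrib]
    congr 1
    refine Finset.sum_congr rfl fun i _ => ?_
    simp [Matrix.one_apply]
  have e5 : ∑ i, ∑ j, star (x i) * (D.ψ (a * star a) - D.ψ a * (D.ψ a).conjTranspose) i j * x j =
      ∑ i, ∑ j, star (x i) * D.ψ (a * star a) i j * x j - ∑ j, star (η j) * η j := by
    rw [← e2]
    simp only [Matrix.sub_apply, mul_sub, sub_mul, Finset.sum_sub_distrib]
    congr 1
    refine Finset.sum_congr rfl fun i _ => ?_
    simp only [Matrix.mul_apply, Matrix.conjTranspose_apply, hη', Finset.mul_sum, Finset.sum_mul]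
    rw [Finset.sum_comm]
    exact Finset.sum_congr rfl fun j _ => Finset.sum_congr rfl fun k _ => by ring
  rw [e5]
  rw [e4] at h2
  rw [e2, e3] at h1
  have h3 := add_nonneg h1 h2
  refine h3.trans_eq ?_
  ring

end dat


section oz
variable {E : Type*} [CStarAlgebra E] {I L : Type*} [Fintype L]

theorem sum_star_mul_eq_zero {ι : Type*} [Fintype ι] (x : ι → E) (h : ∑ i, star (x i) * x i = 0)
    (i : ι) : x i = 0 := by
  let := CStarAlgebra.spectralOrder E
  have := CStarAlgebra.spectralOrderedRing E
  have := (Finset.sum_eq_zero_iff_of_nonneg fun i _ => star_mul_self_nonneg (x i)).1 h i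
    (Finset.mem_univ i)
  exact CStarRing.star_mul_self_eq_zero_iff _ |>.1 this

theorem sum_mul_star_eq_zero {ι : Type*} [Fintype ι] (x : ι → E) (h : ∑ i, x i * star (x i) = 0)
    (i : ι) : x i = 0 := by
  have := sum_star_mul_eq_zero (fun i => star (x i)) (by simpa using h) i
  simpa using this

theorem sa_sq_zero {x : E} (h : star x = x) (h2 : x * x = 0) : x = 0 := by
  have : star x * x = 0 := by rw [h, h2]
  exact CStarRing.star_mul_self_eq_zero_iff _ |>.1 this

theorem gram_orth {z : I → L → E} {j k : I} (h : gram z j j * gram z k k = 0) (m m' : L) :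
    star (z j m) * z k m' = 0 := by
  have h' : gram z k k * gram z j j = 0 := by
    have := congrArg star h
    simpa [star_gram] using this
  have h1 : ∀ m, star (z j m) * gram z k k = 0 := by
    intro m
    refine sum_star_mul_eq_zero (fun m => star (z j m) * gram z k k) ?_ m
    have : ∑ m, star (star (z j m) * gram z k k) * (star (z j m) * gram z k k)
        = gram z k k * gram z j j * gram z k k := by
      conv_rhs => enter [1, 2]; rw [gram]
      rw [Finset.mul_sum, Finset.sum_mul]
      refine Finset.sum_congr rfl fun m _ => ?_
      rw [star_mul, star_star, star_gram]; noncomm_ring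
    rw [this, h', zero_mul]
  refine sum_mul_star_eq_zero (fun m' => star (z j m) * z k m') ?_ m'
  have : ∑ m', star (z j m) * z k m' * star (star (z j m) * z k m')
      = star (z j m) * gram z k k * z j m := by
    rw [gram, Finset.mul_sum, Finset.sum_mul]
    refine Finset.sum_congr rfl fun m _ => ?_
    rw [star_mul, star_star]; noncomm_ring
  rw [this, h1, zero_mul]

theorem gram_mul_zero {z : I → L → E} {j k : I} (h : gram z j j * gram z k k = 0) (i l : I) :
    gram z i j * gram z k l = 0 := by
  rw [gram, gram, Finset.sum_mul_sum]
  refine Finset.sum_eq_zero fun m _ => Finset.sum_eq_zero fun m' _ => ?_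
  rw [mul_assoc, ← mul_assoc (star _), gram_orth h, zero_mul, mul_zero]

theorem oz_alg {p q t : E} (hp : star p = p) (hq : star q = q) (hpq : p * q = 0)
    (hqp : q * p = 0) (htp : t * p = 0) (hqt : q * t = 0) (htt : t * t = 0)
    (h1 : (p + q + (t + star t)) * (p + q - (t + star t)) = 0)
    (h2 : (p + q - (t + star t)) * (p + q + (t + star t)) = 0) :
    t * star t = p * p ∧ p * t = t * q := by
  have htp' : p * star t = 0 := by simpa [hp] using congrArg star htp
  have hqt' : star t * q = 0 := by simpa [hq] using congrArg star hqt
  have htt' : star t * star t = 0 := by simpa using congrArg star htt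
  have e1 : (p + q) * (p + q) = p * p + q * q := by
    rw [add_mul, mul_add, mul_add, hpq, hqp]; abel
  have e2 : (t + star t) * (t + star t) = t * star t + star t * t := by
    rw [add_mul, mul_add, mul_add, htt, htt']; abel
  have e3 : (p + q) * (t + star t) = p * t + q * star t := by
    rw [add_mul, mul_add, mul_add, htp', hqt]; abel
  have e4 : (t + star t) * (p + q) = t * q + star t * p := by
    rw [add_mul, mul_add, mul_add, htp, hqt']; abel
  have f1 : (p * p + q * q) - (p * t + q * star t) + (t * q + star t * p)
      - (t * star t + star t * t) = 0 := by
    rw [← e1, ← e2, ← e3, ← e4, ← h1]; noncomm_ring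
  have f2 : (p * p + q * q) + (p * t + q * star t) - (t * q + star t * p)
      - (t * star t + star t * t) = 0 := by
    rw [← e1, ← e2, ← e3, ← e4, ← h2]; noncomm_ring
  have g1 : p * p + q * q = t * star t + star t * t := by
    have : (2 : ℂ) • (p * p + q * q - (t * star t + star t * t)) = 0 := by
      rw [two_smul]
      calc _ = _ := ?_
        _ = (0 : E) + 0 := congrArg₂ (· + ·) f1 f2
        _ = 0 := add_zero 0
      abel
    exact sub_eq_zero.1 ((smul_eq_zero.1 this).resolve_left two_ne_zero)
  have g2 : p * t + q * star t = t * q + star t * p := by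
    have : (2 : ℂ) • (p * t + q * star t - (t * q + star t * p)) = 0 := by
      rw [two_smul]
      calc _ = _ := ?_
        _ = (0 : E) - 0 := congrArg₂ (· - ·) f2 f1
        _ = 0 := sub_zero 0
      abel
    exact sub_eq_zero.1 ((smul_eq_zero.1 this).resolve_left two_ne_zero)
  constructor
  · have hW : t * star t - p * p = q * q - star t * t := by
      rw [sub_eq_sub_iff_add_eq_add, ← g1, add_comm]
    have : t * star t - p * p = 0 := by
      refine sa_sq_zero (by simp [hp]) ?_
      nth_rewrite 2 [hW]
      have : (t * star t - p * p) * (q * q - star t * t) =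
        t * (star t * q) * q - t * (star t * star t) * t - p * (p * q) * q
          + p * (p * star t) * t := by noncomm_ring
      rw [this, hqt', htt', hpq, htp']; simp
    exact sub_eq_zero.1 this
  · have hx : p * t - t * q = star t * p - q * star t := by
      rw [sub_eq_sub_iff_add_eq_add, g2, add_comm]
    have : p * t - t * q = 0 := by
      refine sa_sq_zero (by rw [hx]; simp [hp, hq, hx]) ?_
      have : (p * t - t * q) * (p * t - t * q) =
        p * (t * p) * t - p * (t * t) * q - t * (q * p) * t + t * (q * t) * q := by noncomm_ring
      rw [this, htp, htt, hqp, hqt]; simp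
    exact sub_eq_zero.1 this

theorem gram_oz {z : I → L → E} {i j : I} (hij : gram z i i * gram z j j = 0)
    (h1 : (gram z i i + gram z j j + (gram z i j + gram z j i)) *
      (gram z i i + gram z j j - (gram z i j + gram z j i)) = 0)
    (h2 : (gram z i i + gram z j j - (gram z i j + gram z j i)) *
      (gram z i i + gram z j j + (gram z i j + gram z j i)) = 0) (l : I) :
    gram z i j * gram z j l = gram z i i * gram z i l := by
  have hji : gram z j j * gram z i i = 0 := by
    have := congrArg star hij
    simpa [star_gram] using this
  obtain ⟨ha, hb⟩ := oz_alg (p := gram z i i) (q := gram z j j) (t := gram z i j)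
    (star_gram _ _ _) (star_gram _ _ _) hij hji (gram_mul_zero hji _ _) (gram_mul_zero hji _ _)
    (gram_mul_zero hji _ _) (by rwa [star_gram]) (by rwa [star_gram])
  rw [star_gram] at ha
  set p := gram z i i
  set q := gram z j j
  set t := gram z i j
  have hps : star p = p := star_gram _ _ _
  have hts : star t = gram z j i := star_gram _ _ _
  have hts' : star (gram z j i) = t := star_gram _ _ _
  have key : ∀ m, t * z j m = p * z i m := by
    intro m
    have := sum_mul_star_eq_zero (fun m => t * z j m - p * z i m) ?_ m
    · exact sub_eq_zero.1 this
    have e : ∀ m, (t * z j m - p * z i m) * star (t * z j m - p * z i m) =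
        t * (z j m * star (z j m)) * star t - t * (z j m * star (z i m)) * p
        - p * (z i m * star (z j m)) * star t + p * (z i m * star (z i m)) * p := by
      intro m
      rw [star_sub, star_mul, star_mul, hps]; noncomm_ring
    have e2 : ∑ m, (t * z j m - p * z i m) * star (t * z j m - p * z i m) =
        t * q * star t - t * gram z j i * p - p * t * star t + p * p * p := by
      simp only [e, Finset.sum_add_distrib, Finset.sum_sub_distrib, ← Finset.mul_sum,
        ← Finset.sum_mul]
      rfl
    rw [e2, ← hb, ha, hts, mul_assoc p t, ha]; noncomm_ring
  calc t * gram z j l = ∑ m, t * z j m * star (z l m) := by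
        rw [gram, Finset.mul_sum]; simp only [mul_assoc]
    _ = p * gram z i l := by
        simp only [key]; rw [gram, Finset.mul_sum]; simp only [mul_assoc]

end oz


theorem rank1_pos {R : Type*} [Ring R] [StarRing R] {k : ℕ} (v : Fin k → R) :
    IsPosElem (Matrix.of fun i j => star (v i) * v j) := by
  rcases k with _ | k
  · exact ⟨0, by ext i; exact i.elim0⟩
  · refine ⟨Matrix.of fun m j => if m = 0 then v j else 0, ?_⟩
    ext i j
    rw [Matrix.mul_apply, Finset.sum_eq_single 0]
    · simp [Matrix.star_apply]
    · intro b _ hb; simp [hb]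
    · simp

section F2C
variable {s : ℕ} {r : Fin s → ℕ}

/-- matrix units -/
def eu (x y : Σ b, Fin (r b)) : FDBlock s r :=
  if h : y.1 = x.1 then Pi.single x.1 (Matrix.single x.2 (h ▸ y.2) 1) else 0

theorem eu_same (b : Fin s) (i j : Fin (r b)) :
    (eu ⟨b, i⟩ ⟨b, j⟩ : FDBlock s r) = Pi.single b (Matrix.single i j 1) := by simp [eu]

theorem eu_mul (b : Fin s) (i j l : Fin (r b)) :
    (eu ⟨b, i⟩ ⟨b, j⟩ * eu ⟨b, j⟩ ⟨b, l⟩ : FDBlock s r) = eu ⟨b, i⟩ ⟨b, l⟩ := by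
  rw [eu_same, eu_same, eu_same, ← Pi.single_mul]; simp

theorem eu_mul_ne (x y z w : Σ b, Fin (r b)) (h : y ≠ z) :
    (eu x y * eu z w : FDBlock s r) = 0 := by
  obtain ⟨b, i⟩ := x; obtain ⟨b2, j⟩ := y; obtain ⟨c, k⟩ := z; obtain ⟨c2, l⟩ := w
  by_cases h1 : b2 = b
  · subst h1
    by_cases h2 : c2 = c
    · subst h2
      rw [eu_same, eu_same]
      by_cases h3 : b2 = c2
      · subst h3
        rw [← Pi.single_mul, Matrix.single_mul_single_of_ne, Pi.single_zero]
        rintro rfl; exact h rfl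
      · ext1 a
        by_cases h4 : a = b2
        · subst h4; simp [Pi.single_eq_of_ne h3]
        · simp [Pi.single_eq_of_ne h4]
    · simp [eu, h2]
  · simp [eu, h1]

theorem eu_star (b : Fin s) (i j : Fin (r b)) :
    star (eu ⟨b, i⟩ ⟨b, j⟩ : FDBlock s r) = eu ⟨b, j⟩ ⟨b, i⟩ := by
  rw [eu_same, eu_same]
  ext1 a
  by_cases h4 : a = b
  · subst h4; simp [Matrix.star_eq_conjTranspose]
  · simp [Pi.single_eq_of_ne h4]

theorem eu_expand (X : FDBlock s r) :
    X = ∑ b, ∑ i, ∑ j, X b i j • eu ⟨b, i⟩ ⟨b, j⟩ := by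
  ext1 a
  rw [Finset.sum_apply, Finset.sum_eq_single a]
  · conv_lhs => rw [Matrix.matrix_eq_sum_single (X a)]
    simp only [Finset.sum_apply, Pi.smul_apply, eu_same, Pi.single_eq_same, Matrix.smul_single,
      smul_eq_mul, mul_one]
  · intro b _ hb
    simp [eu_same, Pi.single_eq_of_ne (Ne.symm hb)]
  · simp

theorem proj_norm_le {E : Type*} [CStarAlgebra E] {p : E} (h : p * p = p) (hs : star p = p) :
    ‖p‖ ≤ 1 := by
  have := CStarRing.norm_star_mul_self (x := p)
  rw [hs, h] at this
  nlinarith [norm_nonneg p]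

end F2C

section F2C
variable {D : Type} [CStarAlgebra D] 

theorem bd_psd {s : ℕ} {r : Fin s → ℕ} (P : FDBlock s r) (h : ∀ b, (P b).PosSemidef) :
    (Matrix.blockDiagonal' P).PosSemidef := by
  choose B hB using fun b => psd_factor (h b)
  have : Matrix.blockDiagonal' P =
      (Matrix.blockDiagonal' B).conjTranspose * Matrix.blockDiagonal' B := by
    rw [Matrix.blockDiagonal'_conjTranspose, ← Matrix.blockDiagonal'_mul]
    congr 1; ext1 b; exact hB b
  rw [this]; exact Matrix.posSemidef_conjTranspose_mul_self _

theorem gram_repr {s : ℕ} {r : Fin s → ℕ} (φ : FDBlock s r →ₗ[ℂ] D)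
    (hφ : IsCompletelyPositive φ) :
    ∃ z : (Σ b, Fin (r b)) → (Σ b, Fin (r b)) → D, ∀ x y, gram z x y = φ (eu x y) := by
  have : ∀ b, ∃ y : Fin (r b) → Fin (r b) → D, ∀ i j,
      φ (eu ⟨b, i⟩ ⟨b, j⟩) = ∑ m, star (y m i) * y m j := by
    intro b
    rcases isEmpty_or_nonempty (Fin (r b)) with he | ⟨⟨m0⟩⟩
    · exact ⟨fun i => isEmptyElim i, fun i => isEmptyElim i⟩
    · obtain ⟨Y, hY⟩ := hφ (r b) _ (rank1_pos fun i => (eu ⟨b, m0⟩ ⟨b, i⟩ : FDBlock s r))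
      refine ⟨Y, fun i j => ?_⟩
      have := congrFun (congrFun hY i) j
      rw [Matrix.map_apply, Matrix.of_apply, eu_star, eu_mul] at this
      rw [this, Matrix.mul_apply]; rfl
  choose y hy using this
  refine ⟨fun x l => if h : l.1 = x.1 then star (y x.1 (h ▸ l.2) x.2) else 0, ?_⟩
  rintro ⟨b, i⟩ ⟨c, j⟩
  rw [gram, Fintype.sum_sigma, Finset.sum_eq_single b]
  · by_cases h : c = b
    · subst h; simp [hy]
    · simp [eu, h, Ne.symm h]
  · intro b' _ hb; simp [hb]
  · simp

set_option maxHeartbeats 1000000 in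
theorem nuc_to_HD {n : ℕ} (h : NuclearDimensionLE n D) : HD (Fin (n + 1)) D Set.univ := by
  intro S ε _ hε
  obtain ⟨s, r, J, ψ0, φ, hψ, hφ, hψn, hφ2, happ⟩ := h S ε hε
  obtain ⟨z, hz⟩ := gram_repr φ hφ
  let ψ : D →ₗ[ℂ] Matrix (Σ b, Fin (r b)) (Σ b, Fin (r b)) ℂ :=
    { toFun := fun x => Matrix.blockDiagonal' (ψ0 x)
      map_add' := fun x y => by rw [map_add, Matrix.blockDiagonal'_add]
      map_smul' := fun c x => by rw [map_smul, Matrix.blockDiagonal'_smul]; rfl }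
  have hψd : ∀ x, ψ x = Matrix.blockDiagonal' (ψ0 x) := fun _ => rfl
  have hsupp : ∀ x y : Σ b, Fin (r b), (eu x y : FDBlock s r) ∈ blockSupp J (J x.1) := by
    rintro ⟨b, i⟩ ⟨c, j⟩ a ha
    by_cases h : c = b
    · subst h; rw [eu_same, Pi.single_eq_of_ne]; rintro rfl; exact ha rfl
    · simp [eu, h]
  have hadd : ∀ c, ∀ x ∈ blockSupp (r := r) J c, ∀ y ∈ blockSupp J c, x + y ∈ blockSupp J c :=
    fun c x hx y hy i hi => by simp [hx i hi, hy i hi]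
  have hneg : ∀ c, ∀ x ∈ blockSupp (r := r) J c, -x ∈ blockSupp J c :=
    fun c x hx i hi => by simp [hx i hi]
  have hpos1 : ∀ b, (ψ0 1 b).PosSemidef := by
    intro b
    obtain ⟨Y, hY⟩ := hψ 1 _ (rank1_pos fun _ => (1 : D))
    have := congrFun (congrFun (congrFun hY 0) 0) b
    simp only [Matrix.map_apply, Matrix.of_apply, star_one, one_mul] at this
    rw [this, Matrix.mul_apply]
    simp only [Fin.sum_univ_one, Matrix.star_apply]
    exact Matrix.posSemidef_conjTranspose_mul_self _
  have horth : ∀ x y : Σ b, Fin (r b), J x.1 = J y.1 → x ≠ y →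
      gram z x x * gram z y y = 0 := by
    intro x y hJ hne
    rw [hz, hz]
    refine ((hφ2 (J x.1)).2 _ (hsupp x x) _ (hJ ▸ hsupp y y) ?_ ?_).1
    · exact eu_mul_ne _ _ _ _ hne
    · exact eu_mul_ne _ _ _ _ hne.symm
  refine ⟨Σ b, Fin (r b), Fin s, Σ b, Fin (r b), inferInstance, inferInstance, inferInstance,
    { blk := Sigma.fst, col := J, ψ := ψ, z := z, T := fun i l => gram z i i * gram z i l,
      cp := ?_, ctr := ?_, off := ?_, mul_ne := ?_, mul_eq := ?_, sum_le := ?_ }, ?_, ?_⟩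
  · intro a
    have : ∑ i, ∑ j, ψ (star (a i) * a j) i j =
        ∑ b, ∑ i, ∑ j, ψ0 (star (a ⟨b, i⟩) * a ⟨b, j⟩) b i j := by
      rw [Fintype.sum_sigma]
      refine Finset.sum_congr rfl fun b _ => Finset.sum_congr rfl fun i _ => ?_
      rw [Fintype.sum_sigma, Finset.sum_eq_single b]
      · simp only [hψd, Matrix.blockDiagonal'_apply_eq]
      · intro b' _ hb
        refine Finset.sum_eq_zero fun j _ => ?_
        rw [hψd, Matrix.blockDiagonal'_apply_ne _ _ _ (Ne.symm hb)]
      · simp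
    rw [this]
    refine Finset.sum_nonneg fun b _ => ?_
    obtain ⟨Y, hY⟩ := hψ (r b) _ (rank1_pos fun i => a ⟨b, i⟩)
    have h1 : ∀ i j, ψ0 (star (a ⟨b, i⟩) * a ⟨b, j⟩) b i j =
        ∑ m, ∑ t, star (Y m i b t i) * Y m j b t j := by
      intro i j
      have := congrFun (congrFun (congrFun (congrFun (congrFun hY i) j) b) i) j
      rw [Matrix.map_apply, Matrix.of_apply] at this
      rw [this, Matrix.mul_apply]
      simp only [Matrix.star_apply, Finset.sum_apply, Matrix.sum_apply, Pi.mul_apply,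
        Matrix.mul_apply, Pi.star_apply]
    have h2 : ∑ i, ∑ j, ψ0 (star (a ⟨b, i⟩) * a ⟨b, j⟩) b i j =
        ∑ m, ∑ t, star (∑ i, Y m i b t i) * (∑ i, Y m i b t i) := by
      simp only [h1, star_sum, Finset.sum_mul_sum]
      calc _ = ∑ i, ∑ m, ∑ j, ∑ t, star (Y m i b t i) * Y m j b t j :=
            Finset.sum_congr rfl fun i _ => Finset.sum_comm
        _ = ∑ m, ∑ i, ∑ j, ∑ t, star (Y m i b t i) * Y m j b t j := Finset.sum_comm
        _ = ∑ m, ∑ i, ∑ t, ∑ j, star (Y m i b t i) * Y m j b t j :=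
            Finset.sum_congr rfl fun m _ => Finset.sum_congr rfl fun i _ => Finset.sum_comm
        _ = _ := Finset.sum_congr rfl fun m _ => Finset.sum_comm
    rw [h2]
    exact Finset.sum_nonneg fun m _ => Finset.sum_nonneg fun t _ => star_mul_self_nonneg _
  · have h1 : (1 - ψ 1) = Matrix.blockDiagonal' (1 - ψ0 1) := by
      rw [hψd, Matrix.blockDiagonal'_sub, Matrix.blockDiagonal'_one]
    rw [h1]
    refine bd_psd _ fun b => ?_
    have h2 : ‖ψ0 1 b‖ ≤ 1 :=
      (norm_le_pi_norm (ψ0 1) b).trans ((hψn 1).trans (one_norm_le D))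
    open scoped MatrixOrder in
    have h3 : 0 ≤ ψ0 1 b := Matrix.nonneg_iff_posSemidef.2 (hpos1 b)
    open scoped MatrixOrder in
    have h4 : ψ0 1 b ≤ 1 := (CStarAlgebra.norm_le_one_iff_of_nonneg _ h3).1 h2
    open scoped MatrixOrder in
    exact Matrix.nonneg_iff_posSemidef.1 (sub_nonneg.2 h4)
  · rintro x ⟨b, i⟩ ⟨c, j⟩ h
    rw [hψd, Matrix.blockDiagonal'_apply_ne _ _ _ h]
  · intro i j k l _ _ hc hjk
    exact gram_mul_zero (horth j k hc hjk) _ _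
  · rintro ⟨b, i⟩ ⟨b1, j⟩ ⟨b2, l⟩ (rfl : b = b1) (rfl : b = b2)
    by_cases hij : i = j
    · subst hij; rfl
    have hne : (⟨b, i⟩ : Σ b, Fin (r b)) ≠ ⟨b, j⟩ := by
      intro h; apply hij; simpa using h
    have hs' : ∀ i j : Fin (r b), (eu ⟨b, i⟩ ⟨b, j⟩ : FDBlock s r) ∈ blockSupp J (J b) :=
      fun i j => hsupp ⟨b, i⟩ ⟨b, j⟩
    have hP : (eu ⟨b, i⟩ ⟨b, i⟩ + eu ⟨b, j⟩ ⟨b, j⟩ + (eu ⟨b, i⟩ ⟨b, j⟩ + eu ⟨b, j⟩ ⟨b, i⟩) :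
        FDBlock s r) ∈ blockSupp J (J b) :=
      hadd _ _ (hadd _ _ (hs' _ _) _ (hs' _ _)) _ (hadd _ _ (hs' _ _) _ (hs' _ _))
    have hM : (eu ⟨b, i⟩ ⟨b, i⟩ + eu ⟨b, j⟩ ⟨b, j⟩ - (eu ⟨b, i⟩ ⟨b, j⟩ + eu ⟨b, j⟩ ⟨b, i⟩) :
        FDBlock s r) ∈ blockSupp J (J b) := by
      rw [sub_eq_add_neg]
      exact hadd _ _ (hadd _ _ (hs' _ _) _ (hs' _ _)) _
        (hneg _ _ (hadd _ _ (hs' _ _) _ (hs' _ _)))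
    have hz1 := (hφ2 (J b)).2 _ hP _ hM
      (by simp only [add_mul, mul_sub, mul_add, eu_mul, eu_mul_ne _ _ _ _ hne,
            eu_mul_ne _ _ _ _ hne.symm]; abel)
      (by simp only [add_mul, sub_mul, mul_add, eu_mul, eu_mul_ne _ _ _ _ hne,
            eu_mul_ne _ _ _ _ hne.symm]; abel)
    simp only [map_add, map_sub, ← hz] at hz1
    have ho := horth ⟨b, i⟩ ⟨b, j⟩ rfl hne
    exact gram_oz ho hz1.1 hz1.2 _
  · intro c t ht
    let := CStarAlgebra.spectralOrder D
    have := CStarAlgebra.spectralOrderedRing D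
    rw [isPos_iff, sub_nonneg]
    have h0 : 0 ≤ ∑ i ∈ t, gram z i i :=
      Finset.sum_nonneg fun i _ => Finset.sum_nonneg fun l _ => mul_star_self_nonneg _
    rw [← CStarAlgebra.norm_le_one_iff_of_nonneg _ h0]
    simp only [hz]
    rw [← map_sum]
    refine ((hφ2 c).1 _ ?_).trans ?_
    · intro b hb
      rw [Finset.sum_apply]
      refine Finset.sum_eq_zero fun i hi => ?_
      refine hsupp i i b ?_
      rw [ht i hi]; exact hb
    · refine proj_norm_le ?_ ?_
      · rw [Finset.sum_mul_sum]
        refine Finset.sum_congr rfl fun i hi => ?_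
        rw [Finset.sum_eq_single i]
        · exact eu_mul _ _ _ _
        · intro j _ hj; exact eu_mul_ne _ _ _ _ (Ne.symm hj)
        · exact fun h => absurd hi h
      · rw [star_sum]
        exact Finset.sum_congr rfl fun i hi => eu_star _ _ _
  · intro i j; trivial
  · intro a ha
    have : φ (ψ0 a) = ∑ i, ∑ j, ψ a i j • gram z i j := by
      conv_lhs => rw [eu_expand (ψ0 a)]
      simp only [map_sum, map_smul, ← hz]
      rw [Fintype.sum_sigma]
      refine Finset.sum_congr rfl fun b _ => Finset.sum_congr rfl fun i _ => ?_
      rw [Fintype.sum_sigma, Finset.sum_eq_single b]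
      · simp only [hψd, Matrix.blockDiagonal'_apply_eq]
      · intro b' _ hb
        refine Finset.sum_eq_zero fun j _ => ?_
        rw [hψd, Matrix.blockDiagonal'_apply_ne _ _ _ (Ne.symm hb), zero_smul]
      · simp
    have h2 := happ a ha
    rw [this] at h2
    exact h2

end F2C


section pull
variable {κ κ' E : Type} [CStarAlgebra E] {I β L I' β' : Type} [Fintype I] [DecidableEq I]
    [Fintype L] [Fintype I'] [DecidableEq I']

/-- Restriction of data along an injective map. -/
def Dat.pull (D : Dat κ E I β L) (q : I' → I) (hq : Function.Injective q) (blk' : I' → β')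
    (col' : β' → κ') (g : κ → κ') (hg : Function.Injective g)
    (hb : ∀ x y, blk' x = blk' y ↔ D.blk (q x) = D.blk (q y))
    (hc : ∀ x, col' (blk' x) = g (D.col (D.blk (q x)))) : Dat κ' E I' β' L where
  blk := blk'
  col := col'
  ψ :=
    { toFun := fun x => (D.ψ x).submatrix q q
      map_add' := fun x y => by rw [map_add, Matrix.submatrix_add]; rfl
      map_smul' := fun c x => by rw [map_smul, Matrix.submatrix_smul]; rfl }
  z := fun i => D.z (q i)
  T := fun i j => D.T (q i) (q j)
  cp := fun a => by
    refine (D.cp (Function.extend q a 0)).trans_eq ?_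
    symm
    refine Fintype.sum_of_injective q hq _ _ (fun i hi => ?_) (fun i => ?_)
    · have : Function.extend q a 0 i = 0 := Function.extend_apply' _ _ _ hi
      simp [this]
    · refine Fintype.sum_of_injective q hq _ _ (fun j hj => ?_) (fun j => ?_)
      · have : Function.extend q a 0 j = 0 := Function.extend_apply' _ _ _ hj
        simp [this]
      · rw [hq.extend_apply, hq.extend_apply]; rfl
  ctr := by
    have : (1 - (D.ψ 1).submatrix q q) = (1 - D.ψ 1).submatrix q q := by
      rw [Matrix.submatrix_sub, Pi.sub_apply, Pi.sub_apply, Matrix.submatrix_one _ hq]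
    change (1 - (D.ψ 1).submatrix q q).PosSemidef
    rw [this]; exact D.ctr.submatrix q
  off := fun x i j h => D.off x _ _ fun h' => h ((hb i j).2 h')
  mul_ne := fun i j k l h1 h2 h3 h4 => D.mul_ne _ _ _ _ ((hb _ _).1 h1) ((hb _ _).1 h2)
    (hg (by rw [← hc, ← hc, h3])) fun h => h4 (hq h)
  mul_eq := fun i j l h1 h2 => D.mul_eq _ _ _ ((hb _ _).1 h1) ((hb _ _).1 h2)
  sum_le := fun c s hs => by
    rcases s.eq_empty_or_nonempty with rfl | ⟨x, hx⟩
    · exact ⟨1, by simp⟩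
    · have := D.sum_le (D.col (D.blk (q x))) (s.map ⟨q, hq⟩) fun i hi => by
        obtain ⟨y, hy, rfl⟩ := Finset.mem_map.1 hi
        apply hg
        change g (D.col (D.blk (q y))) = _
        rw [← hc, ← hc, hs y hy, hs x hx]
      rw [Finset.sum_map] at this
      exact this

theorem Dat.std (D : Dat κ E I β L) (g : κ → κ') (hg : Function.Injective g) :
    ∃ (s : ℕ) (r : Fin s → ℕ) (D' : Dat κ' E (Σ b, Fin (r b)) (Fin s) L),
      D'.blk = Sigma.fst ∧ (∀ i j, ∃ i' j', gram D'.z i j = gram D.z i' j') ∧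
      ∀ a, D'.Φ a = D.Φ a := by
  classical
  have e1 := Fintype.equivFin (Set.range D.blk)
  set s := Fintype.card (Set.range D.blk)
  let r : Fin s → ℕ := fun b => Fintype.card {i // D.blk i = (e1.symm b).1}
  let e2 : ∀ b, Fin (r b) ≃ {i // D.blk i = (e1.symm b).1} := fun b => (Fintype.equivFin _).symm
  let q : (Σ b, Fin (r b)) → I := fun x => (e2 x.1 x.2).1
  have hqb : ∀ x, D.blk (q x) = (e1.symm x.1).1 := fun x => (e2 x.1 x.2).2
  have hbl : ∀ x y : Σ b, Fin (r b), x.1 = y.1 ↔ D.blk (q x) = D.blk (q y) := by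
    intro x y
    rw [hqb, hqb]
    constructor
    · intro h; rw [h]
    · intro h; exact e1.symm.injective (Subtype.ext h)
  have hq : Function.Injective q := by
    rintro ⟨b, i⟩ ⟨c, j⟩ h
    have : b = c := (hbl ⟨b, i⟩ ⟨c, j⟩).2 (by rw [h])
    subst this
    have hij : i = j := (e2 b).injective (Subtype.ext h)
    rw [hij]
  have hqs : Function.Surjective q := by
    intro i
    refine ⟨⟨e1 ⟨D.blk i, i, rfl⟩, (e2 _).symm ⟨i, by simp⟩⟩, ?_⟩
    simp [q]
  refine ⟨s, r, D.pull q hq Sigma.fst (fun b => g (D.col (e1.symm b).1)) g hg hbl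
    (fun x => by rw [hqb]), rfl, fun i j => ⟨q i, q j, rfl⟩, fun a => ?_⟩
  refine Fintype.sum_bijective q ⟨hq, hqs⟩ _ _ fun i => ?_
  exact Fintype.sum_bijective q ⟨hq, hqs⟩ _ _ fun j => rfl

end pull

theorem colnorm {E : Type*} [CStarAlgebra E] [PartialOrder E] [StarOrderedRing E] {I L : Type*}
    [Fintype I] [DecidableEq I] [Fintype L] (z : I → L → E) (hz : ∑ i, gram z i i ≤ 1)
    (X : Matrix I I ℂ) {c : ℝ} (hc : 0 ≤ c)
    (hX : (((c ^ 2 : ℝ) : ℂ) • 1 - X.conjTranspose * X).PosSemidef) :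
    ‖∑ i, ∑ j, X i j • gram z i j‖ ≤ c := by
  let y : I × L → E := fun p => ∑ j, star (X p.1 j) • z j p.2
  have h1 : ∑ i, ∑ j, X i j • gram z i j = ∑ p : I × L, z p.1 p.2 * star (y p) := by
    rw [Fintype.sum_prod_type]
    refine Finset.sum_congr rfl fun i _ => ?_
    simp only [y, star_sum, star_smul, star_star, Finset.mul_sum, mul_smul_comm, gram,
      Finset.smul_sum]
    rw [Finset.sum_comm]
  rw [h1]
  refine cs_norm_le _ _ ?_ hc ?_
  · rw [Fintype.sum_prod_type]; exact hz
  · have h2 : ∑ p, y p * star (y p) = ∑ i, ∑ j, (X.conjTranspose * X) i j • gram z i j := by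
      rw [Fintype.sum_prod_type]
      simp only [y, star_sum, star_smul, star_star, gram, Finset.sum_mul_sum,
        smul_mul_smul_comm, Matrix.mul_apply, Matrix.conjTranspose_apply, Finset.sum_smul,
        Finset.smul_sum]
      calc _ = ∑ k, ∑ i, ∑ l, ∑ j, (star (X k i) * X k j) • (z i l * star (z j l)) :=
            Finset.sum_congr rfl fun k _ => Finset.sum_comm
        _ = ∑ k, ∑ i, ∑ j, ∑ l, (star (X k i) * X k j) • (z i l * star (z j l)) :=
            Finset.sum_congr rfl fun k _ => Finset.sum_congr rfl fun i _ => Finset.sum_comm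
        _ = ∑ i, ∑ k, ∑ j, ∑ l, (star (X k i) * X k j) • (z i l * star (z j l)) :=
            Finset.sum_comm
        _ = ∑ i, ∑ j, ∑ k, ∑ l, (star (X k i) * X k j) • (z i l * star (z j l)) :=
            Finset.sum_congr rfl fun i _ => Finset.sum_comm
        _ = _ := Finset.sum_congr rfl fun k _ => Finset.sum_congr rfl fun i _ => Finset.sum_comm
    have h3 := gram_form z hX
    have h4 : ∑ i, ∑ j, (((c ^ 2 : ℝ) : ℂ) • 1 - X.conjTranspose * X) i j • gram z i j =
        ((c ^ 2 : ℝ) : ℂ) • ∑ i, gram z i i - ∑ p, y p * star (y p) := by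
      rw [h2]
      simp only [Matrix.sub_apply, sub_smul, Finset.sum_sub_distrib, Finset.smul_sum]
      congr 1
      refine Finset.sum_congr rfl fun i _ => ?_
      rw [Finset.sum_eq_single i]
      · simp
      · intro j _ hj; simp [Matrix.one_apply_ne (Ne.symm hj)]
      · simp
    rw [h4, sub_nonneg] at h3
    refine h3.trans ?_
    have h5 : algebraMap ℝ E (c ^ 2) = ((c ^ 2 : ℝ) : ℂ) • 1 := by
      rw [Algebra.algebraMap_eq_smul_one, Complex.coe_smul]
    rw [h5, Complex.coe_smul, Complex.coe_smul]
    exact smul_le_smul_of_nonneg_left hz (by positivity)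

theorem pos_pullback {D E : Type*} [CStarAlgebra D] [CStarAlgebra E]
    (ι : D →⋆ₙₐ[ℂ] E) (hι : Function.Injective ι) {a : D} (h : IsPosElem (ι a)) :
    IsPosElem a := by
  let := CStarAlgebra.spectralOrder D
  have := CStarAlgebra.spectralOrderedRing D
  let := CStarAlgebra.spectralOrder E
  have := CStarAlgebra.spectralOrderedRing E
  rw [isPos_iff] at h ⊢
  have hsa : IsSelfAdjoint a := hι (by rw [map_star]; exact h.isSelfAdjoint)
  rw [← CFC.negPart_eq_zero_iff a hsa]
  have hn := CFC.negPart_nonneg a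
  have hnsa : star a⁻ = a⁻ := hn.isSelfAdjoint
  have h1 : a⁻ * a * a⁻ = - (a⁻ * a⁻ * a⁻) := by
    conv_lhs => enter [1, 2]; rw [← CFC.posPart_sub_negPart a hsa]
    rw [mul_sub, CFC.negPart_mul_posPart]; noncomm_ring
  have h2 : 0 ≤ ι (a⁻ * a * a⁻) := by
    have := star_left_conjugate_nonneg h (ι a⁻)
    rwa [← map_star, hnsa, ← map_mul, ← map_mul] at this
  have h3 : 0 ≤ ι (a⁻ * a⁻ * a⁻) := by
    have h0 : 0 ≤ a⁻ * a⁻ * a⁻ := by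
      have := star_left_conjugate_nonneg hn a⁻
      rwa [hnsa] at this
    obtain ⟨y, hy⟩ := CStarAlgebra.nonneg_iff_eq_star_mul_self.1 h0
    rw [hy, map_mul, map_star]; exact star_mul_self_nonneg _
  rw [h1, map_neg] at h2
  have h4 : ι (a⁻ * a⁻ * a⁻) = 0 := le_antisymm (by simpa using h2) h3
  have h5 : a⁻ * a⁻ * a⁻ = 0 := hι (by rw [h4, map_zero])
  have h6 : a⁻ * a⁻ = 0 := by
    refine sa_sq_zero (by rw [star_mul, hnsa]) ?_
    rw [← mul_assoc, h5, zero_mul]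
  exact sa_sq_zero hnsa h6

theorem matrix_pos_pullback {D E : Type*} [CStarAlgebra D] [CStarAlgebra E]
    (ι : D →⋆ₙₐ[ℂ] E) (hι : Function.Injective ι) {k : ℕ} (x : Matrix (Fin k) (Fin k) D)
    {Λ : Type*} [Fintype Λ] (c : Λ → Fin k → E)
    (h : ∀ i j, ι (x i j) = ∑ t, star (c t i) * c t j) : IsPosElem x := by
  let := CStarAlgebra.spectralOrder D
  have := CStarAlgebra.spectralOrderedRing D
  let := CStarAlgebra.spectralOrder E
  have := CStarAlgebra.spectralOrderedRing E
  let f : CStarMatrix (Fin k) (Fin k) D →⋆ₙₐ[ℂ] CStarMatrix (Fin k) (Fin k) E :=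
    CStarMatrix.mapₙₐ ι
  have hf : Function.Injective f := by
    intro a b hab
    ext i j
    exact hι (congrFun (congrFun hab i) j)
  have : IsPosElem (CStarMatrix.ofMatrix x) := by
    refine pos_pullback f hf ?_
    let := CStarAlgebra.spectralOrder (CStarMatrix (Fin k) (Fin k) E)
    have := CStarAlgebra.spectralOrderedRing (CStarMatrix (Fin k) (Fin k) E)
    have hs : f (CStarMatrix.ofMatrix x) =
        ∑ t, CStarMatrix.ofMatrix (Matrix.of fun i j => star (c t i) * c t j) := by
      ext i j
      have : ∀ (s : Finset Λ) (F : Λ → CStarMatrix (Fin k) (Fin k) E),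
          (∑ t ∈ s, F t) i j = ∑ t ∈ s, F t i j := fun s F => Matrix.sum_apply i j s F
      rw [this]
      exact h i j
    rw [hs, isPos_iff]
    refine Finset.sum_nonneg fun t _ => ?_
    rw [← isPos_iff]
    exact rank1_pos (c t)
  exact this


section C2F
variable {κ E D : Type} [CStarAlgebra E] [CStarAlgebra D]

theorem sq_psd {n : Type*} [Fintype n] [DecidableEq n] (P : Matrix n n ℂ) {c : ℝ}
    (h : ‖P‖ ≤ c) : (((c ^ 2 : ℝ) : ℂ) • 1 - P.conjTranspose * P).PosSemidef := by
  open scoped MatrixOrder in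
  have h1 : star P * P ≤ algebraMap ℝ (Matrix n n ℂ) (c ^ 2) :=
    CStarAlgebra.star_mul_le_algebraMap_norm_sq.trans
      (algebraMap_mono _ (pow_le_pow_left₀ (norm_nonneg _) h 2))
  open scoped MatrixOrder in
  have h2 := Matrix.nonneg_iff_posSemidef.1 (sub_nonneg.2 h1)
  rwa [Algebra.algebraMap_eq_smul_one, ← Complex.coe_smul] at h2

theorem norm_le_of_psd {n : Type*} [Fintype n] [DecidableEq n] (P : Matrix n n ℂ) {c : ℝ}
    (hc : 0 ≤ c)
    (h : (((c ^ 2 : ℝ) : ℂ) • 1 - P * P.conjTranspose).PosSemidef) : ‖P‖ ≤ c := by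
  open scoped MatrixOrder in
  rw [← norm_star]
  open scoped MatrixOrder in
  refine norm_le_of_sq_le hc ?_
  open scoped MatrixOrder in
  rw [← sub_nonneg, Matrix.nonneg_iff_posSemidef, Algebra.algebraMap_eq_smul_one,
    ← Complex.coe_smul, star_star]
  exact h

theorem Dat.bound {I β L : Type} [Fintype I] [DecidableEq I]
    [Fintype L] (M : Dat κ E I β L) (a : E) {c : ℝ} (hc : ‖a‖ ≤ c) :
    (((c ^ 2 : ℝ) : ℂ) • 1 - M.ψ a * (M.ψ a).conjTranspose).PosSemidef := by
  let := CStarAlgebra.spectralOrder E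
  have := CStarAlgebra.spectralOrderedRing E
  have h1 : a * star a ≤ algebraMap ℝ E (c ^ 2) :=
    CStarAlgebra.mul_star_le_algebraMap_norm_sq.trans
      (algebraMap_mono _ (pow_le_pow_left₀ (norm_nonneg _) hc 2))
  have h2 := M.psi_mono h1
  rw [Algebra.algebraMap_eq_smul_one, ← Complex.coe_smul, map_smul] at h2
  have h3 := M.schwarz a
  have h4 : (((c ^ 2 : ℝ) : ℂ) • (1 - M.ψ 1)).PosSemidef :=
    M.ctr.smul (by rw [Complex.zero_le_real]; positivity)
  have := (h2.add h3).add h4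
  convert this using 1
  rw [smul_sub]; abel

theorem HD_to_nuc_aux {n : ℕ} {H : Set E} (ι : D →⋆ₙₐ[ℂ] E) (hι : Function.Injective ι)
    (hr : Set.range ι = H) {s : ℕ} {r : Fin s → ℕ} {L : Type} [Fintype L]
    (M : Dat (Fin (n + 1)) E (Σ b, Fin (r b)) (Fin s) L) (hb : M.blk = Sigma.fst)
    (hH : ∀ i j, gram M.z i j ∈ H) :
    ∃ (J : Fin s → Fin (n + 1))
      (ψ : D →ₗ[ℂ] FDBlock s r) (φ : FDBlock s r →ₗ[ℂ] D),
      IsCompletelyPositive ψ ∧ IsCompletelyPositive φ ∧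
      (∀ a : D, ‖ψ a‖ ≤ ‖a‖) ∧
      (∀ j : Fin (n + 1), (∀ x ∈ blockSupp J j, ‖φ x‖ ≤ ‖x‖) ∧
        OrderZeroOn φ (blockSupp J j)) ∧
      ∀ a, ι (φ (ψ a)) = M.Φ (ι a) := by
  let := CStarAlgebra.spectralOrder E
  have := CStarAlgebra.spectralOrderedRing E
  have hw : ∀ i j, ∃ d : D, ι d = gram M.z i j := fun i j => by
    have := hH i j; rw [← hr] at this; exact this
  choose w hw using hw
  let ψ : D →ₗ[ℂ] FDBlock s r :=
    { toFun := fun a => Matrix.blockDiag' (M.ψ (ι a))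
      map_add' := fun x y => by rw [map_add, map_add, Matrix.blockDiag'_add]
      map_smul' := fun c x => by rw [map_smul, map_smul, Matrix.blockDiag'_smul]; rfl }
  let φ : FDBlock s r →ₗ[ℂ] D :=
    { toFun := fun x => ∑ i, ∑ j, Matrix.blockDiagonal' x i j • w i j
      map_add' := fun x y => by
        rw [Matrix.blockDiagonal'_add]
        simp only [Matrix.add_apply, add_smul, Finset.sum_add_distrib]
      map_smul' := fun c x => by
        rw [Matrix.blockDiagonal'_smul]
        simp only [Matrix.smul_apply, smul_assoc, Finset.smul_sum, RingHom.id_apply] }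
  have hψ : ∀ a b, ψ a b = Matrix.blockDiag' (M.ψ (ι a)) b := fun _ _ => rfl
  have hφ : ∀ x, ι (φ x) = ∑ i, ∑ j, Matrix.blockDiagonal' x i j • gram M.z i j := by
    intro x
    change ι (∑ i, ∑ j, Matrix.blockDiagonal' x i j • w i j) = _
    simp only [map_sum, map_smul, hw]
  have hbd : ∀ a, Matrix.blockDiagonal' (ψ a) = M.ψ (ι a) := by
    intro a
    ext ⟨b, i⟩ ⟨c, j⟩
    by_cases h : b = c
    · subst h; rw [Matrix.blockDiagonal'_apply_eq]; rfl
    · rw [Matrix.blockDiagonal'_apply_ne _ _ _ h, M.off]; rw [hb]; exact h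
  have hpsd : ∀ x : FDBlock s r, (((‖x‖ ^ 2 : ℝ) : ℂ) • 1 -
      (Matrix.blockDiagonal' x).conjTranspose * Matrix.blockDiagonal' x).PosSemidef := by
    intro x
    have := bd_psd (fun b => ((‖x‖ ^ 2 : ℝ) : ℂ) • 1 - (x b).conjTranspose * x b)
      fun b => sq_psd (x b) (norm_le_pi_norm x b)
    convert this using 1
    rw [Matrix.blockDiagonal'_conjTranspose, ← Matrix.blockDiagonal'_mul,
      ← Matrix.blockDiagonal'_one, ← Matrix.blockDiagonal'_smul, ← Matrix.blockDiagonal'_sub]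
    rfl
  refine ⟨M.col, ψ, φ, ?_, ?_, ?_, ?_, ?_⟩
  · -- cp of ψ
    rintro k _ ⟨Y, rfl⟩
    have hN : ∀ b, ∃ B : Matrix (Fin k × Fin (r b)) (Fin k × Fin (r b)) ℂ, ∀ i p j t,
        M.ψ (ι ((star Y * Y) i j)) ⟨b, p⟩ ⟨b, t⟩ =
          ∑ m, star (B m (i, p)) * B m (j, t) := by
      intro b
      let N : Matrix (Fin k × Fin (r b)) (Fin k × Fin (r b)) ℂ :=
        Matrix.of fun x y => M.ψ (ι ((star Y * Y) x.1 y.1)) ⟨b, x.2⟩ ⟨b, y.2⟩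
      have hNp : N.PosSemidef := by
        refine psd_of_form ?_ fun ξ => ?_
        · ext x y
          simp only [N, Matrix.conjTranspose_apply, Matrix.of_apply]
          rw [← Matrix.conjTranspose_apply, ← M.psi_star, ← map_star, ← Matrix.star_apply,
            star_mul, star_star]
        · let a : Fin k → (Σ b, Fin (r b)) → E := fun m x =>
            if h : x.1 = b then ∑ i, ξ (i, h ▸ x.2) • ι (Y m i) else 0
          have ha : ∀ m p, a m ⟨b, p⟩ = ∑ i, ξ (i, p) • ι (Y m i) := fun m p => by simp [a]
          have ha0 : ∀ m b' p, b' ≠ b → a m ⟨b', p⟩ = 0 := fun m b' p h => by simp [a, h]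
          have h1 : ∑ x, ∑ y, star (ξ x) * N x y * ξ y =
              ∑ m, ∑ x, ∑ y, M.ψ (star (a m x) * a m y) x y := by
            have h2 : ∀ m, ∑ x, ∑ y, M.ψ (star (a m x) * a m y) x y =
                ∑ p, ∑ t, M.ψ (star (a m ⟨b, p⟩) * a m ⟨b, t⟩) ⟨b, p⟩ ⟨b, t⟩ := by
              intro m
              rw [Fintype.sum_sigma, Finset.sum_eq_single b]
              · refine Finset.sum_congr rfl fun p _ => ?_
                rw [Fintype.sum_sigma, Finset.sum_eq_single b]
                · intro b' _ hb'
                  exact Finset.sum_eq_zero fun t _ => by rw [ha0 _ _ _ hb']; simp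
                · simp
              · intro b' _ hb'
                exact Finset.sum_eq_zero fun t _ => Finset.sum_eq_zero fun t _ => by
                  rw [ha0 _ _ _ hb']; simp
              · simp
            have h3 : ∀ m p t, M.ψ (star (a m ⟨b, p⟩) * a m ⟨b, t⟩) ⟨b, p⟩ ⟨b, t⟩ =
                ∑ i, ∑ j, star (ξ (i, p)) * M.ψ (ι (star (Y m i) * Y m j)) ⟨b, p⟩ ⟨b, t⟩
                  * ξ (j, t) := by
              intro m p t
              rw [ha, ha, star_sum, Finset.sum_mul_sum]
              simp only [map_sum, Matrix.sum_apply, star_smul, smul_mul_smul_comm, map_smul,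
                Matrix.smul_apply, smul_eq_mul, map_mul, map_star]
              exact Finset.sum_congr rfl fun i _ => Finset.sum_congr rfl fun j _ => by ring
            have h4 : ∀ x y, star (ξ x) * N x y * ξ y =
                ∑ m, star (ξ x) * M.ψ (ι (star (Y m x.1) * Y m y.1)) ⟨b, x.2⟩ ⟨b, y.2⟩ * ξ y := by
              intro x y
              simp only [N, Matrix.of_apply, Matrix.mul_apply, map_sum, Matrix.sum_apply,
                Finset.mul_sum, Finset.sum_mul, Matrix.star_apply]
            simp only [h2, h3, h4, Fintype.sum_prod_type]
            calc _ = ∑ i, ∑ p, ∑ j, ∑ m, ∑ t, star (ξ (i, p)) *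
                    M.ψ (ι (star (Y m i) * Y m j)) ⟨b, p⟩ ⟨b, t⟩ * ξ (j, t) :=
                  Finset.sum_congr rfl fun i _ => Finset.sum_congr rfl fun p _ =>
                    Finset.sum_congr rfl fun j _ => Finset.sum_comm
              _ = ∑ i, ∑ p, ∑ m, ∑ j, ∑ t, star (ξ (i, p)) *
                    M.ψ (ι (star (Y m i) * Y m j)) ⟨b, p⟩ ⟨b, t⟩ * ξ (j, t) :=
                  Finset.sum_congr rfl fun i _ => Finset.sum_congr rfl fun p _ =>
                    Finset.sum_comm
              _ = ∑ i, ∑ m, ∑ p, ∑ j, ∑ t, star (ξ (i, p)) *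
                    M.ψ (ι (star (Y m i) * Y m j)) ⟨b, p⟩ ⟨b, t⟩ * ξ (j, t) :=
                  Finset.sum_congr rfl fun i _ => Finset.sum_comm
              _ = ∑ m, ∑ i, ∑ p, ∑ j, ∑ t, star (ξ (i, p)) *
                    M.ψ (ι (star (Y m i) * Y m j)) ⟨b, p⟩ ⟨b, t⟩ * ξ (j, t) := Finset.sum_comm
              _ = ∑ m, ∑ p, ∑ i, ∑ j, ∑ t, star (ξ (i, p)) *
                    M.ψ (ι (star (Y m i) * Y m j)) ⟨b, p⟩ ⟨b, t⟩ * ξ (j, t) :=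
                  Finset.sum_congr rfl fun m _ => Finset.sum_comm
              _ = ∑ m, ∑ p, ∑ i, ∑ t, ∑ j, star (ξ (i, p)) *
                    M.ψ (ι (star (Y m i) * Y m j)) ⟨b, p⟩ ⟨b, t⟩ * ξ (j, t) :=
                  Finset.sum_congr rfl fun m _ => Finset.sum_congr rfl fun p _ =>
                    Finset.sum_congr rfl fun i _ => Finset.sum_comm
              _ = _ :=
                  Finset.sum_congr rfl fun m _ => Finset.sum_congr rfl fun p _ =>
                    Finset.sum_comm
          rw [h1]
          exact Finset.sum_nonneg fun m _ => M.cp (a m)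
      obtain ⟨B, hB⟩ := psd_factor hNp
      refine ⟨B, fun i p j t => ?_⟩
      have := congrFun (congrFun hB (i, p)) (j, t)
      rw [Matrix.mul_apply] at this
      exact this
    choose B hB using hN
    refine ⟨Matrix.of fun m j => fun b => Matrix.of fun p t => B b (m, p) (j, t), ?_⟩
    ext i j b p t
    rw [Matrix.map_apply, hψ, Matrix.blockDiag'_apply, hB, Fintype.sum_prod_type,
      Matrix.mul_apply, Finset.sum_apply, Matrix.sum_apply]
    refine Finset.sum_congr rfl fun m _ => ?_
    rw [Pi.mul_apply, Matrix.mul_apply]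
    rfl
  · -- cp of φ
    rintro k _ ⟨Y, rfl⟩
    refine matrix_pos_pullback ι hι _ (Λ := Fin k × (Σ b, Fin (r b)) × L)
      (fun x j => ∑ t, Matrix.blockDiagonal' (Y x.1 j) x.2.1 t • star (M.z t x.2.2)) ?_
    intro i j
    rw [Matrix.map_apply, hφ]
    have h1 : Matrix.blockDiagonal' ((star Y * Y) i j) = ∑ m,
        (Matrix.blockDiagonal' (Y m i)).conjTranspose * Matrix.blockDiagonal' (Y m j) := by
      rw [Matrix.mul_apply]
      have : ∀ F : Fin k → FDBlock s r, Matrix.blockDiagonal' (∑ m, F m) =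
          ∑ m, Matrix.blockDiagonal' (F m) :=
        fun F => map_sum (Matrix.blockDiagonal'AddMonoidHom _ _ _) F Finset.univ
      rw [this]
      refine Finset.sum_congr rfl fun m _ => ?_
      rw [Matrix.blockDiagonal'_conjTranspose, ← Matrix.blockDiagonal'_mul]
      rfl
    rw [h1]
    simp only [Fintype.sum_prod_type, star_sum, star_smul, star_star, Finset.sum_mul_sum,
      smul_mul_smul_comm, Matrix.sum_apply, Matrix.mul_apply, Matrix.conjTranspose_apply, gram,
      Finset.sum_smul, Finset.smul_sum]
    generalize hf : (fun m u p t l => (star (Matrix.blockDiagonal' (Y m i) u p) *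
      Matrix.blockDiagonal' (Y m j) u t) • (M.z p l * star (M.z t l))) = f
    have hf' : ∀ m u p t l, (star (Matrix.blockDiagonal' (Y m i) u p) *
      Matrix.blockDiagonal' (Y m j) u t) • (M.z p l * star (M.z t l)) = f m u p t l := by
      intros; rw [← hf]
    simp only [hf']
    calc _ = ∑ p, ∑ t, ∑ m, ∑ l, ∑ u, f m u p t l :=
          Finset.sum_congr rfl fun _ _ => Finset.sum_congr rfl fun _ _ => Finset.sum_comm
      _ = ∑ p, ∑ m, ∑ t, ∑ l, ∑ u, f m u p t l :=
          Finset.sum_congr rfl fun _ _ => Finset.sum_comm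
      _ = ∑ m, ∑ p, ∑ t, ∑ l, ∑ u, f m u p t l :=
          Finset.sum_comm
      _ = ∑ m, ∑ p, ∑ t, ∑ u, ∑ l, f m u p t l :=
          Finset.sum_congr rfl fun _ _ => Finset.sum_congr rfl fun _ _ => Finset.sum_congr rfl fun _ _ => Finset.sum_comm
      _ = ∑ m, ∑ p, ∑ u, ∑ t, ∑ l, f m u p t l :=
          Finset.sum_congr rfl fun _ _ => Finset.sum_congr rfl fun _ _ => Finset.sum_comm
      _ = ∑ m, ∑ u, ∑ p, ∑ t, ∑ l, f m u p t l :=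
          Finset.sum_congr rfl fun _ _ => Finset.sum_comm
      _ = ∑ m, ∑ u, ∑ p, ∑ l, ∑ t, f m u p t l :=
          Finset.sum_congr rfl fun _ _ => Finset.sum_congr rfl fun _ _ => Finset.sum_congr rfl fun _ _ => Finset.sum_comm
      _ = _ :=
          Finset.sum_congr rfl fun _ _ => Finset.sum_congr rfl fun _ _ => Finset.sum_comm
  · intro a
    refine (pi_norm_le_iff_of_nonneg (norm_nonneg a)).2 fun b => ?_
    refine norm_le_of_psd _ (norm_nonneg a) ?_
    have h1 := (M.bound (ι a) (NonUnitalStarAlgHom.norm_map ι hι a).le).submatrix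
      (fun i : Fin (r b) => (⟨b, i⟩ : Σ b, Fin (r b)))
    convert h1 using 1
    ext i j
    rw [← hbd, Matrix.blockDiagonal'_conjTranspose, ← Matrix.blockDiagonal'_mul]
    simp only [Matrix.submatrix_apply, Matrix.sub_apply, Matrix.smul_apply,
      Matrix.blockDiagonal'_apply_eq, Matrix.one_apply, Sigma.mk.injEq, heq_eq_eq, true_and]
  · intro c
    have hx0 : ∀ x ∈ blockSupp (r := r) M.col c, ∀ i j : Σ b, Fin (r b), M.col i.1 ≠ c →
        Matrix.blockDiagonal' x i j = 0 := by
      rintro x hx ⟨b, i⟩ ⟨b', j⟩ h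
      by_cases hbb : b = b'
      · subst hbb; rw [Matrix.blockDiagonal'_apply_eq, hx b h]; rfl
      · rw [Matrix.blockDiagonal'_apply_ne _ _ _ hbb]
    have hx1 : ∀ (x : FDBlock s r) (i j : Σ b, Fin (r b)), i.1 ≠ j.1 →
        Matrix.blockDiagonal' x i j = 0 := by
      rintro x ⟨b, i⟩ ⟨b', j⟩ h
      rw [Matrix.blockDiagonal'_apply_ne _ _ _ h]
    constructor
    · intro x hx
      rw [← NonUnitalStarAlgHom.norm_map ι hι, hφ]
      let z' : (Σ b, Fin (r b)) → L → E := fun i l => if M.col i.1 = c then M.z i l else 0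
      have e1 : ∑ i, ∑ j, Matrix.blockDiagonal' x i j • gram M.z i j =
          ∑ i, ∑ j, Matrix.blockDiagonal' x i j • gram z' i j := by
        refine Finset.sum_congr rfl fun i _ => Finset.sum_congr rfl fun j _ => ?_
        by_cases h1 : i.1 = j.1
        · by_cases h2 : M.col i.1 = c
          · congr 1
            simp only [gram, z', ← h1, h2, if_true]
          · rw [hx0 x hx i j h2, zero_smul, zero_smul]
        · rw [hx1 x i j h1, zero_smul, zero_smul]
      rw [e1]
      refine colnorm z' ?_ _ (norm_nonneg x) (hpsd x)
      have h1 := M.sum_le c (Finset.univ.filter fun i => M.col (M.blk i) = c)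
        (fun i hi => (Finset.mem_filter.1 hi).2)
      rw [isPos_iff, sub_nonneg] at h1
      refine le_trans (le_of_eq ?_) h1
      rw [Finset.sum_filter]
      refine Finset.sum_congr rfl fun i _ => ?_
      rw [hb]
      by_cases h2 : M.col i.1 = c
      · simp only [gram, z', h2, if_true]
      · simp only [gram, z', h2, if_false, zero_mul, Finset.sum_const_zero]
    · have key : ∀ x ∈ blockSupp (r := r) M.col c, ∀ y ∈ blockSupp (r := r) M.col c,
          x * y = 0 → φ x * φ y = 0 := by
        intro x hx y hy hxy
        apply hι
        rw [map_mul, hφ, hφ, map_zero]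
        have e1 : ∀ i j k l, Matrix.blockDiagonal' x i j • gram M.z i j *
            Matrix.blockDiagonal' y k l • gram M.z k l =
            if j = k then (Matrix.blockDiagonal' x i j * Matrix.blockDiagonal' y k l) • M.T i l
              else 0 := by
          intro i j k l
          rw [smul_mul_smul_comm]
          by_cases h1 : i.1 = j.1
          swap
          · rw [hx1 x i j h1]; simp
          by_cases h2 : k.1 = l.1
          swap
          · rw [hx1 y k l h2]; simp
          by_cases h3 : M.col i.1 = c
          swap
          · rw [hx0 x hx i j h3]; simp
          by_cases h4 : M.col k.1 = c
          swap
          · rw [hx0 y hy k l h4]; simp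
          split_ifs with h5
          · subst h5
            rw [M.mul_eq i j l (by rw [hb]; exact h1) (by rw [hb]; exact h2)]
          · rw [M.mul_ne i j k l (by rw [hb]; exact h1) (by rw [hb]; exact h2)
              (by rw [hb]; rw [← h1, h3, h4]) h5, smul_zero]
        have e2 : ∀ i, (∑ j, Matrix.blockDiagonal' x i j • gram M.z i j) *
            (∑ k, ∑ l, Matrix.blockDiagonal' y k l • gram M.z k l) =
            ∑ l, ((Matrix.blockDiagonal' x * Matrix.blockDiagonal' y) i l) • M.T i l := by
          intro i
          calc _ = ∑ j, ∑ k, ∑ l, Matrix.blockDiagonal' x i j • gram M.z i j *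
                Matrix.blockDiagonal' y k l • gram M.z k l := by
                rw [Finset.sum_mul]
                refine Finset.sum_congr rfl fun j _ => ?_
                rw [Finset.mul_sum]
                exact Finset.sum_congr rfl fun k _ => Finset.mul_sum _ _ _
            _ = ∑ j, ∑ l, (Matrix.blockDiagonal' x i j * Matrix.blockDiagonal' y j l) •
                M.T i l := by
                refine Finset.sum_congr rfl fun j _ => ?_
                simp only [e1]
                rw [Finset.sum_comm]
                exact Finset.sum_congr rfl fun l _ => by
                  rw [Finset.sum_ite_eq]; simp
            _ = _ := by
                rw [Finset.sum_comm]
                exact Finset.sum_congr rfl fun l _ => by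
                  rw [Matrix.mul_apply, Finset.sum_smul]
        rw [Finset.sum_mul]
        simp only [e2]
        rw [← Matrix.blockDiagonal'_mul]
        have : (fun b => x b * y b) = (0 : FDBlock s r) := hxy
        simp [this]
      exact fun x hx y hy h1 h2 => ⟨key x hx y hy h1, key y hy x hx h2⟩
  · intro a
    rw [hφ, hbd]; rfl

theorem HD_to_nuc [Fintype κ] {H : Set E} (h : HD κ E H) (ι : D →⋆ₙₐ[ℂ] E)
    (hι : Function.Injective ι) (hr : Set.range ι = H) : ∃ n, NuclearDimensionLE n D := by
  classical
  refine ⟨Fintype.card κ, fun S ε hε => ?_⟩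
  obtain ⟨I, β, L, _, _, _, M, hM, hS⟩ := h (S.image ι) ε
    (fun a ha => by
      obtain ⟨b, _, rfl⟩ := Finset.mem_image.1 ha
      rw [← hr]; exact ⟨b, rfl⟩) hε
  let g : κ → Fin (Fintype.card κ + 1) := fun x => (Fintype.equivFin κ x).castSucc
  have hg : Function.Injective g := fun x y hxy =>
    (Fintype.equivFin κ).injective (Fin.castSucc_injective _ hxy)
  obtain ⟨s, r, M', hb, hgr, hΦ⟩ := M.std g hg
  obtain ⟨J, ψ, φ, h1, h2, h3, h4, h5⟩ := HD_to_nuc_aux ι hι hr M' hb fun i j => by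
    obtain ⟨i', j', h⟩ := hgr i j
    rw [h]; exact hM _ _
  refine ⟨s, r, J, ψ, φ, h1, h2, h3, h4, fun a ha => ?_⟩
  rw [← NonUnitalStarAlgHom.norm_map ι hι, map_sub, h5, hΦ]
  exact hS _ (Finset.mem_image_of_mem _ ha)

end C2F


section conj
variable {κ E : Type} [CStarAlgebra E] {I β L : Type} [Fintype I] [DecidableEq I]
    [Fintype L]

/-- change of basis for vectors -/
def zconj (V : Matrix I I ℂ) (z : I → L → E) : I → L → E := fun a l => ∑ i, V i a • z i l

theorem gram_zconj (V : Matrix I I ℂ) (z : I → L → E) (a b : I) :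
    gram (zconj V z) a b = ∑ i, ∑ j, (V i a * star (V j b)) • gram z i j := by
  simp only [gram, zconj, star_sum, star_smul, Finset.sum_mul_sum, smul_mul_smul_comm,
    Finset.smul_sum]
  rw [Finset.sum_comm]
  exact Finset.sum_congr rfl fun i _ => Finset.sum_comm

theorem Dat.conj_mul (D : Dat κ E I β L) (V : Matrix I I ℂ) (h1 : V.conjTranspose * V = 1)
    (hV : ∀ i j, D.blk i ≠ D.blk j → V i j = 0) (a b b' c : I) (hab : D.blk a = D.blk b)
    (hbc : D.blk b' = D.blk c) (hc : D.col (D.blk b) = D.col (D.blk b')) :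
    gram (zconj V D.z) a b * gram (zconj V D.z) b' c =
      if b = b' then ∑ i, ∑ l, (V i a * star (V l c)) • D.T i l else 0 := by
  have e1 : ∀ i j k l, (V i a * star (V j b)) • gram D.z i j *
      (V k b' * star (V l c)) • gram D.z k l =
      if j = k then (V i a * star (V l c)) • (star (V j b) * V j b') • D.T i l else 0 := by
    intro i j k l
    rw [smul_mul_smul_comm]
    by_cases g1 : D.blk i = D.blk a
    swap
    · rw [hV i a g1]; simp
    by_cases g2 : D.blk j = D.blk b
    swap
    · rw [hV j b g2]; simp
    by_cases g3 : D.blk k = D.blk b'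
    swap
    · rw [hV k b' g3]
      split_ifs with h
      · rw [h, hV k b' g3]; simp
      · simp
    by_cases g4 : D.blk l = D.blk c
    swap
    · rw [hV l c g4]; simp
    split_ifs with h
    · subst h
      rw [D.mul_eq i j l (by rw [g1, g2, hab]) (by rw [g3, g4, hbc]), smul_smul]
      congr 1; ring
    · rw [D.mul_ne i j k l (by rw [g1, g2, hab]) (by rw [g3, g4, hbc]) (by rw [g2, g3, hc]) h,
        smul_zero]
  have e0 : ∑ j, star (V j b) * V j b' = if b = b' then 1 else 0 := by
    have := congrFun (congrFun h1 b) b'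
    rw [Matrix.mul_apply, Matrix.one_apply] at this
    exact this
  rw [gram_zconj, gram_zconj]
  calc _ = ∑ i, ∑ j, ∑ k, ∑ l, (V i a * star (V j b)) • gram D.z i j *
          (V k b' * star (V l c)) • gram D.z k l := by
        rw [Finset.sum_mul]; refine Finset.sum_congr rfl fun i _ => ?_
        rw [Finset.sum_mul]; refine Finset.sum_congr rfl fun j _ => ?_
        rw [Finset.mul_sum]; refine Finset.sum_congr rfl fun k _ => ?_
        rw [Finset.mul_sum]
    _ = ∑ i, ∑ j, ∑ l, (V i a * star (V l c)) • (star (V j b) * V j b') • D.T i l := by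
        refine Finset.sum_congr rfl fun i _ => Finset.sum_congr rfl fun j _ => ?_
        simp only [e1]
        rw [Finset.sum_comm]
        exact Finset.sum_congr rfl fun l _ => by rw [Finset.sum_ite_eq]; simp
    _ = ∑ i, ∑ l, (V i a * star (V l c)) • (∑ j, star (V j b) * V j b') • D.T i l := by
        refine Finset.sum_congr rfl fun i _ => ?_
        rw [Finset.sum_comm]
        exact Finset.sum_congr rfl fun l _ => by rw [Finset.sum_smul, Finset.smul_sum]
    _ = _ := by
        rw [e0]
        split_ifs <;> simp

/-- Change of basis. -/
def Dat.conj (D : Dat κ E I β L) (V : Matrix I I ℂ) (h1 : V.conjTranspose * V = 1)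
    (h2 : V * V.conjTranspose = 1)
    (hV : ∀ i j, D.blk i ≠ D.blk j → V i j = 0) : Dat κ E I β L where
  blk := D.blk
  col := D.col
  ψ :=
    { toFun := fun x => V.conjTranspose * D.ψ x * V
      map_add' := fun x y => by rw [map_add, mul_add, add_mul]
      map_smul' := fun c x => by rw [map_smul, mul_smul_comm, smul_mul_assoc]; rfl }
  z := zconj V D.z
  T := fun a c => ∑ i, ∑ l, (V i a * star (V l c)) • D.T i l
  cp := fun a => by
    refine (D.cp fun p => ∑ i, V p i • a i).trans_eq ?_
    simp only [star_sum, star_smul, Finset.sum_mul_sum, smul_mul_smul_comm, map_sum, map_smul,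
      Matrix.sum_apply, Matrix.smul_apply, smul_eq_mul]
    simp only [LinearMap.coe_mk, AddHom.coe_mk, Matrix.mul_apply, Matrix.conjTranspose_apply,
      Finset.sum_mul]
    generalize hf : (fun p q i j => star (V p i) * V q j * (D.ψ (star (a i) * a j)) p q) = f
    have e1 : ∀ p q i j, star (V p i) * V q j * (D.ψ (star (a i) * a j)) p q = f p q i j := by
      intros; rw [← hf]
    have e2 : ∀ p q i j, star (V p i) * (D.ψ (star (a i) * a j)) p q * V q j = f p q i j := by
      intros; rw [← hf]; ring
    simp only [e1, e2]
    calc _ = ∑ p, ∑ i, ∑ q, ∑ j, f p q i j := Finset.sum_congr rfl fun _ _ => Finset.sum_comm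
      _ = ∑ i, ∑ p, ∑ q, ∑ j, f p q i j := Finset.sum_comm
      _ = ∑ i, ∑ p, ∑ j, ∑ q, f p q i j :=
        Finset.sum_congr rfl fun _ _ => Finset.sum_congr rfl fun _ _ => Finset.sum_comm
      _ = ∑ i, ∑ j, ∑ p, ∑ q, f p q i j := Finset.sum_congr rfl fun _ _ => Finset.sum_comm
      _ = _ :=
        Finset.sum_congr rfl fun _ _ => Finset.sum_congr rfl fun _ _ => Finset.sum_comm
  ctr := by
    have : 1 - V.conjTranspose * D.ψ 1 * V = V.conjTranspose * (1 - D.ψ 1) * V := by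
      rw [mul_sub, sub_mul, mul_one, h1]
    change (1 - V.conjTranspose * D.ψ 1 * V).PosSemidef
    rw [this]; exact D.ctr.conjTranspose_mul_mul_same V
  off := fun x a b hab => by
    simp only [LinearMap.coe_mk, AddHom.coe_mk, Matrix.mul_apply, Matrix.conjTranspose_apply,
      Finset.sum_mul]
    refine Finset.sum_eq_zero fun q _ => Finset.sum_eq_zero fun p _ => ?_
    by_cases g1 : D.blk p = D.blk a
    swap
    · rw [hV p a g1]; simp
    by_cases g2 : D.blk q = D.blk b
    swap
    · rw [hV q b g2]; simp
    rw [D.off x p q (by rw [g1, g2]; exact hab)]; simp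
  mul_ne := fun i j k l g1 g2 g3 g4 => by
    rw [D.conj_mul V h1 hV i j k l g1 g2 g3, if_neg g4]
  mul_eq := fun i j l g1 g2 => by
    rw [D.conj_mul V h1 hV i j j l g1 g2 rfl, if_pos rfl]
  sum_le := fun c s hs => by
    let := CStarAlgebra.spectralOrder E
    have := CStarAlgebra.spectralOrderedRing E
    classical
    have g1 := D.sum_le c (Finset.univ.filter fun i => D.col (D.blk i) = c)
      (fun i hi => (Finset.mem_filter.1 hi).2)
    rw [isPos_iff, sub_nonneg] at g1 ⊢
    have g2 : ∑ a ∈ s, gram (zconj V D.z) a a ≤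
        ∑ a ∈ Finset.univ.filter (fun i => D.col (D.blk i) = c), gram (zconj V D.z) a a :=
      Finset.sum_le_sum_of_subset_of_nonneg
        (fun i hi => Finset.mem_filter.2 ⟨Finset.mem_univ _, hs i hi⟩)
        fun i _ _ => Finset.sum_nonneg fun l _ => mul_star_self_nonneg _
    refine g2.trans (le_trans (le_of_eq ?_) g1)
    rw [Finset.sum_filter, Finset.sum_filter]
    have e0 : ∀ i j, ∑ a, V i a * star (V j a) = if i = j then 1 else 0 := by
      intro i j
      have := congrFun (congrFun h2 i) j
      rw [Matrix.mul_apply, Matrix.one_apply] at this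
      exact this
    calc _ = ∑ a, ∑ i, ∑ j, if D.col (D.blk i) = c then (V i a * star (V j a)) • gram D.z i j
              else 0 := by
          refine Finset.sum_congr rfl fun a _ => ?_
          have : ∀ i j, (if D.col (D.blk i) = c then (V i a * star (V j a)) • gram D.z i j
              else 0) = if D.col (D.blk a) = c then (V i a * star (V j a)) • gram D.z i j
              else 0 := by
            intro i j
            by_cases g : D.blk i = D.blk a
            · rw [g]
            · rw [hV i a g]; simp
          simp only [this]
          split_ifs
          · rw [gram_zconj]
          · simp
      _ = ∑ i, ∑ j, if D.col (D.blk i) = c then (∑ a, V i a * star (V j a)) • gram D.z i j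
              else 0 := by
          rw [Finset.sum_comm]
          refine Finset.sum_congr rfl fun i _ => ?_
          rw [Finset.sum_comm]
          refine Finset.sum_congr rfl fun j _ => ?_
          split_ifs
          · rw [Finset.sum_smul]
          · simp
      _ = _ := by
          refine Finset.sum_congr rfl fun i _ => ?_
          split_ifs
          · simp only [e0, ite_smul, one_smul, zero_smul]
            rw [Finset.sum_ite_eq]; simp
          · simp

theorem Dat.conj_Φ (D : Dat κ E I β L) (V : Matrix I I ℂ) (h1 : V.conjTranspose * V = 1)
    (h2 : V * V.conjTranspose = 1)
    (hV : ∀ i j, D.blk i ≠ D.blk j → V i j = 0) (x : E) : (D.conj V h1 h2 hV).Φ x = D.Φ x := by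
  change ∑ a, ∑ b, (V.conjTranspose * D.ψ x * V) a b • gram (zconj V D.z) a b = _
  set N := V.conjTranspose * D.ψ x * V
  have hN : V * N * V.conjTranspose = D.ψ x := by
    simp only [N]
    calc _ = (V * V.conjTranspose) * D.ψ x * (V * V.conjTranspose) := by noncomm_ring
      _ = _ := by rw [h2]; simp
  simp only [gram_zconj, Finset.smul_sum, smul_smul]
  rw [Dat.Φ, ← hN]
  simp only [Matrix.mul_apply, Matrix.conjTranspose_apply, Finset.sum_mul, Finset.sum_smul]
  generalize hf : (fun a b i j => (N a b * (V i a * star (V j b))) • gram D.z i j) = f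
  have e1 : ∀ a b i j, (N a b * (V i a * star (V j b))) • gram D.z i j = f a b i j := by
    intros; rw [← hf]
  have e2 : ∀ a b i j, (V i a * N a b * star (V j b)) • gram D.z i j = f a b i j := by
    intros; rw [← hf]; congr 1; ring
  simp only [e1, e2]
  calc _ = ∑ a, ∑ i, ∑ b, ∑ j, f a b i j := Finset.sum_congr rfl fun _ _ => Finset.sum_comm
    _ = ∑ i, ∑ a, ∑ b, ∑ j, f a b i j := Finset.sum_comm
    _ = ∑ i, ∑ a, ∑ j, ∑ b, f a b i j :=
      Finset.sum_congr rfl fun _ _ => Finset.sum_congr rfl fun _ _ => Finset.sum_comm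
    _ = ∑ i, ∑ j, ∑ a, ∑ b, f a b i j := Finset.sum_congr rfl fun _ _ => Finset.sum_comm
    _ = _ := Finset.sum_congr rfl fun _ _ => Finset.sum_congr rfl fun _ _ => Finset.sum_comm

theorem Dat.diag (D : Dat κ E I β L) (e : E) (he : IsPosElem e) :
    ∃ (I' β' : Type) (_ : Fintype I') (_ : DecidableEq I') (D' : Dat κ E I' β' L),
      (∀ a, D'.Φ a = D.Φ a) ∧ ∀ i j, i ≠ j → D'.ψ e i j = 0 := by
  obtain ⟨s, r, D1, hb, -, hΦ⟩ := D.std id Function.injective_id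
  have hH : ∀ b, (Matrix.blockDiag' (D1.ψ e) b).IsHermitian := by
    intro b
    obtain ⟨y, rfl⟩ := he
    have := (D1.psi_pos' y).1
    rw [Matrix.IsHermitian, ← Matrix.blockDiag'_conjTranspose, this]
  have hbd : Matrix.blockDiagonal' (Matrix.blockDiag' (D1.ψ e)) = D1.ψ e := by
    ext ⟨b, i⟩ ⟨c, j⟩
    by_cases h : b = c
    · subst h; rw [Matrix.blockDiagonal'_apply_eq]; rfl
    · rw [Matrix.blockDiagonal'_apply_ne _ _ _ h, D1.off]; rw [hb]; exact h
  let U : FDBlock s r := fun b => ((hH b).eigenvectorUnitary : Matrix (Fin (r b)) (Fin (r b)) ℂ)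
  have hU1 : ∀ b, (U b).conjTranspose * U b = 1 := fun b =>
    Unitary.coe_star_mul_self (hH b).eigenvectorUnitary
  have hU2 : ∀ b, U b * (U b).conjTranspose = 1 := fun b =>
    Unitary.coe_mul_star_self (hH b).eigenvectorUnitary
  have hd : ∀ b, (U b).conjTranspose * Matrix.blockDiag' (D1.ψ e) b * U b =
      Matrix.diagonal (fun i => ((hH b).eigenvalues i : ℂ)) := by
    intro b
    conv_lhs => enter [1, 2]; rw [(hH b).spectral_theorem]
    change (U b).conjTranspose * (U b * _ * (U b).conjTranspose) * U b = _
    calc _ = ((U b).conjTranspose * U b) * _ * ((U b).conjTranspose * U b) := by noncomm_ring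
      _ = _ := by rw [hU1, one_mul, mul_one]; rfl
  have h1 : (Matrix.blockDiagonal' U).conjTranspose * Matrix.blockDiagonal' U = 1 := by
    rw [Matrix.blockDiagonal'_conjTranspose, ← Matrix.blockDiagonal'_mul,
      ← Matrix.blockDiagonal'_one]
    congr 1; ext1 b; exact hU1 b
  have h2 : Matrix.blockDiagonal' U * (Matrix.blockDiagonal' U).conjTranspose = 1 := by
    rw [Matrix.blockDiagonal'_conjTranspose, ← Matrix.blockDiagonal'_mul,
      ← Matrix.blockDiagonal'_one]
    congr 1; ext1 b; exact hU2 b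
  have hV : ∀ i j, D1.blk i ≠ D1.blk j → Matrix.blockDiagonal' U i j = 0 := by
    rintro ⟨b, i⟩ ⟨c, j⟩ h
    rw [hb] at h
    exact Matrix.blockDiagonal'_apply_ne _ _ _ h
  refine ⟨_, _, inferInstance, inferInstance, D1.conj _ h1 h2 hV, fun a => ?_, fun i j hij => ?_⟩
  · rw [D1.conj_Φ, hΦ]
  · change ((Matrix.blockDiagonal' U).conjTranspose * D1.ψ e * Matrix.blockDiagonal' U) i j = 0
    rw [← hbd, Matrix.blockDiagonal'_conjTranspose, ← Matrix.blockDiagonal'_mul,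
      ← Matrix.blockDiagonal'_mul]
    simp only [hd]
    rw [Matrix.blockDiagonal'_diagonal, Matrix.diagonal_apply_ne _ hij]

end conj


section cut

theorem algMap_cpx {E : Type*} [CStarAlgebra E] (c : ℝ) :
    algebraMap ℝ E c = (c : ℂ) • 1 := by
  rw [Algebra.algebraMap_eq_smul_one, Complex.coe_smul]

theorem col_factor {E : Type*} [CStarAlgebra E] [PartialOrder E] [StarOrderedRing E] {I L : Type*}
    [Fintype I] [DecidableEq I] [Fintype L] (z : I → L → E) (hz : ∑ i, gram z i i ≤ 1)
    (X : Matrix I I ℂ) {c : ℝ} (hc : 0 ≤ c)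
    (hX : (((c ^ 2 : ℝ) : ℂ) • 1 - X.conjTranspose * X).PosSemidef) :
    ∃ y : I × L → E, ∑ i, ∑ j, X i j • gram z i j = ∑ p : I × L, z p.1 p.2 * star (y p) ∧
      ∑ p, y p * star (y p) ≤ algebraMap ℝ E (c ^ 2) := by
  let y : I × L → E := fun p => ∑ j, star (X p.1 j) • z j p.2
  have h1 : ∑ i, ∑ j, X i j • gram z i j = ∑ p : I × L, z p.1 p.2 * star (y p) := by
    rw [Fintype.sum_prod_type]
    refine Finset.sum_congr rfl fun i _ => ?_
    simp only [y, star_sum, star_smul, star_star, Finset.mul_sum, mul_smul_comm, gram,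
      Finset.smul_sum]
    rw [Finset.sum_comm]
  refine ⟨y, h1, ?_⟩
  · have h2 : ∑ p, y p * star (y p) = ∑ i, ∑ j, (X.conjTranspose * X) i j • gram z i j := by
      rw [Fintype.sum_prod_type]
      simp only [y, star_sum, star_smul, star_star, gram, Finset.sum_mul_sum,
        smul_mul_smul_comm, Matrix.mul_apply, Matrix.conjTranspose_apply, Finset.sum_smul,
        Finset.smul_sum]
      calc _ = ∑ k, ∑ i, ∑ l, ∑ j, (star (X k i) * X k j) • (z i l * star (z j l)) :=
            Finset.sum_congr rfl fun k _ => Finset.sum_comm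
        _ = ∑ k, ∑ i, ∑ j, ∑ l, (star (X k i) * X k j) • (z i l * star (z j l)) :=
            Finset.sum_congr rfl fun k _ => Finset.sum_congr rfl fun i _ => Finset.sum_comm
        _ = ∑ i, ∑ k, ∑ j, ∑ l, (star (X k i) * X k j) • (z i l * star (z j l)) :=
            Finset.sum_comm
        _ = ∑ i, ∑ j, ∑ k, ∑ l, (star (X k i) * X k j) • (z i l * star (z j l)) :=
            Finset.sum_congr rfl fun i _ => Finset.sum_comm
        _ = _ := Finset.sum_congr rfl fun k _ => Finset.sum_congr rfl fun i _ => Finset.sum_comm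
    have h3 := gram_form z hX
    have h4 : ∑ i, ∑ j, (((c ^ 2 : ℝ) : ℂ) • 1 - X.conjTranspose * X) i j • gram z i j =
        ((c ^ 2 : ℝ) : ℂ) • ∑ i, gram z i i - ∑ p, y p * star (y p) := by
      rw [h2]
      simp only [Matrix.sub_apply, sub_smul, Finset.sum_sub_distrib, Finset.smul_sum]
      congr 1
      refine Finset.sum_congr rfl fun i _ => ?_
      rw [Finset.sum_eq_single i]
      · simp
      · intro j _ hj; simp [Matrix.one_apply_ne (Ne.symm hj)]
      · simp
    rw [h4, sub_nonneg] at h3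
    refine h3.trans ?_
    rw [algMap_cpx, Complex.coe_smul, Complex.coe_smul]
    exact smul_le_smul_of_nonneg_left hz (by positivity)

theorem col_left {E : Type*} [CStarAlgebra E] [PartialOrder E] [StarOrderedRing E] {I L : Type*}
    [Fintype I] [DecidableEq I] [Fintype L] (z : I → L → E) (hz : ∑ i, gram z i i ≤ 1)
    (X : Matrix I I ℂ) {c : ℝ} (hX : ‖X‖ ≤ c) (t : E) {μ : ℝ} (hμ : 0 < μ)
    (ht : ‖t * (∑ i, gram z i i) * star t‖ ≤ μ ^ 2) :
    ‖t * ∑ i, ∑ j, X i j • gram z i j‖ ≤ μ * c := by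
  have hc : 0 ≤ c := (norm_nonneg _).trans hX
  obtain ⟨y, h1, h2⟩ := col_factor z hz X hc (sq_psd X hX)
  have hk0 : 0 ≤ ∑ i, gram z i i := Finset.sum_nonneg fun i _ => Finset.sum_nonneg fun l _ =>
    mul_star_self_nonneg _
  have hle : t * (∑ i, gram z i i) * star t ≤ algebraMap ℝ E (μ ^ 2) :=
    (CStarAlgebra.norm_le_iff_le_algebraMap _ (by positivity)
      (star_right_conjugate_nonneg hk0 t)).1 ht
  have h3 : ‖∑ p : I × L, (((μ⁻¹ : ℝ) : ℂ) • (t * z p.1 p.2)) * star (y p)‖ ≤ c := by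
    refine cs_norm_le _ _ ?_ hc h2
    have : ∑ p : I × L, (((μ⁻¹ : ℝ) : ℂ) • (t * z p.1 p.2)) *
        star (((μ⁻¹ : ℝ) : ℂ) • (t * z p.1 p.2)) =
        (μ⁻¹ ^ 2) • (t * (∑ i, gram z i i) * star t) := by
      simp only [star_smul, star_mul, smul_mul_smul_comm, Finset.mul_sum, Finset.sum_mul, gram,
        Fintype.sum_prod_type, Finset.smul_sum]
      refine Finset.sum_congr rfl fun i _ => Finset.sum_congr rfl fun l _ => ?_
      rw [← Complex.coe_smul]
      congr 1
      · simp [sq]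
      · simp only [mul_assoc]
    rw [this]
    refine (smul_le_smul_of_nonneg_left hle (by positivity)).trans (le_of_eq ?_)
    rw [Algebra.algebraMap_eq_smul_one, smul_smul]
    have : μ⁻¹ ^ 2 * μ ^ 2 = 1 := by field_simp
    rw [this, one_smul]
  have h4 : t * ∑ i, ∑ j, X i j • gram z i j =
      ((μ : ℝ) : ℂ) • ∑ p : I × L, (((μ⁻¹ : ℝ) : ℂ) • (t * z p.1 p.2)) * star (y p) := by
    rw [h1, Finset.mul_sum, Finset.smul_sum]
    refine Finset.sum_congr rfl fun p _ => ?_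
    rw [smul_mul_assoc, smul_smul, ← Complex.ofReal_mul, mul_inv_cancel₀ hμ.ne']
    simp [mul_assoc]
  rw [h4, norm_smul, Complex.norm_real, Real.norm_of_nonneg hμ.le]
  gcongr

variable {κ E I β L : Type} [CStarAlgebra E] [Fintype I] [DecidableEq I] [Fintype L]

open Classical in
/-- Restriction to a colour. -/
def Dat.zc (D : Dat κ E I β L) (c : κ) : I → L → E :=
  fun i l => if D.col (D.blk i) = c then D.z i l else 0

theorem Dat.gram_zc (D : Dat κ E I β L) (c : κ) (i j : I) (hi : D.col (D.blk i) = c)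
    (hj : D.col (D.blk j) = c) : gram (D.zc c) i j = gram D.z i j := by
  simp [gram, Dat.zc, hi, hj]

theorem Dat.gram_zc' (D : Dat κ E I β L) (c : κ) (i j : I) (hi : D.col (D.blk i) ≠ c) :
    gram (D.zc c) i j = 0 := by
  simp [gram, Dat.zc, hi]

theorem Dat.zc_le [PartialOrder E] [StarOrderedRing E] (D : Dat κ E I β L) (c : κ) :
    ∑ i, gram (D.zc c) i i ≤ 1 := by
  classical
  have g1 := D.sum_le c (Finset.univ.filter fun i => D.col (D.blk i) = c)
      (fun i hi => (Finset.mem_filter.1 hi).2)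
  rw [isPos_iff, sub_nonneg] at g1
  refine le_trans (le_of_eq ?_) g1
  rw [Finset.sum_filter]
  refine Finset.sum_congr rfl fun i _ => ?_
  split_ifs with h
  · rw [D.gram_zc c i i h h]
  · rw [D.gram_zc' c i i h]

theorem Dat.split [Fintype κ] (D : Dat κ E I β L) (X : Matrix I I ℂ)
    (hX : ∀ i j, D.blk i ≠ D.blk j → X i j = 0) (v : κ → E) :
    ∑ i, ∑ j, X i j • (v (D.col (D.blk i)) * gram D.z i j * star (v (D.col (D.blk j)))) =
      ∑ c, v c * (∑ i, ∑ j, X i j • gram (D.zc c) i j) * star (v c) := by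
  classical
  simp only [Finset.mul_sum, Finset.sum_mul]
  symm
  rw [Finset.sum_comm]
  refine Finset.sum_congr rfl fun i _ => ?_
  rw [Finset.sum_comm]
  refine Finset.sum_congr rfl fun j _ => ?_
  by_cases hb : D.blk i = D.blk j
  · rw [Finset.sum_eq_single (D.col (D.blk i))]
    · rw [D.gram_zc _ i j rfl (by rw [hb]), hb, mul_smul_comm, smul_mul_assoc]
    · intro c _ hc
      rw [D.gram_zc' c i j (Ne.symm hc)]; simp
    · simp
  · simp [hX i j hb]

theorem Dat.split1 [Fintype κ] (D : Dat κ E I β L) (X : Matrix I I ℂ)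
    (hX : ∀ i j, D.blk i ≠ D.blk j → X i j = 0) :
    ∑ i, ∑ j, X i j • gram D.z i j = ∑ c, ∑ i, ∑ j, X i j • gram (D.zc c) i j := by
  have := D.split X hX fun _ => 1
  simpa using this

theorem Dat.total_norm [Fintype κ] (D : Dat κ E I β L) (X : Matrix I I ℂ)
    (hX : ∀ i j, D.blk i ≠ D.blk j → X i j = 0) {c : ℝ} (hc : ‖X‖ ≤ c) :
    ‖∑ i, ∑ j, X i j • gram D.z i j‖ ≤ Fintype.card κ * c := by
  let := CStarAlgebra.spectralOrder E
  have := CStarAlgebra.spectralOrderedRing E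
  rw [D.split1 X hX]
  refine (norm_sum_le _ _).trans ?_
  refine (Finset.sum_le_sum fun k _ => colnorm (D.zc k) (D.zc_le k) X
    ((norm_nonneg _).trans hc) (sq_psd X hc)).trans ?_
  simp

theorem Dat.psi_norm (D : Dat κ E I β L) (a : E) {c : ℝ} (h : ‖a‖ ≤ c) : ‖D.ψ a‖ ≤ c :=
  norm_le_of_psd _ ((norm_nonneg _).trans h) (D.bound a h)

theorem Dat.Phi_norm [Fintype κ] (D : Dat κ E I β L) (a : E) {c : ℝ} (h : ‖a‖ ≤ c) :
    ‖D.Φ a‖ ≤ Fintype.card κ * c :=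
  D.total_norm _ (fun i j => D.off a i j) (D.psi_norm a h)

theorem Dat.Phi_sub (D : Dat κ E I β L) (a b : E) : D.Φ (a - b) = D.Φ a - D.Φ b := by
  simp only [Dat.Φ, map_sub, Matrix.sub_apply, sub_smul, Finset.sum_sub_distrib]

/-- Conjugating each colour. -/
def Dat.twist (D : Dat κ E I β L) (v : κ → E) (hv : ∀ c, ‖v c‖ ≤ 1)
    (hcomm : ∀ i j, D.blk i = D.blk j → Commute
      (star (v (D.col (D.blk i))) * v (D.col (D.blk i))) (gram D.z i j)) : Dat κ E I β L where
  blk := D.blk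
  col := D.col
  ψ := D.ψ
  z := fun i l => v (D.col (D.blk i)) * D.z i l
  T := fun i l => v (D.col (D.blk i)) * (star (v (D.col (D.blk i))) * v (D.col (D.blk i))) *
    D.T i l * star (v (D.col (D.blk i)))
  cp := D.cp
  ctr := D.ctr
  off := D.off
  mul_ne := fun i j k l h1 h2 h3 h4 => by
    have e : ∀ i j, gram (fun i l => v (D.col (D.blk i)) * D.z i l) i j =
      v (D.col (D.blk i)) * gram D.z i j * star (v (D.col (D.blk j))) := by
      intro i j; simp [gram, Finset.mul_sum, Finset.sum_mul, mul_assoc]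
    have hc := hcomm i j h1
    have := D.mul_ne i j k l h1 h2 h3 h4
    rw [e, e, h1, ← h2, h3] at *
    set w := v (D.col (D.blk k))
    calc _ = w * (gram D.z i j * (star w * w)) * gram D.z k l * star w := by noncomm_ring
      _ = w * (star w * w) * (gram D.z i j * gram D.z k l) * star w := by
        rw [← hc.eq]; noncomm_ring
      _ = 0 := by rw [this]; simp
  mul_eq := fun i j l h1 h2 => by
    have e : ∀ i j, gram (fun i l => v (D.col (D.blk i)) * D.z i l) i j =
      v (D.col (D.blk i)) * gram D.z i j * star (v (D.col (D.blk j))) := by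
      intro i j; simp [gram, Finset.mul_sum, Finset.sum_mul, mul_assoc]
    have hc := hcomm i j h1
    have := D.mul_eq i j l h1 h2
    rw [e, e, h1, ← h2] at *
    set w := v (D.col (D.blk j))
    calc _ = w * (gram D.z i j * (star w * w)) * gram D.z j l * star w := by noncomm_ring
      _ = w * (star w * w) * (gram D.z i j * gram D.z j l) * star w := by
        rw [← hc.eq]; noncomm_ring
      _ = _ := by rw [this]
  sum_le := fun c s hs => by
    let := CStarAlgebra.spectralOrder E
    have := CStarAlgebra.spectralOrderedRing E
    have e : ∀ i j, gram (fun i l => v (D.col (D.blk i)) * D.z i l) i j =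
      v (D.col (D.blk i)) * gram D.z i j * star (v (D.col (D.blk j))) := by
      intro i j; simp [gram, Finset.mul_sum, Finset.sum_mul, mul_assoc]
    have h := D.sum_le c s hs
    rw [isPos_iff, sub_nonneg] at h ⊢
    have e2 : ∑ i ∈ s, gram (fun i l => v (D.col (D.blk i)) * D.z i l) i i =
        v c * (∑ i ∈ s, gram D.z i i) * star (v c) := by
      rw [Finset.mul_sum, Finset.sum_mul]
      exact Finset.sum_congr rfl fun i hi => by rw [e, hs i hi]
    rw [e2]
    refine (conj_le h (v c)).trans ?_
    rw [mul_one]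
    refine (CStarAlgebra.mul_star_le_algebraMap_norm_sq).trans ?_
    rw [Algebra.algebraMap_eq_smul_one]
    have : ‖v c‖ ^ 2 ≤ 1 := pow_le_one₀ (norm_nonneg _) (hv c)
    calc _ ≤ (1 : ℝ) • (1 : E) := smul_le_smul_of_nonneg_right this zero_le_one
      _ = 1 := one_smul _ _

theorem Dat.gram_twist (D : Dat κ E I β L) (v : κ → E) (hv) (hcomm) (i j : I) :
    gram (D.twist v hv hcomm).z i j =
      v (D.col (D.blk i)) * gram D.z i j * star (v (D.col (D.blk j))) := by
  simp [Dat.twist, gram, Finset.mul_sum, Finset.sum_mul, mul_assoc]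

end cut


section cut2
variable {κ E I β L : Type} [CStarAlgebra E] [Fintype I] [DecidableEq I] [Fintype L]

theorem Dat.twist_est [Fintype κ] (D : Dat κ E I β L) (v : κ → E) (hv) (hcomm)
    {η μ M : ℝ} (hμ : 0 < μ) (hμη : 6 * η ≤ μ ^ 2)
    (hk : ∀ c, ‖(v c - 1) * ∑ i, gram (D.zc c) i i‖ ≤ 3 * η) (a : E) (ha : ‖a‖ ≤ M) :
    ‖(D.twist v hv hcomm).Φ a - D.Φ a‖ ≤ Fintype.card κ * (2 * (μ * M)) := by
  let := CStarAlgebra.spectralOrder E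
  have := CStarAlgebra.spectralOrderedRing E
  have h1 : (D.twist v hv hcomm).Φ a =
      ∑ c, v c * (∑ i, ∑ j, D.ψ a i j • gram (D.zc c) i j) * star (v c) := by
    rw [← D.split _ (fun i j => D.off a i j) v, Dat.Φ]
    simp only [D.gram_twist]; rfl
  rw [h1, Dat.Φ, D.split1 _ (fun i j => D.off a i j), ← Finset.sum_sub_distrib]
  refine (norm_sum_le _ _).trans ?_
  refine (Finset.sum_le_sum (g := fun _ => 2 * (μ * M)) fun c _ => ?_).trans (by simp)
  set U := ∑ i, ∑ j, D.ψ a i j • gram (D.zc c) i j with hU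
  set k := ∑ i, gram (D.zc c) i i with hkd
  have ht : ‖(v c - 1) * k * star (v c - 1)‖ ≤ μ ^ 2 := by
    have h2 : ‖star (v c - 1)‖ ≤ 2 := by
      rw [norm_star]
      calc _ ≤ ‖v c‖ + ‖(1 : E)‖ := norm_sub_le _ _
        _ ≤ 1 + 1 := add_le_add (hv c) (one_norm_le E)
        _ = 2 := by norm_num
    calc _ ≤ ‖(v c - 1) * k‖ * ‖star (v c - 1)‖ := norm_mul_le _ _
      _ ≤ 3 * η * 2 := mul_le_mul (hk c) h2 (norm_nonneg _) ((norm_nonneg _).trans (hk c))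
      _ ≤ _ := by linarith
  have hX := D.psi_norm a ha
  have g1 := col_left (D.zc c) (D.zc_le c) (D.ψ a) hX (v c - 1) hμ ht
  have g2 := col_left (c := M) (D.zc c) (D.zc_le c) (D.ψ a).conjTranspose
    (by rw [Matrix.l2_opNorm_conjTranspose]; exact hX) (v c - 1) hμ ht
  have e : ∑ i, ∑ j, (D.ψ a).conjTranspose i j • gram (D.zc c) i j = star U := by
    simp only [hU, star_sum, star_smul, star_gram, Matrix.conjTranspose_apply]
    rw [Finset.sum_comm]
  rw [e] at g2
  have e2 : v c * U * star (v c) - U = (v c - 1) * U + v c * star ((v c - 1) * star U) := by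
    simp only [star_mul, star_star, star_sub, star_one]; noncomm_ring
  rw [e2]
  calc _ ≤ ‖(v c - 1) * U‖ + ‖v c * star ((v c - 1) * star U)‖ := norm_add_le _ _
    _ ≤ μ * M + 1 * (μ * M) := by
      refine add_le_add g1 ((norm_mul_le _ _).trans ?_)
      rw [norm_star]
      exact mul_le_mul (hv c) g2 (norm_nonneg _) zero_le_one
    _ = _ := by ring

theorem Dat.est1 (D : Dat κ E I β L) (e a : E) (he : IsPosElem e) (he1 : IsPosElem (1 - e))
    (hea : e * a = a) {M ρ : ℝ} (hM : ‖a‖ ≤ M) (hρ : 0 ≤ ρ)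
    (hd : ∀ i j, i ≠ j → D.ψ e i j = 0) (q : I → ℝ) (hq : ∀ i, q i = 0 ∨
      (q i = 1 ∧ (D.ψ e i i).re ≤ ρ ^ 2)) :
    ‖Matrix.diagonal (fun i => (q i : ℂ)) * D.ψ a‖ ≤ M * ρ := by
  let := CStarAlgebra.spectralOrder E
  have := CStarAlgebra.spectralOrderedRing E
  have hM0 : 0 ≤ M := (norm_nonneg _).trans hM
  set Q := Matrix.diagonal (fun i => (q i : ℂ)) with hQ
  have hQs : Q.conjTranspose = Q := by
    rw [hQ, Matrix.diagonal_conjTranspose]; congr 1; ext i; simp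
  rw [isPos_iff] at he he1
  have hle : a * star a ≤ (M ^ 2) • e := by
    have h1 : a * star a ≤ algebraMap ℝ E (M ^ 2) :=
      CStarAlgebra.mul_star_le_algebraMap_norm_sq.trans
        (algebraMap_mono _ (by gcongr))
    have hes : star e = e := (IsSelfAdjoint.of_nonneg he).star_eq
    have h2 := conj_le h1 e
    rw [hes] at h2
    have h3 : e * (a * star a) * e = a * star a := by
      have : star a * e = star a := by
        have := congrArg star hea
        rwa [star_mul, hes] at this
      rw [mul_assoc, mul_assoc, this, ← mul_assoc, hea]
    rw [h3] at h2
    refine h2.trans ?_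
    have h4 : e * algebraMap ℝ E (M ^ 2) * e = (M ^ 2) • (e * e) := by
      rw [Algebra.algebraMap_eq_smul_one]; simp
    rw [h4]
    exact smul_le_smul_of_nonneg_left (sq_le_self he (sub_nonneg.1 he1)) (by positivity)
  have p1 := (D.schwarz a).conjTranspose_mul_mul_same Q
  have p2 := (D.psi_mono hle).conjTranspose_mul_mul_same Q
  have hpos : (D.ψ e).PosSemidef := by simpa using D.psi_mono he
  have hdiag : D.ψ e = Matrix.diagonal (fun i => D.ψ e i i) := by
    ext i j
    by_cases h : i = j
    · subst h; simp
    · rw [Matrix.diagonal_apply_ne _ h, hd i j h]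
  have him : ∀ i, D.ψ e i i = ((D.ψ e i i).re : ℂ) := by
    intro i
    have := hpos.1.coe_re_apply_self i
    exact this.symm
  have p3 : ((((M * ρ) ^ 2 : ℝ) : ℂ) • 1 - Q * (D.ψ ((M ^ 2) • e)) * Q).PosSemidef := by
    rw [← Complex.coe_smul (M ^ 2) e, map_smul, hdiag, hQ, ← Matrix.diagonal_smul,
      Matrix.diagonal_mul_diagonal, Matrix.diagonal_mul_diagonal, ← Matrix.diagonal_one,
      ← Matrix.diagonal_smul, Matrix.diagonal_sub]
    refine Matrix.PosSemidef.diagonal fun i => ?_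
    simp only [Pi.smul_apply, Pi.zero_apply, smul_eq_mul, mul_one]
    rw [him i]
    rcases hq i with h | ⟨h, h'⟩
    · rw [h]; simp only [Complex.ofReal_zero, mul_zero, sub_zero]
      exact Complex.zero_le_real.2 (by positivity)
    · rw [h]
      norm_cast
      have : M ^ 2 * (D.ψ e i i).re ≤ M ^ 2 * ρ ^ 2 := by gcongr
      linarith
  have := (p1.add p2).add p3
  refine norm_le_of_psd _ (by positivity) ?_
  convert this using 1
  rw [Matrix.conjTranspose_mul, hQs]
  noncomm_ring

theorem Dat.est1' [Fintype κ] (D : Dat κ E I β L) (e a : E) (he : IsPosElem e)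
    (he1 : IsPosElem (1 - e))
    (hea : e * a = a) (hae : a * e = a) {M ρ : ℝ} (hM : ‖a‖ ≤ M) (hρ : 0 ≤ ρ)
    (hd : ∀ i j, i ≠ j → D.ψ e i j = 0) (p : I → Prop) [DecidablePred p]
    (hp : ∀ i, ¬ p i → (D.ψ e i i).re ≤ ρ ^ 2) :
    ‖D.Φ a - ∑ i : {i // p i}, ∑ j : {i // p i}, D.ψ a i j • gram D.z i j‖
      ≤ Fintype.card κ * (2 * (M * ρ)) := by
  let q : I → ℝ := fun i => if p i then 0 else 1
  let q' : I → ℝ := fun i => if p i then 1 else 0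
  set Q := Matrix.diagonal (fun i => (q i : ℂ)) with hQ
  set Q' := Matrix.diagonal (fun i => (q' i : ℂ)) with hQ'
  have hq : ∀ i, q i = 0 ∨ (q i = 1 ∧ (D.ψ e i i).re ≤ ρ ^ 2) := by
    intro i
    by_cases h : p i
    · left; simp [q, h]
    · right; exact ⟨by simp [q, h], hp i h⟩
  let := CStarAlgebra.spectralOrder E
  have := CStarAlgebra.spectralOrderedRing E
  have hes : star e = e := (IsSelfAdjoint.of_nonneg (isPos_iff.1 he)).star_eq
  have hQs : Q.conjTranspose = Q := by
    rw [hQ, Matrix.diagonal_conjTranspose]; congr 1; ext i; simp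
  have n1 := D.est1 e a he he1 hea hM hρ hd q hq
  have n2 := D.est1 (M := M) e (star a) he he1
    (by have := congrArg star hae; rwa [star_mul, hes] at this) (by rwa [norm_star]) hρ hd q hq
  have n3 : ‖D.ψ a * Q‖ ≤ M * ρ := by
    rw [D.psi_star] at n2
    rw [← Matrix.l2_opNorm_conjTranspose, Matrix.conjTranspose_mul, hQs]; exact n2
  have n4 : ‖Q'‖ ≤ 1 := by
    rw [hQ', Matrix.l2_opNorm_diagonal]
    refine (pi_norm_le_iff_of_nonneg zero_le_one).2 fun i => ?_
    by_cases h : p i <;> simp [q', h]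
  have hsum : Q + Q' = 1 := by
    rw [hQ, hQ', Matrix.diagonal_add, ← Matrix.diagonal_one]; congr 1; ext i
    by_cases h : p i <;> simp [q, q', h]
  have hY : ‖D.ψ a - Q' * D.ψ a * Q'‖ ≤ 2 * (M * ρ) := by
    have : D.ψ a - Q' * D.ψ a * Q' = Q * D.ψ a + Q' * (D.ψ a * Q) := by
      calc _ = (Q + Q') * D.ψ a * (Q + Q') - Q' * D.ψ a * Q' := by rw [hsum]; simp
        _ = Q * D.ψ a * (Q + Q') + Q' * (D.ψ a * Q) := by noncomm_ring
        _ = _ := by rw [hsum, mul_one]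
    rw [this]
    calc _ ≤ ‖Q * D.ψ a‖ + ‖Q' * (D.ψ a * Q)‖ := norm_add_le _ _
      _ ≤ M * ρ + 1 * (M * ρ) := add_le_add n1 ((norm_mul_le _ _).trans
        (mul_le_mul n4 n3 (norm_nonneg _) zero_le_one))
      _ = _ := by ring
  have hentry : ∀ i j, (D.ψ a - Q' * D.ψ a * Q') i j =
      D.ψ a i j - if p i then (if p j then D.ψ a i j else 0) else 0 := by
    intro i j
    rw [Matrix.sub_apply, hQ', Matrix.mul_diagonal, Matrix.diagonal_mul]
    by_cases h : p i <;> by_cases h' : p j <;> simp [q', h, h']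
  have hs : D.Φ a - ∑ i : {i // p i}, ∑ j : {i // p i}, D.ψ a i j • gram D.z i j =
      ∑ i, ∑ j, (D.ψ a - Q' * D.ψ a * Q') i j • gram D.z i j := by
    simp only [hentry, sub_smul, Finset.sum_sub_distrib]
    rw [Dat.Φ]
    congr 1
    rw [Finset.sum_subtype (Finset.univ.filter p) (p := p) (by simp)
      (fun i => ∑ j : {i // p i}, D.ψ a i j • gram D.z i j) |>.symm, Finset.sum_filter]
    refine Finset.sum_congr rfl fun i _ => ?_
    split_ifs with h
    · rw [Finset.sum_subtype (Finset.univ.filter p) (p := p) (by simp)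
        (fun j => D.ψ a i j • gram D.z i j) |>.symm, Finset.sum_filter]
      refine Finset.sum_congr rfl fun j _ => ?_
      split_ifs <;> simp
    · simp
  rw [hs]
  refine D.total_norm _ (fun i j h => ?_) hY
  rw [hentry, D.off a i j h]; simp

end cut2


section cut3
variable {κ E : Type} [CStarAlgebra E]

/-- Hereditary-type condition on a subset. -/
def Her (E : Type) [CStarAlgebra E] (H : Set E) : Prop :=
  IsClosed H ∧ ∀ (S : Finset E) (ε : ℝ), (∀ a ∈ S, a ∈ H) → 0 < ε →
    ∃ e e' : E, IsPosElem e ∧ IsPosElem (1 - e) ∧ IsPosElem e' ∧ IsPosElem (1 - e') ∧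
      e' * e = e ∧ (∀ x, e' * x * e' ∈ H) ∧
      ∀ a ∈ S, ∃ a', ‖a - a'‖ < ε ∧ e * a' = a' ∧ a' * e = a'

theorem Dat.comm_k {I β L : Type} [Fintype I] [DecidableEq I] [Fintype L]
    (D : Dat κ E I β L) (i j : I) (h : D.blk i = D.blk j) :
    Commute (∑ k, gram (D.zc (D.col (D.blk i))) k k) (gram D.z i j) := by
  have h1 : (∑ k, gram (D.zc (D.col (D.blk i))) k k) * gram D.z i j = D.T i j := by
    rw [Finset.sum_mul, Finset.sum_eq_single i]
    · rw [D.gram_zc _ i i rfl rfl, D.mul_eq i i j rfl h]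
    · intro k _ hk
      by_cases hc : D.col (D.blk k) = D.col (D.blk i)
      · rw [D.gram_zc _ k k hc hc, D.mul_ne k k i j rfl h hc hk]
      · rw [D.gram_zc' _ k k hc, zero_mul]
    · simp
  have h2 : gram D.z i j * (∑ k, gram (D.zc (D.col (D.blk i))) k k) = D.T i j := by
    rw [Finset.mul_sum, Finset.sum_eq_single j]
    · rw [D.gram_zc _ j j (by rw [h]) (by rw [h]), D.mul_eq i j j h rfl]
    · intro k _ hk
      by_cases hc : D.col (D.blk k) = D.col (D.blk i)
      · rw [D.gram_zc _ k k hc hc, D.mul_ne i j k k h rfl (by rw [hc, h]) (Ne.symm hk)]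
      · rw [D.gram_zc' _ k k hc, mul_zero]
    · simp
  rw [Commute, SemiconjBy, h1, h2]

theorem HD.cut [Fintype κ] {H : Set E} (h : HD κ E Set.univ) (hH : Her E H) : HD κ E H := by
  classical
  intro S ε hS hε
  let := CStarAlgebra.spectralOrder E
  have := CStarAlgebra.spectralOrderedRing E
  set N : ℝ := (Fintype.card κ : ℝ) with hN
  have hN0 : 0 ≤ N := by positivity
  obtain ⟨e, e', he0, he1, he0', he1', hee, hmem, happ⟩ := hH.2 S (ε / (4 * (N + 1))) hS
    (by positivity)
  choose! f hf1 hf2 hf3 using happ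
  obtain ⟨M, hM⟩ : ∃ M : ℝ, ∀ a ∈ S, ‖f a‖ ≤ M := by
    refine ⟨∑ a ∈ S, ‖f a‖, fun a ha => Finset.single_le_sum (f := fun a => ‖f a‖)
      (fun _ _ => norm_nonneg _) ha⟩
  obtain ⟨ρ, hρ0, hρ1, hρ⟩ : ∃ ρ : ℝ, 0 < ρ ∧ ρ ≤ 1 ∧ N * (4 * (|M| * ρ)) ≤ ε / 4 := by
    refine ⟨min 1 (ε / 4 / (N * 4 * |M| + 1)), by positivity, min_le_left _ _, ?_⟩
    calc _ = (N * 4 * |M|) * min 1 (ε / 4 / (N * 4 * |M| + 1)) := by ring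
      _ ≤ (N * 4 * |M| + 1) * (ε / 4 / (N * 4 * |M| + 1)) := by
        gcongr
        · linarith
        · exact min_le_right _ _
      _ = ε / 4 := by field_simp
  set η1 := ρ ^ 2 / 6 with hη1
  set δ := min (ε / 8) (ρ ^ 2 * (η1 ^ 4 / 4)) with hδ
  have hδ0 : 0 < δ := by positivity
  obtain ⟨I, β, L, _, _, _, D0, -, hD0⟩ := h (insert e (S.image f)) δ (by simp) hδ0
  obtain ⟨I, β, _, _, D, hΦ, hdiag⟩ := D0.diag e he0
  let p : I → Prop := fun i => ρ ^ 2 ≤ (D.ψ e i i).re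
  let D2 : Dat κ E {i // p i} β L := D.pull Subtype.val Subtype.val_injective
    (fun i => D.blk i.1) D.col id Function.injective_id (fun _ _ => Iff.rfl) (fun _ => rfl)
  have hpsi : (D.ψ e).PosSemidef := by
    obtain ⟨y, rfl⟩ := he0; exact D.psi_pos' y
  have hre : ∀ i, D.ψ e i i = ((D.ψ e i i).re : ℂ) := fun i => (hpsi.1.coe_re_apply_self i).symm
  have hre0 : ∀ i, 0 ≤ (D.ψ e i i).re := by
    intro i
    have := hpsi.diag_nonneg (i := i)
    rw [hre i] at this
    exact Complex.zero_le_real.1 this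
  rw [isPos_iff] at he0' he1'
  have hes' : star e' = e' := (IsSelfAdjoint.of_nonneg he0').star_eq
  have hes : star e = e := (IsSelfAdjoint.of_nonneg (isPos_iff.1 he0)).star_eq
  have hee2 : e * e' = e := by
    have := congrArg star hee; rwa [star_mul, hes, hes'] at this
  have hgn : ∀ i, 0 ≤ gram D.z i i := fun i => Finset.sum_nonneg fun l _ => mul_star_self_nonneg _
  have hΦe : D.Φ e = ∑ i, (D.ψ e i i).re • gram D.z i i := by
    rw [Dat.Φ]
    refine Finset.sum_congr rfl fun i _ => ?_
    rw [Finset.sum_eq_single i]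
    · conv_lhs => rw [hre i]
      rw [Complex.coe_smul]
    · intro j _ hj; rw [hdiag i j (Ne.symm hj), zero_smul]
    · simp
  have hΦe2 : D.Φ e ≤ e + algebraMap ℝ E δ := by
    have h1 : ‖D.Φ e - e‖ ≤ δ := by
      rw [hΦ]; exact (hD0 e (Finset.mem_insert_self _ _)).le
    have hsa : IsSelfAdjoint (D.Φ e - e) := by
      refine IsSelfAdjoint.sub ?_ hes
      rw [hΦe]
      exact .of_nonneg (Finset.sum_nonneg fun i _ => smul_nonneg (hre0 i) (hgn i))
    have := hsa.le_algebraMap_norm_self.trans (algebraMap_mono E h1)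
    rwa [sub_le_iff_le_add'] at this
  have hk : ∀ c, (1 - e') * (∑ i, gram (D2.zc c) i i) * (1 - e') ≤
      algebraMap ℝ E (η1 ^ 4 / 4) := by
    intro c
    have h1 : ρ ^ 2 • (∑ i, gram (D2.zc c) i i) ≤ D.Φ e := by
      rw [hΦe, Finset.smul_sum]
      calc _ ≤ ∑ i : {i // p i}, (D.ψ e i i).re • gram D.z i i := by
            refine Finset.sum_le_sum fun i _ => ?_
            by_cases hc : D2.col (D2.blk i) = c
            · rw [D2.gram_zc c i i hc hc]
              exact smul_le_smul_of_nonneg_right i.2 (hgn _)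
            · rw [D2.gram_zc' c i i hc, smul_zero]
              exact smul_nonneg (hre0 _) (hgn _)
        _ = ∑ i ∈ Finset.univ.filter p, (D.ψ e i i).re • gram D.z i i :=
            (Finset.sum_subtype (Finset.univ.filter p) (p := p) (by simp)
              (fun i => (D.ψ e i i).re • gram D.z i i)).symm
        _ ≤ _ := Finset.sum_le_sum_of_subset_of_nonneg (Finset.filter_subset _ _)
            fun i _ _ => smul_nonneg (hre0 _) (hgn _)
    have h2 := conj_le (h1.trans hΦe2) (1 - e')
    have hs1 : star (1 - e') = 1 - e' := by rw [star_sub, star_one, hes']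
    rw [hs1] at h2
    have h3 : (1 - e') * (e + algebraMap ℝ E δ) * (1 - e') = δ • ((1 - e') * (1 - e')) := by
      have : (1 - e') * e = 0 := by rw [sub_mul, one_mul, hee, sub_self]
      rw [mul_add, this, zero_add, Algebra.algebraMap_eq_smul_one]; simp
    have h4 : (1 - e') * (1 - e') ≤ 1 := by
      refine (sq_le_self he1' ?_).trans ?_ <;> exact sub_le_self _ he0'
    rw [h3, mul_smul_comm, smul_mul_assoc] at h2
    have h5 := smul_le_smul_of_nonneg_left (h2.trans
      (smul_le_smul_of_nonneg_left h4 hδ0.le)) (by positivity : 0 ≤ (ρ ^ 2)⁻¹)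
    rw [smul_smul, inv_mul_cancel₀ (by positivity), one_smul, smul_smul] at h5
    refine h5.trans ?_
    rw [Algebra.algebraMap_eq_smul_one]
    refine smul_le_smul_of_nonneg_right ?_ zero_le_one
    rw [inv_mul_le_iff₀ (by positivity)]
    exact min_le_right _ _
  have hvv : ∀ c, ∃ v ∈ closure (Set.range (fun y => e' * y)), ‖v‖ ≤ 1 ∧
      ‖(v - 1) * (∑ i, gram (D2.zc c) i i)‖ ≤ 3 * η1 ∧
      ∀ w, Commute (∑ i, gram (D2.zc c) i i) w → Commute (star v * v) w := by
    intro c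
    refine rordam (Finset.sum_nonneg fun i _ => Finset.sum_nonneg fun l _ =>
      mul_star_self_nonneg _) (D2.zc_le c) he0' (sub_nonneg.1 he1') (by positivity) ?_
      (by positivity) le_rfl (hk c)
    rw [hη1]; nlinarith
  choose v hv1 hv2 hv3 hv4 using hvv
  have hcomm : ∀ i j, D2.blk i = D2.blk j → Commute
      (star (v (D2.col (D2.blk i))) * v (D2.col (D2.blk i))) (gram D2.z i j) :=
    fun i j hij => hv4 _ _ (D2.comm_k i j hij)
  refine ⟨_, _, _, inferInstance, inferInstance, inferInstance, D2.twist v hv2 hcomm, ?_, ?_⟩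
  · intro i j
    rw [D2.gram_twist]
    set g := gram D2.z i j
    have := map_mem_closure₂ (f := fun x y : E => x * g * star y) (u := H) (by fun_prop)
      (hv1 (D2.col (D2.blk i))) (hv1 (D2.col (D2.blk j))) (by
        rintro _ ⟨x, rfl⟩ _ ⟨y, rfl⟩
        have := hmem (x * g * star y)
        simpa [star_mul, hes', mul_assoc] using this)
    rwa [hH.1.closure_eq] at this
  · intro a ha
    have hMa : ‖f a‖ ≤ |M| := (hM a ha).trans (le_abs_self M)
    have t1 := D2.twist_est v hv2 hcomm hρ0 (by rw [hη1]; linarith) hv3 (f a) hMa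
    have t2 := D.est1' e (f a) he0 he1 (hf2 a ha) (hf3 a ha) hMa hρ0.le hdiag p
      (fun i hi => (not_le.1 hi).le)
    have t2' : ‖D.Φ (f a) - D2.Φ (f a)‖ ≤ N * (2 * (|M| * ρ)) := t2
    have t3 : ‖D.Φ (f a) - f a‖ ≤ ε / 8 := by
      rw [hΦ]
      exact (hD0 _ (Finset.mem_insert_of_mem (Finset.mem_image_of_mem f ha))).le.trans
        (min_le_left _ _)
    have t4 := (D2.twist v hv2 hcomm).Phi_norm (a - f a) (hf1 a ha).le
    rw [Dat.Phi_sub] at t4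
    set Φ3 := (D2.twist v hv2 hcomm).Φ
    have t5 := (hf1 a ha).le
    have t6 : N * (ε / (4 * (N + 1))) + ε / (4 * (N + 1)) = ε / 4 := by field_simp
    have e1 : Φ3 a - a = (Φ3 a - Φ3 (f a)) + (Φ3 (f a) - D2.Φ (f a)) - (D.Φ (f a) - D2.Φ (f a))
      + (D.Φ (f a) - f a) - (a - f a) := by abel
    rw [e1]
    calc _ ≤ ‖Φ3 a - Φ3 (f a)‖ + ‖Φ3 (f a) - D2.Φ (f a)‖ + ‖D.Φ (f a) - D2.Φ (f a)‖
          + ‖D.Φ (f a) - f a‖ + ‖a - f a‖ := by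
          refine (norm_sub_le _ _).trans (add_le_add_left ((norm_add_le _ _).trans
            (add_le_add_left ((norm_sub_le _ _).trans (add_le_add_left (norm_add_le _ _) _)) _)) _)
      _ ≤ N * (ε / (4 * (N + 1))) + N * (2 * (ρ * |M|)) + N * (2 * (|M| * ρ)) + ε / 8 +
          ε / (4 * (N + 1)) := by gcongr
      _ < ε := by nlinarith

end cut3


section sums
variable {κ κ₁ κ₂ E E' I β L I₁ β₁ L₁ I₂ β₂ L₂ : Type} [CStarAlgebra E] [CStarAlgebra E']
  [Fintype I] [DecidableEq I] [Fintype L] [Fintype I₁] [DecidableEq I₁] [Fintype L₁]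
  [Fintype I₂] [DecidableEq I₂] [Fintype L₂]

theorem gram_map (ι : E →⋆ₙₐ[ℂ] E') (z : I → L → E) (i j : I) :
    gram (fun i l => ι (z i l)) i j = ι (gram z i j) := by
  simp [gram, map_sum, map_mul, map_star]

/-- Transport of data along homomorphisms. -/
def Dat.map (D : Dat κ E I β L) (π : E' →⋆ₐ[ℂ] E) (c : E) (hc : IsPosElem (1 - star c * c))
    (ι : E →⋆ₙₐ[ℂ] E') : Dat κ E' I β L where
  blk := D.blk
  col := D.col
  ψ :=
    { toFun := fun x => D.ψ (star c * π x * c)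
      map_add' := fun x y => by rw [map_add, mul_add, add_mul, map_add]
      map_smul' := fun r x => by rw [map_smul, mul_smul_comm, smul_mul_assoc, map_smul]; rfl }
  z := fun i l => ι (D.z i l)
  T := fun i j => ι (D.T i j)
  cp := fun a => by
    refine (D.cp fun i => π (a i) * c).trans_eq ?_
    refine Finset.sum_congr rfl fun i _ => Finset.sum_congr rfl fun j _ => ?_
    simp only [LinearMap.coe_mk, AddHom.coe_mk]
    simp [star_mul, mul_assoc, map_mul, map_star]
  ctr := by
    obtain ⟨y, hy⟩ := hc
    have h1 := D.psi_pos' y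
    rw [← hy, map_sub] at h1
    have := D.ctr.add h1
    simpa using this
  off := fun x i j h => D.off _ i j h
  mul_ne := fun i j k l h1 h2 h3 h4 => by
    rw [gram_map, gram_map, ← map_mul, D.mul_ne i j k l h1 h2 h3 h4, map_zero]
  mul_eq := fun i j l h1 h2 => by
    rw [gram_map, gram_map, ← map_mul, D.mul_eq i j l h1 h2]
  sum_le := fun k s hs => by
    let := CStarAlgebra.spectralOrder E'
    have := CStarAlgebra.spectralOrderedRing E'
    obtain ⟨y, hy⟩ := D.sum_le k s hs
    have e1 : 1 - ∑ i ∈ s, gram (fun i l => ι (D.z i l)) i i =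
        star (1 - ι 1) * (1 - ι 1) + star (ι y) * ι y := by
      rw [← map_star, ← map_mul ι (star y) y, ← hy, map_sub, map_sum]
      simp only [gram_map, star_sub, star_one, ← map_star ι]
      have : ι 1 * ι 1 = ι 1 := by rw [← map_mul, one_mul]
      rw [sub_mul, mul_sub, mul_sub, this]; simp
    rw [e1, isPos_iff]
    exact add_nonneg (star_mul_self_nonneg _) (star_mul_self_nonneg _)

theorem Dat.map_Φ (D : Dat κ E I β L) (π : E' →⋆ₐ[ℂ] E) (c : E) (hc) (ι : E →⋆ₙₐ[ℂ] E') (x : E') :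
    (D.map π c hc ι).Φ x = ι (D.Φ (star c * π x * c)) := by
  simp only [Dat.Φ, map_sum, map_smul, ← gram_map]; rfl

/-- the family for sums -/
def zsum (z₁ : I₁ → L₁ → E) (z₂ : I₂ → L₂ → E) : I₁ ⊕ I₂ → L₁ ⊕ L₂ → E
  | .inl i, .inl l => z₁ i l
  | .inl _, .inr _ => 0
  | .inr _, .inl _ => 0
  | .inr i, .inr l => z₂ i l

theorem gram_zsum (z₁ : I₁ → L₁ → E) (z₂ : I₂ → L₂ → E) :
    (∀ i j, gram (zsum z₁ z₂) (.inl i) (.inl j) = gram z₁ i j) ∧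
    (∀ i j, gram (zsum z₁ z₂) (.inr i) (.inr j) = gram z₂ i j) ∧
    (∀ i j, gram (zsum z₁ z₂) (.inl i) (.inr j) = 0) ∧
    (∀ i j, gram (zsum z₁ z₂) (.inr i) (.inl j) = 0) := by
  refine ⟨?_, ?_, ?_, ?_⟩ <;> intro i j <;> simp [gram, zsum, Fintype.sum_sum_type]

/-- Direct sum of data. -/
def Dat.osum (D₁ : Dat κ₁ E I₁ β₁ L₁) (D₂ : Dat κ₂ E I₂ β₂ L₂) :
    Dat (κ₁ ⊕ κ₂) E (I₁ ⊕ I₂) (β₁ ⊕ β₂) (L₁ ⊕ L₂) where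
  blk := Sum.map D₁.blk D₂.blk
  col := Sum.map D₁.col D₂.col
  ψ :=
    { toFun := fun x => Matrix.fromBlocks (D₁.ψ x) 0 0 (D₂.ψ x)
      map_add' := fun x y => by rw [map_add, map_add, Matrix.fromBlocks_add]; simp
      map_smul' := fun r x => by
        rw [map_smul, map_smul, RingHom.id_apply, Matrix.fromBlocks_smul]; simp }
  z := zsum D₁.z D₂.z
  T := fun
    | .inl i, .inl j => D₁.T i j
    | .inr i, .inr j => D₂.T i j
    | _, _ => 0
  cp := fun a => by
    have := add_nonneg (D₁.cp fun i => a (.inl i)) (D₂.cp fun i => a (.inr i))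
    simpa [Fintype.sum_sum_type] using this
  ctr := by
    have : (1 : Matrix (I₁ ⊕ I₂) (I₁ ⊕ I₂) ℂ) - Matrix.fromBlocks (D₁.ψ 1) 0 0 (D₂.ψ 1) =
        Matrix.fromBlocks (1 - D₁.ψ 1) 0 0 (1 - D₂.ψ 1) := by
      rw [← Matrix.fromBlocks_one, sub_eq_add_neg, Matrix.fromBlocks_neg, Matrix.fromBlocks_add]
      simp [sub_eq_add_neg]
    change (1 - Matrix.fromBlocks (D₁.ψ 1) 0 0 (D₂.ψ 1)).PosSemidef
    rw [this]
    refine psd_of_form ?_ fun x => ?_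
    · rw [Matrix.isHermitian_fromBlocks_iff]
      exact ⟨D₁.ctr.1, by simp, by simp, D₂.ctr.1⟩
    · have := add_nonneg (psd_form D₁.ctr fun i => x (.inl i))
        (psd_form D₂.ctr fun i => x (.inr i))
      simpa [Fintype.sum_sum_type] using this
  off := fun x i j h => by
    rcases i with i | i <;> rcases j with j | j
    · exact D₁.off x i j fun h' => h (by simp [h'])
    · rfl
    · rfl
    · exact D₂.off x i j fun h' => h (by simp [h'])
  mul_ne := fun i j k l h1 h2 h3 h4 => by
    obtain ⟨g1, g2, -, -⟩ := gram_zsum D₁.z D₂.z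
    rcases i with i | i <;> rcases j with j | j <;> rcases k with k | k <;>
      rcases l with l | l <;> simp only [Sum.map_inl, Sum.map_inr, Sum.inl.injEq, Sum.inr.injEq,
        reduceCtorEq, ne_eq] at h1 h2 h3 h4
    · rw [g1, g1]; exact D₁.mul_ne i j k l h1 h2 h3 h4
    · rw [g2, g2]; exact D₂.mul_ne i j k l h1 h2 h3 h4
  mul_eq := fun i j l h1 h2 => by
    obtain ⟨g1, g2, -, -⟩ := gram_zsum D₁.z D₂.z
    rcases i with i | i <;> rcases j with j | j <;>
      rcases l with l | l <;> simp only [Sum.map_inl, Sum.map_inr, Sum.inl.injEq, Sum.inr.injEq,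
        reduceCtorEq] at h1 h2
    · rw [g1, g1]; exact D₁.mul_eq i j l h1 h2
    · rw [g2, g2]; exact D₂.mul_eq i j l h1 h2
  sum_le := fun c s hs => by
    obtain ⟨g1, g2, -, -⟩ := gram_zsum D₁.z D₂.z
    rcases c with c | c
    · have h0 : s = s.toLeft.map ⟨Sum.inl, Sum.inl_injective⟩ := by
        ext i; rcases i with i | i
        · simp
        · simp only [Finset.mem_map, Finset.mem_toLeft, Function.Embedding.coeFn_mk, reduceCtorEq,
            and_false, exists_false, iff_false]
          intro hi; simpa using hs _ hi
      rw [h0, Finset.sum_map]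
      simp only [Function.Embedding.coeFn_mk, g1]
      exact D₁.sum_le c _ fun i hi => by simpa using hs _ (Finset.mem_toLeft.1 hi)
    · have h0 : s = s.toRight.map ⟨Sum.inr, Sum.inr_injective⟩ := by
        ext i; rcases i with i | i
        · simp only [Finset.mem_map, Finset.mem_toRight, Function.Embedding.coeFn_mk, reduceCtorEq,
            and_false, exists_false, iff_false]
          intro hi; simpa using hs _ hi
        · simp
      rw [h0, Finset.sum_map]
      simp only [Function.Embedding.coeFn_mk, g2]
      exact D₂.sum_le c _ fun i hi => by simpa using hs _ (Finset.mem_toRight.1 hi)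

theorem Dat.osum_Φ (D₁ : Dat κ₁ E I₁ β₁ L₁) (D₂ : Dat κ₂ E I₂ β₂ L₂) (x : E) :
    (D₁.osum D₂).Φ x = D₁.Φ x + D₂.Φ x := by
  obtain ⟨g1, g2, g3, g4⟩ := gram_zsum D₁.z D₂.z
  change ∑ i, ∑ j, Matrix.fromBlocks (D₁.ψ x) 0 0 (D₂.ψ x) i j • gram (zsum D₁.z D₂.z) i j = _
  simp [Fintype.sum_sum_type, g1, g2, g3, g4, Dat.Φ]

end sums

section sums2
variable {κ κ₁ κ₂ E E₁ E₂ : Type} [CStarAlgebra E] [CStarAlgebra E₁] [CStarAlgebra E₂]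

theorem one_pos' : IsPosElem (1 - star (1 : E) * 1) := ⟨0, by simp⟩

theorem HD.sum (h₁ : HD κ₁ E₁ Set.univ) (h₂ : HD κ₂ E₂ Set.univ) :
    HD (κ₁ ⊕ κ₂) (E₁ × E₂) Set.univ := by
  classical
  intro S ε _ hε
  obtain ⟨I₁, β₁, L₁, _, _, _, D₁, -, hD₁⟩ := h₁ (S.image Prod.fst) ε (by simp) hε
  obtain ⟨I₂, β₂, L₂, _, _, _, D₂, -, hD₂⟩ := h₂ (S.image Prod.snd) ε (by simp) hε
  let ι₁ : E₁ →⋆ₙₐ[ℂ] E₁ × E₂ := NonUnitalStarAlgHom.inl ℂ E₁ E₂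
  let ι₂ : E₂ →⋆ₙₐ[ℂ] E₁ × E₂ := NonUnitalStarAlgHom.inr ℂ E₁ E₂
  refine ⟨_, _, _, inferInstance, inferInstance, inferInstance,
    (D₁.map (StarAlgHom.fst ℂ E₁ E₂) 1 one_pos' ι₁).osum
      (D₂.map (StarAlgHom.snd ℂ E₁ E₂) 1 one_pos' ι₂), by simp, ?_⟩
  intro a ha
  rw [Dat.osum_Φ, Dat.map_Φ, Dat.map_Φ]
  have e : ι₁ (D₁.Φ (star 1 * StarAlgHom.fst ℂ E₁ E₂ a * 1)) +
      ι₂ (D₂.Φ (star 1 * StarAlgHom.snd ℂ E₁ E₂ a * 1)) - a = (D₁.Φ a.1 - a.1, D₂.Φ a.2 - a.2) := by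
    simp [ι₁, ι₂]
    ext <;> simp
  rw [e, Prod.norm_mk]
  exact max_lt (hD₁ _ (Finset.mem_image_of_mem _ ha)) (hD₂ _ (Finset.mem_image_of_mem _ ha))

/-- One-dimensional data for the unitization. -/
def Dat.unitPt (w : E) (hw : IsPosElem (1 - w * star w)) : Dat Unit (E × ℂ) Unit Unit Unit where
  blk := id
  col := id
  ψ :=
    { toFun := fun x => Matrix.of fun _ _ => x.2
      map_add' := fun x y => rfl
      map_smul' := fun r x => rfl }
  z := fun _ _ => (w, 1)
  T := fun _ _ => (w, 1) * star (w, 1) * ((w, 1) * star (w, 1))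
  cp := fun a => by
    simp only [Finset.univ_unique, Finset.sum_singleton]
    exact star_mul_self_nonneg (a default).2
  ctr := by
    have : (1 : Matrix Unit Unit ℂ) - Matrix.of (fun _ _ => (1 : ℂ)) = 0 := by ext; simp
    change ((1 : Matrix Unit Unit ℂ) - Matrix.of (fun _ _ => (1 : ℂ))).PosSemidef
    rw [this]; exact Matrix.PosSemidef.zero
  off := fun x i j h => (h rfl).elim
  mul_ne := fun i j k l _ _ _ h => (h rfl).elim
  mul_eq := fun i j l _ _ => by simp [gram]
  sum_le := fun c s hs => by
    by_cases h : () ∈ s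
    · have : s = {()} := by ext; simp [h]
      obtain ⟨y, hy⟩ := hw
      refine ⟨(y, 0), ?_⟩
      rw [this]
      ext <;> simp [gram, hy]
    · have : s = ∅ := by ext; simpa using h
      exact ⟨1, by simp [this]⟩

theorem HD.unit {H : Set E} (h : HD κ E H) (hH : Her E H) :
    HD (κ ⊕ Unit) (E × ℂ) {x | x.1 - x.2 • 1 ∈ H} := by
  classical
  intro S ε hS hε
  let := CStarAlgebra.spectralOrder E
  have := CStarAlgebra.spectralOrderedRing E
  obtain ⟨B, hB0, hB⟩ : ∃ B : ℝ, 0 ≤ B ∧ ∀ x ∈ S, ‖x.2‖ ≤ B := by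
    refine ⟨∑ x ∈ S, ‖x.2‖, by positivity, fun a ha => Finset.single_le_sum
      (f := fun x : E × ℂ => ‖x.2‖) (fun _ _ => norm_nonneg _) ha⟩
  let q : E × ℂ → E := fun x => x.1 - x.2 • 1
  obtain ⟨e, e', he0, he1, he0', -, hee, hmem, happ⟩ := hH.2 (S.image q) (ε / 8) (by
    intro a ha
    obtain ⟨x, hx, rfl⟩ := Finset.mem_image.1 ha
    exact hS x hx) (by positivity)
  rw [isPos_iff] at he0 he1 he0'
  have hes : star e = e := (IsSelfAdjoint.of_nonneg he0).star_eq
  have he1' : e ≤ 1 := sub_nonneg.1 he1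
  have hne : ‖e‖ ≤ 1 := (CStarAlgebra.norm_le_one_iff_of_nonneg e he0).2 he1'
  have hes' : star e' = e' := (IsSelfAdjoint.of_nonneg he0').star_eq
  have hee2 : e * e' = e := by
    have := congrArg star hee; rwa [star_mul, hes, hes'] at this
  have hm : ∀ x, e * x * e ∈ H := by
    intro x
    have := hmem (e * x * e)
    have e1 : e' * (e * x * e) * e' = (e' * e) * x * (e * e') := by noncomm_ring
    rwa [e1, hee, hee2] at this
  obtain ⟨y, hy⟩ : IsPosElem (1 - e * e) := by
    rw [isPos_iff, sub_nonneg]; exact (sq_le_self he0 he1').trans he1'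
  have hw : IsPosElem (1 - star y * star (star y)) := by
    rw [star_star, ← hy]; exact ⟨e, by rw [hes]; simp⟩
  have hc : IsPosElem (1 - star e * e) := by rw [hes]; exact ⟨y, hy⟩
  obtain ⟨I, β, L, _, _, _, D, hDH, hD⟩ := h (insert (e * e) (S.image fun x => e * q x * e))
    (ε / (2 * (B + 1))) (by
      intro a ha
      rcases Finset.mem_insert.1 ha with rfl | ha
      · simpa using hm 1
      · obtain ⟨x, hx, rfl⟩ := Finset.mem_image.1 ha
        exact hm _) (by positivity)
  let ι : E →⋆ₙₐ[ℂ] E × ℂ := NonUnitalStarAlgHom.inl ℂ E ℂ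
  refine ⟨_, _, _, inferInstance, inferInstance, inferInstance,
    (D.map (StarAlgHom.fst ℂ E ℂ) e hc ι).osum (Dat.unitPt (star y) hw), ?_, ?_⟩
  · have hz : (0 : E) ∈ H := by simpa using hm 0
    obtain ⟨g1, g2, g3, g4⟩ := gram_zsum (D.map (StarAlgHom.fst ℂ E ℂ) e hc ι).z
      (Dat.unitPt (star y) hw).z
    have g0 : ∀ i j, gram (D.map (StarAlgHom.fst ℂ E ℂ) e hc ι).z i j = ι (gram D.z i j) :=
      fun i j => gram_map ι D.z i j
    rintro (i | i) (j | j)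
    · change gram (zsum _ _) _ _ ∈ _
      rw [g1, g0]
      simpa [ι] using hDH i j
    · change gram (zsum _ _) _ _ ∈ _
      rw [g3]; simpa using hz
    · change gram (zsum _ _) _ _ ∈ _
      rw [g4]; simpa using hz
    · change gram (zsum _ _) _ _ ∈ _
      rw [g2]
      have : gram (Dat.unitPt (star y) hw).z i j = (1 - e * e, 1) := by
        simp only [gram, Dat.unitPt, hy, Finset.univ_unique, Finset.sum_singleton]
        ext <;> simp
      rw [this]
      simpa using hm (-1)
  · intro x hx
    rw [Dat.osum_Φ, Dat.map_Φ]
    have e0 : (Dat.unitPt (star y) hw).Φ x = (x.2 • (1 - e * e), x.2) := by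
      simp only [Dat.Φ, gram, Dat.unitPt, hy, Finset.univ_unique, Finset.sum_singleton]
      change x.2 • ((star y, (1 : ℂ)) * star (star y, (1 : ℂ))) = _
      ext <;> simp
    have e1 : D.Φ (star e * StarAlgHom.fst ℂ E ℂ x * e) = D.Φ (e * q x * e) + x.2 • D.Φ (e * e) := by
      have : star e * StarAlgHom.fst ℂ E ℂ x * e = e * q x * e + x.2 • (e * e) := by
        simp [q, hes, mul_sub, sub_mul]
      rw [this]
      simp only [Dat.Φ, map_add, map_smul, Matrix.add_apply, Matrix.smul_apply, add_smul,
        Finset.sum_add_distrib, Finset.smul_sum, smul_assoc]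
    have e2 : ι (D.Φ (star e * StarAlgHom.fst ℂ E ℂ x * e)) + (Dat.unitPt (star y) hw).Φ x - x =
        ((D.Φ (e * q x * e) - e * q x * e) + x.2 • (D.Φ (e * e) - e * e) + (e * q x * e - q x),
          0) := by
      rw [e0, e1]
      ext
      · simp [ι, q, smul_sub]; abel
      · simp [ι]
    rw [e2, Prod.norm_mk, norm_zero, max_eq_left (norm_nonneg _)]
    have n1 := (hD _ (Finset.mem_insert_self _ _)).le
    have n2 := (hD _ (Finset.mem_insert_of_mem (Finset.mem_image_of_mem
      (fun x => e * q x * e) hx))).le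
    obtain ⟨a', ha1, ha2, ha3⟩ := happ _ (Finset.mem_image_of_mem q hx)
    have n3 : ‖e * q x * e - q x‖ ≤ ε / 8 + ε / 8 := by
      have : e * q x * e - q x = e * (q x - a') * e - (q x - a') := by
        generalize q x = b
        rw [mul_sub, sub_mul, ha2, ha3]; abel
      rw [this]
      refine (norm_sub_le _ _).trans (add_le_add ?_ ha1.le)
      calc _ ≤ ‖e‖ * ‖q x - a'‖ * ‖e‖ := (norm_mul_le _ _).trans
            (mul_le_mul_of_nonneg_right (norm_mul_le _ _) (norm_nonneg _))
        _ ≤ 1 * (ε / 8) * 1 := by gcongr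
        _ = _ := by ring
    calc _ ≤ ‖D.Φ (e * q x * e) - e * q x * e‖ + ‖x.2 • (D.Φ (e * e) - e * e)‖ +
          ‖e * q x * e - q x‖ := norm_add₃_le
      _ ≤ ε / (2 * (B + 1)) + B * (ε / (2 * (B + 1))) + (ε / 8 + ε / 8) := by
        rw [norm_smul]
        gcongr
        exact hB x hx
      _ = 3 / 4 * ε := by field_simp; ring
      _ < ε := by linarith

end sums2


section mat5
variable {κ E E' I β L n : Type} [CStarAlgebra E] [CStarAlgebra E']
  [Fintype I] [DecidableEq I] [Fintype L] [Fintype n] [DecidableEq n]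

/-- matrix units embedding -/
def mj (Ψ : E' ≃⋆ₐ[ℂ] Matrix n n E) (a b : n) : E →ₗ[ℂ] E' where
  toFun := fun y => Ψ.symm (Matrix.single a b y)
  map_add' := fun x y => by rw [Matrix.single_add, map_add]
  map_smul' := fun r x => by rw [RingHom.id_apply, ← map_smul, Matrix.smul_single]

theorem mj_mul (Ψ : E' ≃⋆ₐ[ℂ] Matrix n n E) (a b c : n) (x y : E) :
    mj Ψ a b x * mj Ψ b c y = mj Ψ a c (x * y) := by
  change Ψ.symm _ * Ψ.symm _ = Ψ.symm _
  rw [← map_mul, Matrix.single_mul_single_same]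

theorem mj_mul_ne (Ψ : E' ≃⋆ₐ[ℂ] Matrix n n E) (a b b' c : n) (h : b ≠ b') (x y : E) :
    mj Ψ a b x * mj Ψ b' c y = 0 := by
  change Ψ.symm _ * Ψ.symm _ = _
  rw [← map_mul, Matrix.single_mul_single_of_ne _ _ _ _ h, map_zero]

theorem mj_star (Ψ : E' ≃⋆ₐ[ℂ] Matrix n n E) (a b : n) (x : E) :
    star (mj Ψ a b x) = mj Ψ b a (star x) := by
  change star (Ψ.symm _) = Ψ.symm _
  rw [← map_star, Matrix.star_eq_conjTranspose, Matrix.conjTranspose_single]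

theorem mj_norm (Ψ : E' ≃⋆ₐ[ℂ] Matrix n n E) (a b : n) (x : E) : ‖mj Ψ a b x‖ ≤ ‖x‖ := by
  let ι : E →⋆ₙₐ[ℂ] E' :=
    { toFun := mj Ψ b b
      map_smul' := fun r x => by simp
      map_zero' := map_zero _
      map_add' := map_add _
      map_mul' := fun x y => (mj_mul Ψ b b b x y).symm
      map_star' := fun x => (mj_star Ψ b b x).symm }
  have h : ‖mj Ψ a b x‖ * ‖mj Ψ a b x‖ ≤ ‖x‖ * ‖x‖ := by
    rw [← CStarRing.norm_star_mul_self, ← CStarRing.norm_star_mul_self, mj_star, mj_mul]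
    exact NonUnitalStarAlgHom.norm_apply_le ι (star x * x)
  exact abs_le_of_sq_le_sq' (by nlinarith) (norm_nonneg _) |>.2

theorem mj_sum (Ψ : E' ≃⋆ₐ[ℂ] Matrix n n E) (X : E') : X = ∑ a, ∑ b, mj Ψ a b (Ψ X a b) := by
  apply (show Function.Injective (fun x => Ψ x) from Ψ.injective)
  dsimp only
  simp only [map_sum]
  conv_lhs => rw [Matrix.matrix_eq_sum_single (Ψ X)]
  simp [mj]

theorem mj_gram (Ψ : E' ≃⋆ₐ[ℂ] Matrix n n E) (o : n) (z : I → L → E) (p q : I × n) :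
    gram (fun (p : I × n) l => mj Ψ p.2 o (z p.1 l)) p q = mj Ψ p.2 q.2 (gram z p.1 q.1) := by
  simp only [gram, map_sum, mj_star, mj_mul]

open scoped Kronecker in
/-- Matrix amplification of data. -/
def Dat.mat (D : Dat κ E I β L) (Ψ : E' ≃⋆ₐ[ℂ] Matrix n n E) (o : n) :
    Dat κ E' (I × n) β L where
  blk := fun p => D.blk p.1
  col := D.col
  ψ :=
    { toFun := fun X => Matrix.of fun p q => D.ψ (Ψ X p.2 q.2) p.1 q.1
      map_add' := fun x y => by ext p q; simp
      map_smul' := fun r x => by ext p q; simp }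
  z := fun p l => mj Ψ p.2 o (D.z p.1 l)
  T := fun p q => mj Ψ p.2 q.2 (D.T p.1 q.1)
  cp := fun a => by
    have h := Finset.sum_nonneg fun k (_ : k ∈ (Finset.univ : Finset n)) =>
      D.cp fun i => ∑ b, Ψ (a (i, b)) k b
    refine h.trans_eq ?_
    have e : ∀ p q : I × n, (Matrix.of fun p' q' : I × n =>
        D.ψ (Ψ (star (a p) * a q) p'.2 q'.2) p'.1 q'.1) p q =
        ∑ k, D.ψ (star (Ψ (a p) k p.2) * Ψ (a q) k q.2) p.1 q.1 := by
      intro p q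
      rw [Matrix.of_apply, map_mul, map_star, Matrix.mul_apply, map_sum, Matrix.sum_apply]
      rfl
    simp only [LinearMap.coe_mk, AddHom.coe_mk]
    simp only [e]
    simp only [star_sum, Finset.sum_mul_sum, map_sum, Matrix.sum_apply, Fintype.sum_prod_type]
    calc _ = ∑ i, ∑ k, ∑ j, ∑ b, ∑ b', D.ψ (star (Ψ (a (i, b)) k b) * Ψ (a (j, b')) k b') i j :=
          Finset.sum_comm
      _ = ∑ i, ∑ k, ∑ b, ∑ j, ∑ b', D.ψ (star (Ψ (a (i, b)) k b) * Ψ (a (j, b')) k b') i j :=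
          Finset.sum_congr rfl fun _ _ => Finset.sum_congr rfl fun _ _ => Finset.sum_comm
      _ = ∑ i, ∑ b, ∑ k, ∑ j, ∑ b', D.ψ (star (Ψ (a (i, b)) k b) * Ψ (a (j, b')) k b') i j :=
          Finset.sum_congr rfl fun _ _ => Finset.sum_comm
      _ = ∑ i, ∑ b, ∑ j, ∑ k, ∑ b', D.ψ (star (Ψ (a (i, b)) k b) * Ψ (a (j, b')) k b') i j :=
          Finset.sum_congr rfl fun _ _ => Finset.sum_congr rfl fun _ _ => Finset.sum_comm
      _ = _ :=
          Finset.sum_congr rfl fun _ _ => Finset.sum_congr rfl fun _ _ =>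
            Finset.sum_congr rfl fun _ _ => Finset.sum_comm
  ctr := by
    have := D.ctr.kronecker (Matrix.PosSemidef.one (n := n) (R := ℂ))
    refine cast (congrArg Matrix.PosSemidef ?_) this
    symm
    refine Matrix.ext ?_
    rintro ⟨i, a⟩ ⟨j, b⟩
    change (1 : Matrix (I × n) (I × n) ℂ) (i, a) (j, b) - D.ψ (Ψ 1 a b) i j = _
    rw [map_one, Matrix.kroneckerMap_apply]
    by_cases h : a = b
    · subst h; simp [Matrix.one_apply]
    · rw [Matrix.one_apply_ne h, Matrix.one_apply_ne h, Matrix.one_apply_ne (by simp [h])]; simp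
  off := fun x p q h => D.off _ p.1 q.1 h
  mul_ne := fun i j k l h1 h2 h3 h4 => by
    rw [mj_gram, mj_gram]
    by_cases h : j.2 = k.2
    · rw [h, mj_mul, D.mul_ne i.1 j.1 k.1 l.1 h1 h2 h3 (fun h' => h4 (Prod.ext h' h)), map_zero]
    · exact mj_mul_ne _ _ _ _ _ h _ _
  mul_eq := fun i j l h1 h2 => by
    rw [mj_gram, mj_gram, mj_mul, D.mul_eq i.1 j.1 l.1 h1 h2]
  sum_le := fun c s hs => by
    have h : ∀ b, ∃ y, 1 - ∑ i ∈ Finset.univ.filter (fun i => (i, b) ∈ s), gram D.z i i =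
        star y * y := fun b => D.sum_le c _ fun i hi => hs (i, b) (Finset.mem_filter.1 hi).2
    choose y hy using h
    refine ⟨Ψ.symm (Matrix.diagonal y), ?_⟩
    apply (show Function.Injective (fun x => Ψ x) from Ψ.injective)
    dsimp only
    rw [map_mul, map_star]
    simp only [mj_gram, map_sub, map_one, map_sum, StarAlgEquiv.apply_symm_apply]
    rw [Matrix.star_eq_conjTranspose, Matrix.diagonal_conjTranspose, Matrix.diagonal_mul_diagonal]
    change _ = Matrix.diagonal (fun b => star (y b) * y b)
    simp only [← hy]
    rw [← Matrix.diagonal_one, ← Matrix.diagonal_sub]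
    congr 1
    have e : ∀ p : I × n, Ψ (mj Ψ p.2 p.2 (gram D.z p.1 p.1)) =
        Matrix.single p.2 p.2 (gram D.z p.1 p.1) := fun p => Ψ.apply_symm_apply _
    simp only [e]
    ext a b
    rw [Matrix.sum_apply, Matrix.diagonal_apply]
    split_ifs with hab
    · subst hab
      have : ∀ p : I × n, Matrix.single p.2 p.2 (gram D.z p.1 p.1) a a =
        if p.2 = a then gram D.z p.1 p.1 else 0 := by intro p; simp [Matrix.single_apply]
      simp only [this]
      rw [← Finset.sum_filter]
      refine Finset.sum_nbij' (fun p => p.1) (fun i => (i, a)) ?_ ?_ ?_ ?_ ?_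
      · rintro ⟨i, b⟩ h; simp at h ⊢; rw [← h.2]; exact h.1
      · intro i h; simpa using h
      · rintro ⟨i, b⟩ h; simp at h; simp [h.2]
      · intro i h; rfl
      · intro p h; rfl
    · refine Finset.sum_eq_zero fun p _ => ?_
      rw [Matrix.single_apply, if_neg]
      rintro ⟨rfl, h⟩; exact hab h

theorem Dat.mat_Φ (D : Dat κ E I β L) (Ψ : E' ≃⋆ₐ[ℂ] Matrix n n E) (o : n) (X : E') :
    (D.mat Ψ o).Φ X = ∑ a, ∑ b, mj Ψ a b (D.Φ (Ψ X a b)) := by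
  change ∑ p : I × n, ∑ q : I × n, D.ψ (Ψ X p.2 q.2) p.1 q.1 •
    gram (fun (p : I × n) l => mj Ψ p.2 o (D.z p.1 l)) p q = _
  simp only [mj_gram, Fintype.sum_prod_type, Dat.Φ, map_sum, map_smul]
  generalize hf : (fun i a j b => D.ψ (Ψ X a b) i j • mj Ψ a b (gram D.z i j)) = f
  have e1 : ∀ i a j b, D.ψ (Ψ X a b) i j • mj Ψ a b (gram D.z i j) = f i a j b := by
    intros; rw [← hf]
  simp only [e1]
  calc _ = ∑ a, ∑ i, ∑ j, ∑ b, f i a j b := Finset.sum_comm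
    _ = ∑ a, ∑ i, ∑ b, ∑ j, f i a j b :=
      Finset.sum_congr rfl fun _ _ => Finset.sum_congr rfl fun _ _ => Finset.sum_comm
    _ = _ := Finset.sum_congr rfl fun _ _ => Finset.sum_comm

theorem HD.matrix (h : HD κ E Set.univ) (Ψ : E' ≃⋆ₐ[ℂ] Matrix n n E) (o : n) :
    HD κ E' Set.univ := by
  classical
  intro S ε _ hε
  set N : ℝ := (Fintype.card n : ℝ) with hN
  obtain ⟨I, β, L, _, _, _, D, -, hD⟩ := h
    (S.biUnion fun X => Finset.univ.image fun p : n × n => Ψ X p.1 p.2) (ε / (N * N + 1))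
    (by simp) (by positivity)
  refine ⟨_, _, _, inferInstance, inferInstance, inferInstance, D.mat Ψ o, by simp, ?_⟩
  intro X hX
  rw [D.mat_Φ]
  conv_lhs => enter [1, 2]; rw [mj_sum Ψ X]
  simp only [← Finset.sum_sub_distrib, ← map_sub]
  calc _ ≤ ∑ a, ∑ b, ‖mj Ψ a b (D.Φ (Ψ X a b) - Ψ X a b)‖ :=
        (norm_sum_le _ _).trans (Finset.sum_le_sum fun _ _ => norm_sum_le _ _)
    _ ≤ ∑ a : n, ∑ b : n, ε / (N * N + 1) := by
        refine Finset.sum_le_sum fun a _ => Finset.sum_le_sum fun b _ => (mj_norm _ _ _ _).trans ?_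
        refine (hD _ (Finset.mem_biUnion.2 ⟨X, hX, ?_⟩)).le
        exact Finset.mem_image.2 ⟨(a, b), Finset.mem_univ _, rfl⟩
    _ = N * N * (ε / (N * N + 1)) := by simp [← hN, mul_assoc]
    _ < (N * N + 1) * (ε / (N * N + 1)) := by
        have : 0 < ε / (N * N + 1) := by positivity
        nlinarith
    _ = ε := by field_simp

end mat5

section l7

theorem sep_of_inj {D E : Type} [CStarAlgebra D] [CStarAlgebra E] (ι : D →⋆ₙₐ[ℂ] E)
    (hι : Function.Injective ι) (h : TopologicalSpace.SeparableSpace E) :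
    TopologicalSpace.SeparableSpace D := by
  have hi : Isometry ι := AddMonoidHomClass.isometry_of_norm ι fun x =>
    NonUnitalStarAlgHom.norm_map ι hι x
  have : SecondCountableTopology E := UniformSpace.secondCountable_of_separable E
  have : SecondCountableTopology D := hi.isEmbedding.isInducing.secondCountableTopology
  infer_instance

theorem sep_mat {E E' n : Type} [CStarAlgebra E] [CStarAlgebra E'] [Fintype n] [DecidableEq n]
    (Ψ : E' ≃⋆ₐ[ℂ] Matrix n n E) (h : TopologicalSpace.SeparableSpace E) :
    TopologicalSpace.SeparableSpace E' := by
  let f : (n → n → E) → E' := fun X => ∑ a, ∑ b, mj Ψ a b (X a b)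
  have hm : ∀ a b, Continuous (mj Ψ a b) := fun a b =>
    AddMonoidHomClass.continuous_of_bound (mj Ψ a b) 1 fun x => by
      rw [one_mul]; exact mj_norm Ψ a b x
  have hf : Continuous f := by
    refine continuous_finsetSum _ fun a _ => continuous_finsetSum _ fun b _ => ?_
    exact (hm a b).comp ((continuous_apply b).comp (continuous_apply a))
  have hs : Function.Surjective f := fun X => ⟨fun a b => Ψ X a b, (mj_sum Ψ X).symm⟩
  exact hs.denseRange.separableSpace hf

theorem her_corner {E : Type} [CStarAlgebra E] (p : E) (hp : p * p = p) (hs : star p = p) :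
    Her E {x | p * x * p = x} := by
  refine ⟨isClosed_eq (by fun_prop) (by fun_prop), fun S ε hS hε => ?_⟩
  let := CStarAlgebra.spectralOrder E
  have := CStarAlgebra.spectralOrderedRing E
  have h1 : IsPosElem p := isPos_iff.2 (by
    have := star_mul_self_nonneg p
    rwa [hs, hp] at this)
  have h2 : IsPosElem (1 - p) := isPos_iff.2 (by
    have := star_mul_self_nonneg (1 - p)
    have e : star (1 - p) * (1 - p) = 1 - p := by
      rw [star_sub, star_one, hs]; simp [mul_sub, sub_mul, hp]
    rwa [e] at this)
  refine ⟨p, p, h1, h2, h1, h2, hp, fun x => ?_, fun a ha => ⟨a, by simpa using hε, ?_, ?_⟩⟩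
  · show p * (p * x * p) * p = p * x * p
    rw [show p * (p * x * p) * p = (p * p) * x * (p * p) by simp only [mul_assoc], hp]
  · have : p * a * p = a := hS a ha
    rw [← this]; simp only [← mul_assoc, hp]
  · have : p * a * p = a := hS a ha
    rw [← this]; simp only [mul_assoc, hp]

theorem finsat_lnuc {B : CStarAlg} (h : FinSat lnucClass B) : lnucClass B := by
  induction h with
  | base h => exact h
  | @iso B B' _ e ih =>
    obtain ⟨e⟩ := e
    obtain ⟨hs, n, hn⟩ := ih
    let ι : B'.carrier →⋆ₙₐ[ℂ] B.carrier := (e : B'.carrier →⋆ₙₐ[ℂ] B.carrier)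
    have hi : Function.Injective ι := fun x y h => EquivLike.injective e h
    exact ⟨sep_of_inj ι hi hs, HD_to_nuc (nuc_to_HD hn) ι hi
      (Set.range_eq_univ.2 fun x => EquivLike.surjective e x)⟩
  | @sum B₁ B₂ B _ _ e ih1 ih2 =>
    obtain ⟨e⟩ := e
    obtain ⟨hs1, n, hn⟩ := ih1
    obtain ⟨hs2, m, hm⟩ := ih2
    let ι : B.carrier →⋆ₙₐ[ℂ] (B₁.carrier × B₂.carrier) :=
      (e : B.carrier →⋆ₙₐ[ℂ] (B₁.carrier × B₂.carrier))
    have hi : Function.Injective ι := fun x y h => EquivLike.injective e h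
    exact ⟨sep_of_inj ι hi inferInstance, HD_to_nuc ((nuc_to_HD hn).sum (nuc_to_HD hm)) ι hi
      (Set.range_eq_univ.2 fun x => EquivLike.surjective e x)⟩
  | @matrix B B' k _ e ih =>
    obtain ⟨e⟩ := e
    obtain ⟨hs, n, hn⟩ := ih
    exact ⟨sep_mat e hs, HD_to_nuc ((nuc_to_HD hn).matrix e 0)
      (NonUnitalStarAlgHom.id ℂ B'.carrier) (fun x y h => h)
      (Set.range_eq_univ.2 fun x => ⟨x, rfl⟩)⟩
  | @corner B B' p _ h0 hp hsp hι ih =>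
    obtain ⟨ι, hi, -, hr⟩ := hι
    obtain ⟨hs, n, hn⟩ := ih
    exact ⟨sep_of_inj ι hi hs, HD_to_nuc ((nuc_to_HD hn).cut (her_corner p hp hsp)) ι hi hr⟩

end l7

section l8
variable {E : Type} [CStarAlgebra E]

/-- Hereditary subalgebra generated by `h`. -/
def hHer (h : E) : Set E := closure (Set.range fun x => h * x * h)

theorem her_h {h : E} (hp : IsPosElem h) : Her E (hHer h) := by
  refine ⟨isClosed_closure, fun S ε hS hε => ?_⟩
  let := CStarAlgebra.spectralOrder E
  have := CStarAlgebra.spectralOrderedRing E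
  have h0 : 0 ≤ h := isPos_iff.1 hp
  have hs : IsSelfAdjoint h := .of_nonneg h0
  have hsp : ∀ t ∈ spectrum ℝ h, 0 ≤ t := fun t ht => spectrum_nonneg_of_nonneg h0 ht
  have hx : ∀ a ∈ S, ∃ x, ‖a - h * x * h‖ < ε := by
    intro a ha
    obtain ⟨_, ⟨x, rfl⟩, hb⟩ := Metric.mem_closure_iff.1 (hS a ha) ε hε
    exact ⟨x, by rwa [dist_eq_norm] at hb⟩
  choose! x hx using hx
  have hev : ∀ᶠ y in 𝓝 h, ∀ a ∈ S, ‖a - y * x a * y‖ < ε := by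
    rw [Filter.eventually_all_finset]
    intro a ha
    have hc : Continuous fun y : E => ‖a - y * x a * y‖ := by fun_prop
    exact hc.continuousAt.eventually (gt_mem_nhds (hx a ha))
  obtain ⟨δ, hδ, hδ'⟩ := Metric.eventually_nhds_iff.1 hev
  set η := δ / 3 with hη
  have hη0 : 0 < η := by positivity
  have cm : Continuous fun t : ℝ => (max t η)⁻¹ :=
    (continuous_id.max continuous_const).inv₀ fun t => (lt_max_of_lt_right hη0).ne'
  have cf : Continuous fun t : ℝ => max (t - 2 * η) 0 := by fun_prop
  have ce : Continuous fun t : ℝ => min 1 (max (t - η) 0 / η) := by fun_prop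
  have ce' : Continuous fun t : ℝ => t * (max t η)⁻¹ := continuous_id.mul cm
  set f := cfc (fun t : ℝ => max (t - 2 * η) 0) h with hf
  set e := cfc (fun t : ℝ => min 1 (max (t - η) 0 / η)) h with he
  set e' := cfc (fun t : ℝ => t * (max t η)⁻¹) h with he'
  set m := cfc (fun t : ℝ => (max t η)⁻¹) h with hm
  have hfh : ‖f - h‖ < δ := by
    have : f - h = cfc (fun t : ℝ => max (t - 2 * η) 0 - t) h := by
      rw [← csub cf (continuous_id' : Continuous fun t : ℝ => t), cfc_id' ℝ h]
    rw [this]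
    refine (cnorm (c := 2 * η) (by positivity) fun t ht => ?_).trans_lt (by linarith)
    have := hsp t ht
    rw [abs_le]
    constructor
    · have := le_max_left (t - 2 * η) 0; linarith
    · have : max (t - 2 * η) 0 ≤ t := max_le (by linarith) this
      linarith
  have hef : e * f = f := by
    rw [he, hf, ← cfc_mul _ _ h ce.continuousOn cf.continuousOn]
    refine cfc_congr fun t ht => ?_
    rcases le_total t (2 * η) with h1 | h1
    · rw [max_eq_right (by linarith : t - 2 * η ≤ 0), mul_zero]
    · rw [min_eq_left, one_mul]
      rw [le_div_iff₀ hη0]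
      exact le_max_of_le_left (by linarith)
  have hfe : f * e = f := by
    have := congrArg star hef
    rwa [star_mul, csa, csa] at this
  have he'e : e' * e = e := by
    rw [he, he', ← cfc_mul _ _ h ce'.continuousOn ce.continuousOn]
    refine cfc_congr fun t ht => ?_
    rcases le_total t η with h1 | h1
    · rw [max_eq_right (by linarith : t - η ≤ 0)]; simp
    · rw [max_eq_left h1, mul_inv_cancel₀ (by linarith), one_mul]
  have hb : ∀ {g : ℝ → ℝ}, Continuous g → (∀ t, 0 ≤ t → 0 ≤ g t ∧ g t ≤ 1) →
      IsPosElem (cfc g h) ∧ IsPosElem (1 - cfc g h) := by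
    intro g hg hg1
    refine ⟨isPos_iff.2 (cfc_nonneg fun t ht => (hg1 t (hsp t ht)).1), isPos_iff.2 ?_⟩
    exact sub_nonneg.2 (cfc_le_one _ _ fun t ht => (hg1 t (hsp t ht)).2)
  have hbe := hb ce fun t ht => ⟨le_min zero_le_one (by positivity), min_le_left _ _⟩
  have hbe' := hb ce' fun t ht => ⟨by positivity, by
    rw [← div_eq_mul_inv]; exact div_le_one_of_le₀ (le_max_left _ _) (by positivity)⟩
  refine ⟨e, e', hbe.1, hbe.2, hbe'.1, hbe'.2, he'e, fun y => ?_, fun a ha => ⟨f * x a * f, ?_, ?_, ?_⟩⟩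
  · have h1 : h * m = e' := cidmul hs cm
    have h2 : m * h = e' := by
      rw [hm, cmulid hs cm]; exact cfc_congr fun t _ => mul_comm _ _
    refine subset_closure ⟨m * y * m, ?_⟩
    dsimp only
    calc _ = (h * m) * y * (m * h) := by simp only [mul_assoc]
      _ = _ := by rw [h1, h2]
  · exact hδ' (by rwa [dist_eq_norm]) a ha
  · rw [← mul_assoc, ← mul_assoc, hef]
  · rw [mul_assoc, hfe]

theorem hHer_mul {h a b : E} (ha : a ∈ hHer h) (hb : b ∈ hHer h) : a * b ∈ hHer h := by
  refine map_mem_closure₂ continuous_mul ha hb ?_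
  rintro _ ⟨x, rfl⟩ _ ⟨y, rfl⟩
  exact ⟨x * h * h * y, by simp only [mul_assoc]⟩

theorem hHer_add {h a b : E} (ha : a ∈ hHer h) (hb : b ∈ hHer h) : a + b ∈ hHer h := by
  refine map_mem_closure₂ continuous_add ha hb ?_
  rintro _ ⟨x, rfl⟩ _ ⟨y, rfl⟩
  exact ⟨x + y, by simp only [mul_add, add_mul]⟩

theorem hHer_smul {h a : E} (c : ℂ) (ha : a ∈ hHer h) : c • a ∈ hHer h := by
  refine map_mem_closure (f := fun a => c • a) (by fun_prop) ha ?_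
  rintro _ ⟨x, rfl⟩
  exact ⟨c • x, by simp⟩

theorem hHer_star {h a : E} (hs : star h = h) (ha : a ∈ hHer h) : star a ∈ hHer h := by
  refine map_mem_closure continuous_star ha ?_
  rintro _ ⟨x, rfl⟩
  exact ⟨star x, by simp [hs, mul_assoc]⟩

theorem hHer_zero {h : E} : (0 : E) ∈ hHer h := subset_closure ⟨0, by simp⟩

/-- The unitization of the hereditary subalgebra. -/
def hUnit (h : E) (hs : star h = h) : StarSubalgebra ℂ (E × ℂ) where
  carrier := {x | x.1 - x.2 • 1 ∈ hHer h}
  mul_mem' := fun {a} {b} ha hb => by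
    have : (a * b).1 - (a * b).2 • 1 = (a.1 - a.2 • 1) * (b.1 - b.2 • 1) + a.2 • (b.1 - b.2 • 1)
        + b.2 • (a.1 - a.2 • 1) := by
      simp [mul_sub, sub_mul, smul_sub, mul_smul, smul_comm b.2 a.2]
      abel
    rw [Set.mem_ofPred_eq, this]
    exact hHer_add (hHer_add (hHer_mul ha hb) (hHer_smul _ hb)) (hHer_smul _ ha)
  add_mem' := fun {a} {b} ha hb => by
    have : (a + b).1 - (a + b).2 • 1 = (a.1 - a.2 • 1) + (b.1 - b.2 • 1) := by
      simp [add_smul]; abel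
    rw [Set.mem_ofPred_eq, this]
    exact hHer_add ha hb
  algebraMap_mem' := fun c => by
    have : (algebraMap ℂ (E × ℂ) c).1 - (algebraMap ℂ (E × ℂ) c).2 • 1 = (0 : E) := by
      simp [Algebra.algebraMap_eq_smul_one]
    rw [Set.mem_ofPred_eq, this]
    exact hHer_zero
  star_mem' := fun {a} ha => by
    have : (star a).1 - (star a).2 • 1 = star (a.1 - a.2 • 1) := by simp
    rw [Set.mem_ofPred_eq, this]
    exact hHer_star hs ha

theorem lnuc_unit {B : CStarAlg} (hB : lnucClass B) {h : B.carrier} (hp : IsPosElem h) :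
    ∃ C : CStarAlg, lnucClass C ∧ ∃ j : C.carrier →⋆ₐ[ℂ] B.carrier × ℂ, 
      Set.range j = {x | x.1 - x.2 • 1 ∈ hHer h} := by
  obtain ⟨hs, n, hn⟩ := hB
  have hsa : star h = h := by
    let := CStarAlgebra.spectralOrder B.carrier
    have := CStarAlgebra.spectralOrderedRing B.carrier
    exact IsSelfAdjoint.of_nonneg (isPos_iff.1 hp)
  have hc : IsClosed (hUnit h hsa : Set (B.carrier × ℂ)) := by
    have := (isClosed_closure : IsClosed (hHer h)).preimage
      (f := fun x : B.carrier × ℂ => x.1 - x.2 • (1 : B.carrier)) (by fun_prop)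
    exact this
  have := hc
  let C : CStarAlg := ⟨hUnit h hsa⟩
  let j : C.carrier →⋆ₐ[ℂ] B.carrier × ℂ := (hUnit h hsa).subtype
  have hj : Function.Injective j := Subtype.val_injective
  have hr : Set.range j = {x | x.1 - x.2 • 1 ∈ hHer h} := Subtype.range_val
  refine ⟨C, ⟨sep_of_inj (j : C.carrier →⋆ₙₐ[ℂ] B.carrier × ℂ) hj inferInstance, ?_⟩, j, hr⟩
  exact HD_to_nuc (((nuc_to_HD hn).cut (her_h hp)).unit (her_h hp))
    (j : C.carrier →⋆ₙₐ[ℂ] B.carrier × ℂ) hj hr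

end l8

section l9
variable {A : Type} [CStarAlgebra A]

theorem spec_sub {y : A} (hy : IsSelfAdjoint y) {f : ℝ → ℝ} (hf : Continuous f) {δ : ℝ}
    (h : ‖cfc f y‖ ≤ δ) : ∀ t ∈ spectrum ℝ y, |f t| ≤ δ := fun t ht =>
  (norm_apply_le_norm_cfc f y ht hf.continuousOn hy).trans h

/-- cutoff -/
def cutg (t : ℝ) : ℝ := max 0 (min 1 (2 * t - 1 / 2))

theorem cutg_cont : Continuous cutg := by unfold cutg; fun_prop

theorem cut_proj {y : A} (hy : IsSelfAdjoint y) {δ : ℝ} (hδ : δ < 1 / 8)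
    (h : ‖y * y - y‖ ≤ δ) :
    cfc cutg y * cfc cutg y = cfc cutg y ∧ ‖cfc cutg y - y‖ ≤ 2 * δ := by
  let := CStarAlgebra.spectralOrder A
  have := CStarAlgebra.spectralOrderedRing A
  have hδ0 : 0 ≤ δ := (norm_nonneg _).trans h
  have e : y * y - y = cfc (fun t : ℝ => t * t - t) y := by
    rw [← csub (by fun_prop) (by fun_prop), ← csq hy, cfc_id' ℝ y]
  rw [e] at h
  have hsp := spec_sub hy (by fun_prop) h
  have key : ∀ t ∈ spectrum ℝ y, (cutg t = 0 ∨ cutg t = 1) ∧ |cutg t - t| ≤ 2 * δ := by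
    intro t ht
    have h1 := abs_le.1 (hsp t ht)
    rcases le_total t (1 / 4) with h2 | h2
    · have : cutg t = 0 := max_eq_left ((min_le_right _ _).trans (by linarith))
      rw [this]
      refine ⟨Or.inl rfl, abs_le.2 ⟨?_, ?_⟩⟩ <;> nlinarith
    · rcases le_total (3 / 4) t with h3 | h3
      · have : cutg t = 1 := by
          unfold cutg; rw [min_eq_left (by linarith)]; exact max_eq_right zero_le_one
        rw [this]
        refine ⟨Or.inr rfl, abs_le.2 ⟨?_, ?_⟩⟩ <;> nlinarith
      · exfalso; nlinarith
  constructor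
  · rw [← cfc_mul _ _ y cutg_cont.continuousOn cutg_cont.continuousOn]
    refine cfc_congr fun t ht => ?_
    rcases (key t ht).1 with h | h <;> simp [h]
  · have : cfc cutg y - y = cfc (fun t => cutg t - t) y := by
      rw [← csub cutg_cont (by fun_prop), cfc_id' ℝ y]
    rw [this]
    exact cnorm (by positivity) fun t ht => (key t ht).2

/-- normalizer -/
def rootg (t : ℝ) : ℝ := (Real.sqrt (max t (1 / 2)))⁻¹

theorem rootg_cont : Continuous rootg := by
  unfold rootg
  refine Continuous.inv₀ (by fun_prop) fun t => ?_
  exact (Real.sqrt_pos.2 (lt_max_of_lt_right (by norm_num))).ne'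

theorem root_est {s : A} (hs : IsSelfAdjoint s) {δ : ℝ} (hδ : δ < 1 / 2) (h : ‖s - 1‖ ≤ δ) :
    cfc rootg s * s * cfc rootg s = 1 ∧ s * (cfc rootg s * cfc rootg s) = 1 ∧
      ‖cfc rootg s - 1‖ ≤ 2 * δ := by
  let := CStarAlgebra.spectralOrder A
  have := CStarAlgebra.spectralOrderedRing A
  have hδ0 : 0 ≤ δ := (norm_nonneg _).trans h
  have e1 : ∀ f : ℝ → ℝ, Continuous f → cfc f s - 1 = cfc (fun t : ℝ => f t - 1) s := by
    intro f hf
    rw [← csub hf continuous_const, cfc_const_one ℝ s]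
  have e : s - 1 = cfc (fun t : ℝ => t - 1) s := by
    rw [← e1 _ (by fun_prop), cfc_id' ℝ s]
  rw [e] at h
  have hsp := spec_sub hs (by fun_prop) h
  have key : ∀ t ∈ spectrum ℝ s, rootg t * rootg t * t = 1 ∧ |rootg t - 1| ≤ 2 * δ := by
    intro t ht
    have h1 := abs_le.1 (hsp t ht)
    have h2 : 1 / 2 ≤ t := by linarith
    have e2 : rootg t = (Real.sqrt t)⁻¹ := by unfold rootg; rw [max_eq_left h2]
    have hp : 0 < rootg t := by rw [e2]; positivity
    have h3 : rootg t * rootg t * t = 1 := by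
      rw [e2, ← mul_inv, Real.mul_self_sqrt (by linarith)]
      exact inv_mul_cancel₀ (by linarith)
    refine ⟨h3, ?_⟩
    have h4 : rootg t * rootg t ≤ 2 := by nlinarith [mul_pos hp hp]
    have h5 : |rootg t * rootg t - 1| ≤ 2 * δ := by
      rw [abs_le]; constructor <;> nlinarith [mul_pos hp hp]
    have h6 : rootg t * rootg t - 1 = (rootg t - 1) * (rootg t + 1) := by ring
    rw [h6, abs_mul, abs_of_pos (by linarith : 0 < rootg t + 1)] at h5
    nlinarith [abs_nonneg (rootg t - 1)]
  have hc : cfc rootg s * s = s * cfc rootg s := by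
    rw [cmulid hs rootg_cont, cidmul hs rootg_cont]; exact cfc_congr fun t _ => mul_comm _ _
  have h2 : s * (cfc rootg s * cfc rootg s) = 1 := by
    have c2 : Continuous fun t => rootg t * rootg t := rootg_cont.mul rootg_cont
    rw [← cfc_mul _ _ s rootg_cont.continuousOn rootg_cont.continuousOn, cidmul hs c2,
      ← cfc_const_one ℝ s]
    refine cfc_congr fun t ht => ?_
    have := (key t ht).1
    linarith
  refine ⟨by rw [hc, mul_assoc, h2], h2, ?_⟩
  rw [e1 _ rootg_cont]
  exact cnorm (by positivity) fun t ht => (key t ht).2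

theorem almost_orth {G : Type} [Fintype G] [DecidableEq G] {p : G → A} (hp : ∀ g, p g * p g = p g)
    (hs : ∀ g, star (p g) = p g) {δ : ℝ} (hδ0 : 0 ≤ δ) (h : ‖∑ g, p g - 1‖ ≤ δ * δ) :
    ∀ g k, g ≠ k → ‖p g * p k‖ ≤ δ := by
  let := CStarAlgebra.spectralOrder A
  have := CStarAlgebra.spectralOrderedRing A
  intro g k hgk
  have hn : ‖p k‖ ≤ 1 := by
    have := CStarRing.norm_star_mul_self (x := p k)
    rw [hs, hp] at this
    nlinarith [norm_nonneg (p k)]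
  have hpos : ∀ g, 0 ≤ p k * p g * p k := by
    intro g
    have := star_mul_self_nonneg (p g * p k)
    rwa [star_mul, hs, hs, show p k * p g * (p g * p k) = p k * (p g * p g) * p k by
      simp only [mul_assoc], hp] at this
  have e : p k * (∑ g, p g - 1) * p k = ∑ g ∈ Finset.univ.erase k, p k * p g * p k := by
    rw [mul_sub, sub_mul, Finset.mul_sum, Finset.sum_mul, mul_one, hp,
      ← Finset.add_sum_erase _ _ (Finset.mem_univ k), hp, hp]
    abel
  have hle : p k * p g * p k ≤ p k * (∑ g, p g - 1) * p k := by
    rw [e]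
    exact Finset.single_le_sum (f := fun g => p k * p g * p k) (fun g _ => hpos g)
      (Finset.mem_erase.2 ⟨hgk, Finset.mem_univ _⟩)
  have h1 := CStarAlgebra.norm_le_norm_of_nonneg_of_le (hpos g) hle
  have h2 : ‖p k * (∑ g, p g - 1) * p k‖ ≤ δ * δ := by
    calc _ ≤ ‖p k‖ * ‖∑ g, p g - 1‖ * ‖p k‖ :=
          (norm_mul_le _ _).trans (by gcongr; exact norm_mul_le _ _)
      _ ≤ 1 * (δ * δ) * 1 := by gcongr
      _ = _ := by ring
  have h3 := CStarRing.norm_star_mul_self (x := p g * p k)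
  rw [star_mul, hs, hs, show p k * p g * (p g * p k) = p k * (p g * p g) * p k by
      simp only [mul_assoc], hp] at h3
  nlinarith [norm_nonneg (p g * p k)]

theorem exact_orth {G : Type} [Fintype G] [DecidableEq G] {p : G → A} (hp : ∀ g, p g * p g = p g)
    {δ : ℝ} (hδ0 : 0 ≤ δ) (h : ∀ g k, g ≠ k → ‖p g * p k‖ ≤ δ)
    (hδ : Fintype.card G * δ < 1) {w : A} (hw : (∑ g, p g) * w = 1) (g k : G) :
    p k * w * p g = if k = g then p g else 0 := by
  set y : G → A := fun k => p k * w * p g - if k = g then p g else 0 with hy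
  have hsum : ∑ k, y k = 0 := by
    simp only [hy, Finset.sum_sub_distrib, ← Finset.sum_mul, hw, one_mul]
    simp
  have hpy : ∀ k, p k * y k = y k := by
    intro k
    simp only [hy, mul_sub, ← mul_assoc, hp]
    split_ifs with hk
    · subst hk; rw [hp]
    · simp
  have h1 : ∀ k, ‖y k‖ ≤ δ * ∑ l, ‖y l‖ := by
    intro k
    have h2 : p k * ∑ l, y l = 0 := by rw [hsum, mul_zero]
    rw [Finset.mul_sum, ← Finset.add_sum_erase _ _ (Finset.mem_univ k), hpy] at h2
    rw [eq_neg_of_add_eq_zero_left h2, norm_neg]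
    calc _ ≤ ∑ l ∈ Finset.univ.erase k, ‖p k * y l‖ := norm_sum_le _ _
      _ ≤ ∑ l ∈ Finset.univ.erase k, δ * ‖y l‖ := by
          refine Finset.sum_le_sum fun l hl => ?_
          rw [← hpy l, ← mul_assoc, hpy l]
          refine (norm_mul_le _ _).trans ?_
          gcongr
          exact h k l (Finset.ne_of_mem_erase hl).symm
      _ ≤ ∑ l, δ * ‖y l‖ := Finset.sum_le_sum_of_subset_of_nonneg (Finset.erase_subset _ _)
          fun _ _ _ => by positivity
      _ = _ := by rw [Finset.mul_sum]
  have h2 : ∑ l, ‖y l‖ ≤ Fintype.card G * δ * ∑ l, ‖y l‖ := by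
    calc _ ≤ ∑ l : G, δ * ∑ l, ‖y l‖ := Finset.sum_le_sum fun l _ => h1 l
      _ = _ := by simp [mul_assoc]
  have h3 : ∑ l, ‖y l‖ = 0 := by
    have : 0 ≤ ∑ l, ‖y l‖ := Finset.sum_nonneg fun _ _ => norm_nonneg _
    nlinarith
  have h4 := (Finset.sum_eq_zero_iff_of_nonneg (fun _ _ => norm_nonneg _)).1 h3 k (Finset.mem_univ _)
  exact sub_eq_zero.1 (norm_eq_zero.1 h4)

end l9

section l10
variable {A : Type} [CStarAlgebra A] {G : Type} [Group G] [Fintype G]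

theorem hom_cont {D E : Type} [CStarAlgebra D] [CStarAlgebra E] (ρ : D →⋆ₐ[ℂ] E) :
    Continuous ρ :=
  AddMonoidHomClass.continuous_of_bound ρ 1 fun x => by
    rw [one_mul]; exact NonUnitalStarAlgHom.norm_apply_le ρ x

theorem hom_norm {D E : Type} [CStarAlgebra D] [CStarAlgebra E] (ρ : D →⋆ₐ[ℂ] E) (x : D) :
    ‖ρ x‖ ≤ ‖x‖ := NonUnitalStarAlgHom.norm_apply_le ρ x

theorem hom_cfc {D E : Type} [CStarAlgebra D] [CStarAlgebra E] (ρ : D →⋆ₐ[ℂ] E) {f : ℝ → ℝ}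
    (hf : Continuous f) {x : D} (hx : IsSelfAdjoint x) : ρ (cfc f x) = cfc f (ρ x) :=
  StarAlgHomClass.map_cfc (S := ℂ) ρ f x hf.continuousOn (hom_cont ρ) hx (hx.map ρ)

theorem rok_elem (α : G → (A →⋆ₐ[ℂ] A)) (hRok : ActionHasRokhlin α) (S : Finset A) :
    ∃ M : ℝ, 0 ≤ M ∧ ∀ τ > 0, ∃ x : A, ‖x‖ ≤ M ∧ ‖x * x - x‖ < τ ∧ ‖star x - x‖ < τ ∧
      (∀ a ∈ S, ‖x * a - a * x‖ < τ) ∧ ‖∑ g, α g x - 1‖ < τ := by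
  obtain ⟨e, hb, h1, h2, h3, h4, h5⟩ := hRok
  obtain ⟨M, hM⟩ := hb 1
  refine ⟨M, (norm_nonneg _).trans (hM 0), fun τ hτ => ?_⟩
  have h6 : Tendsto (fun k => ‖∑ g, α g (e 1 k) - 1‖) atTop (𝓝 0) := by
    have ht : Tendsto (fun k => (∑ g, ‖α g (e 1 k) - e (g * 1) k‖) + ‖∑ g, e g k - 1‖)
        atTop (𝓝 ((∑ g : G, 0) + 0)) :=
      (tendsto_finsetSum _ fun g _ => h5 g 1).add h4
    simp only [Finset.sum_const_zero, add_zero] at ht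
    refine squeeze_zero (fun _ => norm_nonneg _) (fun k => ?_) ht
    have : ∑ g, α g (e 1 k) - 1 = (∑ g, (α g (e 1 k) - e (g * 1) k)) + (∑ g, e g k - 1) := by
      simp only [mul_one, Finset.sum_sub_distrib]; abel
    rw [this]
    refine (norm_add_le _ _).trans ?_
    gcongr
    exact norm_sum_le _ _
  have hS : ∀ᶠ k in atTop, ∀ a ∈ S, ‖e 1 k * a - a * e 1 k‖ < τ := by
    rw [Filter.eventually_all_finset]
    exact fun a _ => (h3 1 a).eventually (gt_mem_nhds hτ)
  obtain ⟨k, k1, k2, k3, k4⟩ := (((h1 1).eventually (gt_mem_nhds hτ)).and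
    (((h2 1).eventually (gt_mem_nhds hτ)).and (hS.and (h6.eventually (gt_mem_nhds hτ))))).exists
  exact ⟨e 1 k, hM k, k1, k2, k3, k4⟩

theorem rok_data (hA : HasLocallyFiniteNuclearDimension A) (α : G → (A →⋆ₐ[ℂ] A))
    (hRok : ActionHasRokhlin α) (S : Finset A) (ε : ℝ) (hε : 0 < ε) :
    ∃ B : CStarAlg, FinSat lnucClass B ∧ ∃ (ρ : B.carrier →⋆ₐ[ℂ] A) (h : B.carrier),
      IsPosElem h ∧ ρ h * ρ h = ρ h ∧ star (ρ h) = ρ h ∧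
      (∀ a ∈ S, (∃ b, ‖a - ρ b‖ < ε) ∧ ‖ρ h * a - a * ρ h‖ < ε) ∧
      ‖∑ g, α g (ρ h) - 1‖ < ε := by
  classical
  obtain ⟨M, hM0, hM⟩ := rok_elem α hRok S
  obtain ⟨N, hN0, hN⟩ : ∃ N : ℝ, 0 ≤ N ∧ ∀ a ∈ S, ‖a‖ ≤ N :=
    ⟨∑ a ∈ S, ‖a‖, Finset.sum_nonneg fun _ _ => norm_nonneg _, fun a ha =>
      Finset.single_le_sum (f := fun a => ‖a‖) (fun _ _ => norm_nonneg _) ha⟩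
  set K : ℝ := (Fintype.card G : ℝ) with hK
  have hK0 : 0 ≤ K := by positivity
  obtain ⟨δ, hδ0, hδ1, hδε⟩ : ∃ δ : ℝ, 0 < δ ∧ δ < 1 / 8 ∧ δ * (1 + 8 * N + 4 * K) < ε := by
    refine ⟨min (1 / 9) (ε / (2 * (1 + 8 * N + 4 * K))), by positivity, ?_, ?_⟩
    · exact (min_le_left _ _).trans_lt (by norm_num)
    · calc _ ≤ (ε / (2 * (1 + 8 * N + 4 * K))) * (1 + 8 * N + 4 * K) := by
            gcongr; exact min_le_right _ _
        _ = ε / 2 := by field_simp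
        _ < ε := by linarith
  set τ := δ / (4 * M + 7) with hτ
  have hτ0 : 0 < τ := by positivity
  have hτM : τ * (4 * M + 7) = δ := by rw [hτ]; field_simp
  have hτδ : τ ≤ δ := by nlinarith [mul_nonneg hτ0.le hM0]
  obtain ⟨x, x0, x1, x2, x3, x4⟩ := hM τ hτ0
  obtain ⟨B, hB, ρ, hρ⟩ := hA (insert x S) τ hτ0
  obtain ⟨b, hb⟩ := hρ x (Finset.mem_insert_self _ _)
  set c : B.carrier := (1 / 2 : ℂ) • (b + star b) with hc
  have hcs : IsSelfAdjoint c := by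
    rw [IsSelfAdjoint, hc, star_smul, star_add, star_star, add_comm]; simp
  set y := ρ c with hy
  have hys : IsSelfAdjoint y := hcs.map ρ
  have hyx : ‖y - x‖ ≤ 2 * τ := by
    have e : y - x = (1 / 2 : ℂ) • (-(x - ρ b) + (-(star (x - ρ b)) + (star x - x))) := by
      rw [hy, hc, map_smul, map_add, map_star, star_sub]
      have : x = (1 / 2 : ℂ) • (x + x) := by rw [← two_smul ℂ x, smul_smul]; norm_num
      conv_lhs => rw [this]
      rw [← smul_sub]
      congr 1; abel
    rw [e, norm_smul]
    have h1 : ‖-(x - ρ b) + (-(star (x - ρ b)) + (star x - x))‖ ≤ τ + (τ + τ) := by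
      refine (norm_add_le _ _).trans (add_le_add ?_ ((norm_add_le _ _).trans (add_le_add ?_ x2.le)))
      · rw [norm_neg]; exact hb.le
      · rw [norm_neg, norm_star]; exact hb.le
    have h2 : ‖(1 / 2 : ℂ)‖ = 1 / 2 := by norm_num
    rw [h2]
    linarith
  have hyy : ‖y * y - y‖ ≤ δ := by
    have e : y * y - y = (x * x - x) + ((y - x) * (y - x) + ((y - x) * x + (x * (y - x) - (y - x)))) := by
      noncomm_ring
    have h1 : ‖(y - x) * (y - x)‖ ≤ (2 * τ) * (2 * τ) := (norm_mul_le _ _).trans (by gcongr)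
    have h2 : ‖(y - x) * x‖ ≤ (2 * τ) * M := (norm_mul_le _ _).trans (by gcongr)
    have h3 : ‖x * (y - x)‖ ≤ M * (2 * τ) := (norm_mul_le _ _).trans (by gcongr)
    have h4 : ‖y * y - y‖ ≤ τ + ((2 * τ) * (2 * τ) + ((2 * τ) * M + (M * (2 * τ) + 2 * τ))) := by
      rw [e]
      refine (norm_add_le _ _).trans (add_le_add x1.le ((norm_add_le _ _).trans (add_le_add h1
        ((norm_add_le _ _).trans (add_le_add h2 ((norm_sub_le _ _).trans (add_le_add h3 hyx)))))))
    refine h4.trans ?_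
    rw [← hτM]
    nlinarith
  obtain ⟨hq, hqy⟩ := cut_proj hys hδ1 hyy
  have hρh : ρ (cfc cutg c) = cfc cutg y := hom_cfc ρ cutg_cont hcs
  set q := cfc cutg y with hqdef
  have hqx : ‖q - x‖ ≤ 4 * δ := by
    calc ‖q - x‖ = ‖(q - y) + (y - x)‖ := by congr 1; abel
      _ ≤ 2 * δ + 2 * τ := (norm_add_le _ _).trans (add_le_add hqy hyx)
      _ ≤ _ := by linarith
  refine ⟨B, hB, ρ, cfc cutg c, ?_, ?_, ?_, ?_, ?_⟩
  · let := CStarAlgebra.spectralOrder B.carrier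
    have := CStarAlgebra.spectralOrderedRing B.carrier
    exact isPos_iff.2 (cfc_nonneg fun t _ => le_max_left _ _)
  · rw [hρh, hq]
  · rw [hρh]
    let := CStarAlgebra.spectralOrder A
    have := CStarAlgebra.spectralOrderedRing A
    exact csa _ _
  · intro a ha
    have hlt : τ < ε := by nlinarith [mul_nonneg hδ0.le hN0, mul_nonneg hδ0.le hK0]
    refine ⟨?_, ?_⟩
    · obtain ⟨b, hb⟩ := hρ a (Finset.mem_insert_of_mem ha)
      exact ⟨b, hb.trans hlt⟩
    · rw [hρh]
      have e : q * a - a * q = (x * a - a * x) + ((q - x) * a - a * (q - x)) := by noncomm_ring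
      have h1 : ‖(q - x) * a‖ ≤ 4 * δ * N := (norm_mul_le _ _).trans (by gcongr; exact hN a ha)
      have h2 : ‖a * (q - x)‖ ≤ N * (4 * δ) := (norm_mul_le _ _).trans (by gcongr; exact hN a ha)
      have h3 : ‖q * a - a * q‖ ≤ τ + (4 * δ * N + N * (4 * δ)) := by
        rw [e]
        exact (norm_add_le _ _).trans (add_le_add (x3 a ha).le ((norm_sub_le _ _).trans
          (add_le_add h1 h2)))
      nlinarith [mul_nonneg hδ0.le hN0, mul_nonneg hδ0.le hK0]
  · rw [hρh]
    have e : ∑ g, α g q - 1 = (∑ g, α g x - 1) + ∑ g, α g (q - x) := by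
      simp only [map_sub, Finset.sum_sub_distrib]; abel
    have h1 : ‖∑ g, α g (q - x)‖ ≤ K * (4 * δ) := by
      calc _ ≤ ∑ g, ‖α g (q - x)‖ := norm_sum_le _ _
        _ ≤ ∑ g : G, 4 * δ := Finset.sum_le_sum fun g _ => (hom_norm _ _).trans hqx
        _ = _ := by simp [hK]
    have h2 : ‖∑ g, α g q - 1‖ ≤ τ + K * (4 * δ) := by
      rw [e]; exact (norm_add_le _ _).trans (add_le_add x4.le h1)
    nlinarith [mul_nonneg hδ0.le hN0, mul_nonneg hδ0.le hK0]

theorem act_sum (α : G → (A →⋆ₐ[ℂ] A)) (hact : IsGroupAction α) (x : A) (k : G) :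
    α k (∑ g, α g x) = ∑ g, α g x := by
  rw [map_sum]
  simp only [hact.2]
  exact Fintype.sum_equiv (Equiv.mulLeft k) _ _ fun g => rfl

/-- The corner-averaging homomorphism. -/
def theta {C : Type} [CStarAlgebra C] (α : G → (A →⋆ₐ[ℂ] A)) (hact : IsGroupAction α)
    [DecidableEq G] (σ : C →⋆ₐ[ℂ] A) (q r : A) (hq : q * q = q) (hqs : star q = q)
    (hrs : star r = r) (hr : ∀ g, α g r = r) (hcomm : ∀ c, q * σ c = σ c * q)
    (horth : ∀ g k, α k q * (r * r) * α g q = if k = g then α g q else 0)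
    (hone : r * (∑ g, α g q) * r = 1) : C →⋆ₐ[ℂ] fixedPointAlgebra α where
  toFun := fun c => ⟨r * (∑ g, α g (q * σ c * q)) * r, fun k => by
    rw [map_mul, map_mul, hr, act_sum α hact]⟩
  map_one' := by
    apply Subtype.ext
    simp only [map_one, mul_one, hq]
    exact hone
  map_mul' := fun x y => by
    apply Subtype.ext
    change r * (∑ g, α g (q * σ (x * y) * q)) * r =
      (r * (∑ g, α g (q * σ x * q)) * r) * (r * (∑ g, α g (q * σ y * q)) * r)
    have e : ∀ g k, α k (q * σ x * q) * (r * r) * α g (q * σ y * q) =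
        if k = g then α g (q * σ (x * y) * q) else 0 := by
      intro g k
      have : α k (q * σ x * q) * (r * r) * α g (q * σ y * q) =
          α k (q * σ x) * (α k q * (r * r) * α g q) * α g (σ y * q) := by
        simp only [map_mul, mul_assoc]
      rw [this, horth]
      split_ifs with h
      · subst h
        rw [← map_mul, ← map_mul, map_mul σ]
        congr 1
        calc q * σ x * q * (σ y * q) = q * (σ x * q) * σ y * q := by simp only [mul_assoc]
          _ = (q * q) * (σ x * σ y) * q := by rw [← hcomm]; simp only [mul_assoc]
          _ = _ := by rw [hq]
      · simp
    calc _ = r * (∑ k, ∑ g, α k (q * σ x * q) * (r * r) * α g (q * σ y * q)) * r := by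
          simp only [e, Finset.sum_ite_eq, Finset.mem_univ, if_true]
      _ = r * ((∑ g, α g (q * σ x * q)) * (r * r) * (∑ g, α g (q * σ y * q))) * r := by
          congr 2
          rw [Finset.sum_mul, Finset.sum_mul_sum]
      _ = _ := by simp only [mul_assoc]
  map_zero' := by apply Subtype.ext; simp
  map_add' := fun x y => by
    apply Subtype.ext
    change _ = r * (∑ g, α g (q * σ x * q)) * r + r * (∑ g, α g (q * σ y * q)) * r
    simp only [map_add, mul_add, add_mul, Finset.sum_add_distrib]
  commutes' := fun c => by
    apply Subtype.ext
    change r * (∑ g, α g (q * σ (algebraMap ℂ C c) * q)) * r = algebraMap ℂ A c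
    simp only [Algebra.algebraMap_eq_smul_one, map_smul, map_one, mul_smul_comm, smul_mul_assoc,
      mul_one, hq, ← Finset.smul_sum, hone]
  map_star' := fun x => by
    apply Subtype.ext
    change _ = star (r * (∑ g, α g (q * σ x * q)) * r)
    simp only [star_mul, star_sum, hrs, ← map_star, hqs, mul_assoc]

theorem comm_of_her {B : CStarAlg} (ρ : B.carrier →⋆ₐ[ℂ] A) (h : B.carrier)
    (hq : ρ h * ρ h = ρ h) {y : B.carrier} (hy : y ∈ hHer h) : ρ h * ρ y = ρ y * ρ h := by
  have hc : IsClosed {y | ρ h * ρ y = ρ y * ρ h} :=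
    isClosed_eq (continuous_const.mul (hom_cont ρ)) ((hom_cont ρ).mul continuous_const)
  refine closure_minimal ?_ hc hy
  rintro _ ⟨x, rfl⟩
  change ρ h * ρ (h * x * h) = ρ (h * x * h) * ρ h
  rw [map_mul, map_mul, mul_assoc (ρ h * ρ x), hq, ← mul_assoc, ← mul_assoc, hq]

end l10

section l11

theorem main_thm (A : Type) [CStarAlgebra A] (hA : HasLocallyFiniteNuclearDimension A)
    (G : Type) [Group G] [Fintype G] (α : G → (A →⋆ₐ[ℂ] A)) (hact : IsGroupAction α)
    (hRok : ActionHasRokhlin α) : HasLocallyFiniteNuclearDimension (fixedPointAlgebra α) := by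
  classical
  intro S ε hε
  obtain ⟨N, hN0, hN⟩ : ∃ N : ℝ, 0 ≤ N ∧ ∀ a ∈ S, ‖(a : A)‖ ≤ N :=
    ⟨∑ a ∈ S, ‖(a : A)‖, Finset.sum_nonneg fun _ _ => norm_nonneg _, fun a ha =>
      Finset.single_le_sum (f := fun a : fixedPointAlgebra α => ‖(a : A)‖)
        (fun _ _ => norm_nonneg _) ha⟩
  set K : ℝ := (Fintype.card G : ℝ) with hK
  have hK0 : 0 ≤ K := by positivity
  obtain ⟨δ, hδ0, hδ1, hδK, hδε⟩ : ∃ δ : ℝ, 0 < δ ∧ δ < 1 / 2 ∧ K * δ < 1 ∧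
      δ * (8 * K + 16 * N) < ε := by
    refine ⟨min (1 / 3) (min (1 / (K + 1)) (ε / (2 * (1 + 8 * K + 16 * N)))), by positivity,
      ?_, ?_, ?_⟩
    · exact (min_le_left _ _).trans_lt (by norm_num)
    · calc _ ≤ K * (1 / (K + 1)) := by
            gcongr; exact (min_le_right _ _).trans (min_le_left _ _)
        _ < 1 := by rw [mul_one_div, div_lt_one (by positivity)]; linarith
    · calc _ ≤ (ε / (2 * (1 + 8 * K + 16 * N))) * (1 + 8 * K + 16 * N) := by
            gcongr
            · exact (min_le_right _ _).trans (min_le_right _ _)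
            · linarith
        _ = ε / 2 := by field_simp
        _ < ε := by linarith
  have hδδ : δ * δ ≤ δ := by nlinarith
  obtain ⟨B, hB, ρ, h, hpos, hq, hqs, hS, hsum⟩ :=
    rok_data hA α hRok (S.image Subtype.val) (δ * δ) (by positivity)
  obtain ⟨C, hC, j, hj⟩ := lnuc_unit (finsat_lnuc hB) hpos
  set q := ρ h with hqd
  set s := ∑ g, α g q with hs
  have hpp : ∀ g, α g q * α g q = α g q := fun g => by rw [← map_mul, hq]
  have hps : ∀ g, star (α g q) = α g q := fun g => by rw [← map_star, hqs]
  have hss : IsSelfAdjoint s := by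
    rw [IsSelfAdjoint, hs, star_sum]; exact Finset.sum_congr rfl fun g _ => hps g
  have hao := almost_orth hpp hps hδ0.le hsum.le
  obtain ⟨r1, r2, r3⟩ := root_est hss hδ1 (hsum.le.trans hδδ)
  have hrs : star (cfc rootg s) = cfc rootg s :=
    (cfc_predicate (p := IsSelfAdjoint) rootg s).star_eq
  have hr : ∀ g, α g (cfc rootg s) = cfc rootg s := fun g => by
    rw [hom_cfc _ rootg_cont hss, hs, act_sum α hact]
  set r := cfc rootg s with hrd
  have horth := exact_orth hpp hδ0.le hao hδK r2
  let σ : C.carrier →⋆ₐ[ℂ] A := (ρ.comp (StarAlgHom.fst ℂ B.carrier ℂ)).comp j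
  have hcomm : ∀ c, q * σ c = σ c * q := by
    intro c
    have h1 : j c ∈ {x : B.carrier × ℂ | x.1 - x.2 • 1 ∈ hHer h} := hj ▸ ⟨c, rfl⟩
    have h2 := comm_of_her ρ h hq h1
    rw [map_sub, map_smul, map_one, mul_sub, sub_mul, mul_smul_comm, mul_one, smul_mul_assoc,
      one_mul] at h2
    exact sub_left_injective h2
  refine ⟨C, .base hC, theta α hact σ q r hq hqs hrs hr hcomm horth r1, fun a ha => ?_⟩
  obtain ⟨⟨b, hb⟩, hqa⟩ := hS a (Finset.mem_image_of_mem _ ha)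
  obtain ⟨c, hc⟩ : ∃ c, j c = (h * b * h, 0) := by
    have : ((h * b * h, 0) : B.carrier × ℂ) ∈ Set.range j := by
      rw [hj]
      change h * b * h - (0 : ℂ) • 1 ∈ hHer h
      rw [zero_smul, sub_zero]
      exact subset_closure ⟨b, rfl⟩
    exact this
  refine ⟨c, ?_⟩
  change ‖(a : A) - r * (∑ g, α g (q * σ c * q)) * r‖ < ε
  have hσ : σ c = q * ρ b * q := by
    change ρ (j c).1 = _
    rw [hc]; simp [hqd]
  have hσ' : q * σ c * q = q * ρ b * q := by
    rw [hσ]; simp only [← mul_assoc, hq]; rw [mul_assoc (q * ρ b), hq]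
  rw [hσ']
  have hqn : ‖q‖ ≤ 1 := by
    have := CStarRing.norm_star_mul_self (x := q)
    rw [hqs, hq] at this
    nlinarith [norm_nonneg q]
  have hrn : ‖r‖ ≤ 2 := by
    calc ‖r‖ = ‖(r - 1) + 1‖ := by congr 1; abel
      _ ≤ 2 * δ + 1 := (norm_add_le _ _).trans (add_le_add r3 (one_norm_le A))
      _ ≤ 2 := by linarith
  have hsn : ‖s‖ ≤ 2 := by
    calc ‖s‖ = ‖(s - 1) + 1‖ := by congr 1; abel
      _ ≤ δ + 1 := (norm_add_le _ _).trans (add_le_add (hsum.le.trans hδδ) (one_norm_le A))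
      _ ≤ 2 := by linarith
  have hag : ∀ g, α g (a : A) = a := fun g => a.2 g
  have hone : ‖q * ρ b * q - q * a‖ ≤ 2 * δ := by
    have e : q * ρ b * q - q * a = -(q * (a - ρ b) * q) + -(q * (q * a - a * q)) := by
      have : q * (q * a) = q * a := by rw [← mul_assoc, hq]
      rw [mul_sub q (q * (a : A)), this]; noncomm_ring
    have h1 : ‖q * (a - ρ b) * q‖ ≤ 1 * δ * 1 := by
      refine (norm_mul_le _ _).trans ?_
      gcongr
      refine (norm_mul_le _ _).trans ?_
      gcongr
      exact hb.le.trans hδδ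
    have h2 : ‖q * (q * a - a * q)‖ ≤ 1 * δ := by
      refine (norm_mul_le _ _).trans ?_
      gcongr
      exact hqa.le.trans hδδ
    rw [e]
    refine (norm_add_le _ _).trans ?_
    rw [norm_neg, norm_neg]
    linarith
  have hT : ‖(∑ g, α g (q * ρ b * q)) - s * a‖ ≤ K * (2 * δ) := by
    have e : (∑ g, α g (q * ρ b * q)) - s * a = ∑ g, α g (q * ρ b * q - q * a) := by
      rw [hs, Finset.sum_mul, ← Finset.sum_sub_distrib]
      refine Finset.sum_congr rfl fun g _ => ?_
      rw [map_sub, map_mul _ q (a : A), hag]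
    rw [e]
    calc _ ≤ ∑ g, ‖α g (q * ρ b * q - q * a)‖ := norm_sum_le _ _
      _ ≤ ∑ g : G, 2 * δ := Finset.sum_le_sum fun g _ => (hom_norm _ _).trans hone
      _ = _ := by simp [hK]
  set T := ∑ g, α g (q * ρ b * q) with hTd
  have e : (a : A) - r * T * r = -(r * (T - s * a) * r) +
      -(r * s * (a * (r - 1) - (r - 1) * a)) := by
    have e1 : r * s * (a * (r - 1) - (r - 1) * a) = r * s * a * r - (r * s * r) * a := by
      noncomm_ring
    rw [e1, r1, one_mul]; noncomm_ring
  have h1 : ‖r * (T - s * a) * r‖ ≤ 2 * (K * (2 * δ)) * 2 := by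
    refine (norm_mul_le _ _).trans ?_
    gcongr
    refine (norm_mul_le _ _).trans ?_
    gcongr
  have h2 : ‖(a : A) * (r - 1) - (r - 1) * a‖ ≤ N * (2 * δ) + 2 * δ * N := by
    refine (norm_sub_le _ _).trans (add_le_add ?_ ?_)
    · exact (norm_mul_le _ _).trans (by gcongr; exact hN a ha)
    · exact (norm_mul_le _ _).trans (by gcongr; exact hN a ha)
  have h3 : ‖r * s * (a * (r - 1) - (r - 1) * a)‖ ≤ 2 * 2 * (N * (2 * δ) + 2 * δ * N) := by
    refine (norm_mul_le _ _).trans ?_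
    gcongr
    refine (norm_mul_le _ _).trans ?_
    gcongr
  rw [e]
  refine ((norm_add_le _ _).trans (add_le_add (norm_neg _).le (norm_neg _).le)).trans_lt ?_
  linarith

end l11

open TopologicalSpace in
theorem stmt4 (A : Type) [CStarAlgebra A] [SeparableSpace A]
    (hA : HasLocallyFiniteNuclearDimension A)
    (G : Type) [Group G] [Fintype G] (α : G → (A →⋆ₐ[ℂ] A))
    (hact : IsGroupAction α) (hRok : ActionHasRokhlin α) :
    HasLocallyFiniteNuclearDimension (fixedPointAlgebra α) := by
  exact main_thm A hA G α hact hRok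

end
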